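/- Let Z be a minimal Banach space with a Schauder basis and not containing an isomorphic copy of ℓ₁. Then there exists a map f_Z : ω₁ → ω₁ such that for every countable ordinal ξ, every separable Banach space X with φ_{NC_Z}(X) ≤ ξ embeds isometrically into a Banach space Y with a Schauder basis satisfying φ_{NC_Z}(Y) ≤ f_Z(ξ). -/

import Mathlib

open Filter Topology MeasureTheory

noncomputable section

/-! ### The Cantor set and the space `C(2^ℕ)` -/

/-- The Cantor set `2^ℕ`. -/
abbrev CantorSet : Type := ℕ → Bool

/-- The Banach space `C(2^ℕ)` of continuous real-valued functions on the Cantor set. -/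
abbrev CantorC : Type := C(CantorSet, ℝ)

/-! ### The standard Borel space `SB` of separable Banach spaces -/

/-- `SB`: the set of closed linear subspaces of `C(2^ℕ)`. -/
def SB : Type := {Y : Submodule ℝ CantorC // IsClosed (Y : Set CantorC)}

/-- The Effros-Borel σ-algebra on `SB`, generated by the sets
`{Y : Y ∩ U ≠ ∅}` for `U` open in `C(2^ℕ)`. -/
instance : MeasurableSpace SB :=
  MeasurableSpace.generateFrom
    {A : Set SB | ∃ U : Set CantorC, IsOpen U ∧ A = {Y : SB | ((Y.1 : Set CantorC) ∩ U).Nonempty}}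

/-- A subset of a standard Borel space is analytic if it is the image of a Borel map
from the Baire space `ℕ^ℕ`. -/
def IsAnalyticIn {α : Type*} [MeasurableSpace α] (A : Set α) : Prop :=
  ∃ f : (ℕ → ℕ) → α, Measurable f ∧ A = Set.range f

/-! ### Embeddings, isomorphisms, universality -/

/-- `X` embeds isomorphically into `Y`: there is a bounded linear map which is
bounded below, i.e. an isomorphism onto its range. -/
def Embeds (X Y : Type*) [SeminormedAddCommGroup X] [NormedSpace ℝ X]
    [SeminormedAddCommGroup Y] [NormedSpace ℝ Y] : Prop :=
  ∃ (T : X →L[ℝ] Y) (c : ℝ), 0 < c ∧ ∀ x : X, c * ‖x‖ ≤ ‖T x‖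

/-- `X` embeds isometrically into `Y` (i.e. `Y` contains an isometric copy of `X`). -/
def EmbedsIsometrically (X Y : Type*) [SeminormedAddCommGroup X] [NormedSpace ℝ X]
    [SeminormedAddCommGroup Y] [NormedSpace ℝ Y] : Prop :=
  Nonempty (X →ₗᵢ[ℝ] Y)

/-- `X` and `Y` are isomorphic Banach spaces (linearly homeomorphic). -/
def IsomorphicTo (X Y : Type*) [SeminormedAddCommGroup X] [NormedSpace ℝ X]
    [SeminormedAddCommGroup Y] [NormedSpace ℝ Y] : Prop :=
  Nonempty (X ≃L[ℝ] Y)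

/-- The class `NU ⊆ SB` of non-universal spaces: those `X ∈ SB` which do not contain
an isomorphic copy of `C(2^ℕ)` (equivalently, are not universal for all separable
Banach spaces). -/
def NU : Set SB := {Y : SB | ¬ Embeds CantorC Y.1}

/-- The class `NC_X ⊆ SB` of all `Y ∈ SB` containing no isomorphic copy of `X`. -/
def NCin (X : Type*) [SeminormedAddCommGroup X] [NormedSpace ℝ X] : Set SB :=
  {Y : SB | ¬ Embeds X Y.1}

/-! ### Schauder bases -/

/-- `x` is a Schauder basis of `E`: every vector has a unique representation as a
norm convergent series `Σ aₙ • xₙ`. -/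
def IsSchauderBasis {E : Type*} [SeminormedAddCommGroup E] [NormedSpace ℝ E]
    (x : ℕ → E) : Prop :=
  ∀ y : E, ∃! a : ℕ → ℝ,
    Tendsto (fun m => ∑ n ∈ Finset.range m, a n • x n) atTop (𝓝 y)

/-- `E` has a Schauder basis. -/
def HasSchauderBasis (E : Type*) [SeminormedAddCommGroup E] [NormedSpace ℝ E] : Prop :=
  ∃ x : ℕ → E, IsSchauderBasis x

/-- `x` is a monotone basis sequence: initial-segment projections have norm at most 1. -/
def IsMonotoneSeq {E : Type*} [SeminormedAddCommGroup E] [NormedSpace ℝ E]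
    (x : ℕ → E) : Prop :=
  ∀ (a : ℕ → ℝ) (k m : ℕ), k ≤ m →
    ‖∑ n ∈ Finset.range k, a n • x n‖ ≤ ‖∑ n ∈ Finset.range m, a n • x n‖

/-- `x` is a bi-monotone sequence: interval projections have norm at most 1. -/
def IsBimonotoneSeq {E : Type*} [SeminormedAddCommGroup E] [NormedSpace ℝ E]
    (x : ℕ → E) : Prop :=
  ∀ (a : ℕ → ℝ) (j k m : ℕ), j ≤ k → k ≤ m →
    ‖∑ n ∈ Finset.Ico j k, a n • x n‖ ≤ ‖∑ n ∈ Finset.range m, a n • x n‖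

/-- `x` is a Schauder basic sequence: it is a Schauder basis of its closed linear span. -/
def IsSchauderBasicSeq {E : Type*} [NormedAddCommGroup E] [NormedSpace ℝ E]
    (x : ℕ → E) : Prop :=
  ∀ y ∈ (Submodule.span ℝ (Set.range x)).topologicalClosure,
    ∃! a : ℕ → ℝ,
      Tendsto (fun m => ∑ n ∈ Finset.range m, a n • x n) atTop (𝓝 y)

/-! ### Trees, ordinal ranks and Bourgain's index -/

/-- A tree on `Λ`: a set of finite sequences closed under initial segments. -/
def IsTree {Λ : Type*} (T : Set (List Λ)) : Prop :=
  ∀ s t : List Λ, s <+: t → t ∈ T → s ∈ T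

/-- A pruned tree: every node has a proper extension in the tree. -/
def IsPruned {Λ : Type*} (T : Set (List Λ)) : Prop :=
  ∀ t ∈ T, ∃ a : Λ, t ++ [a] ∈ T

/-- `σ` is an infinite branch of `T`. -/
def IsBranch {Λ : Type*} (T : Set (List Λ)) (σ : ℕ → Λ) : Prop :=
  ∀ n : ℕ, (List.ofFn fun i : Fin n => σ i) ∈ T

/-- `T` is ill-founded: it has an infinite branch. -/
def TreeIllFounded {Λ : Type*} (T : Set (List Λ)) : Prop :=
  ∃ σ : ℕ → Λ, IsBranch T σ

/-- The derivative of a tree: its non-maximal nodes, i.e. nodes having a proper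
extension in the tree. -/
def treeDeriv {Λ : Type*} (T : Set (List Λ)) : Set (List Λ) :=
  {l | l ∈ T ∧ ∃ a : Λ, l ++ [a] ∈ T}

/-- The iterated derivatives `T^(ξ)` of a tree, defined by transfinite recursion. -/
def treeDerivIter {Λ : Type*} (T : Set (List Λ)) (ξ : Ordinal.{0}) : Set (List Λ) :=
  Ordinal.limitRecOn ξ T (fun _ S => treeDeriv S)
    (fun o _ ih => ⋂ (o' : Ordinal.{0}) (h : o' < o), ih o' h)

/-- The ordinal rank `o(T)` of a (well-founded) tree: the least `ξ` with `T^(ξ) = ∅`. -/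
def treeRank {Λ : Type*} (T : Set (List Λ)) : Ordinal.{0} :=
  sInf {ξ : Ordinal.{0} | treeDerivIter T ξ = ∅}

/-- The first uncountable ordinal `ω₁`. -/
def omega1 : Ordinal.{0} := (Cardinal.aleph 1).ord

/-- Bourgain's tree `T(Y, (e_n), δ)`: all finite sequences `(y_0, …, y_k)` in `Y`
which are `δ`-equivalent to `(e_0, …, e_k)`. -/
def bourgainTree {W : Type*} [SeminormedAddCommGroup W] [NormedSpace ℝ W] (e : ℕ → W)
    (δ : ℝ) (Y : Type*) [SeminormedAddCommGroup Y] [NormedSpace ℝ Y] : Set (List Y) :=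
  {l : List Y | ∀ a : ℕ → ℝ,
    δ * ‖∑ i ∈ Finset.range l.length, a i • e i‖ ≤
        ‖∑ i ∈ Finset.range l.length, a i • l.getD i 0‖ ∧
    ‖∑ i ∈ Finset.range l.length, a i • l.getD i 0‖ ≤
        δ⁻¹ * ‖∑ i ∈ Finset.range l.length, a i • e i‖}

open Classical in
/-- Bourgain's ordinal index of `Y` relative to a (normalized Schauder) basis `(e_n)`
of a space `W`: it equals `ω₁` if some tree `T(Y, (e_n), δ)` is ill-founded, and
otherwise `sup_{0 < δ ≤ 1} o(T(Y, (e_n), δ))`.  With `W = C(2^ℕ)` this is `φ_NU`,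
and with `W = Z` it is `φ_{NC_Z}`. -/
def bourgainIndex {W : Type*} [SeminormedAddCommGroup W] [NormedSpace ℝ W] (e : ℕ → W)
    (Y : Type*) [SeminormedAddCommGroup Y] [NormedSpace ℝ Y] : Ordinal.{0} :=
  if ∃ δ ∈ Set.Ioc (0:ℝ) 1, TreeIllFounded (bourgainTree e δ Y) then omega1
  else ⨆ δ : Set.Ioc (0:ℝ) 1, treeRank (bourgainTree e δ.1 Y)

/-! ### The Schur property and the Radon-Nikodym property -/

/-- `X` has the Schur property: weakly convergent sequences are norm convergent. -/
def HasSchurProperty (X : Type*) [SeminormedAddCommGroup X] [NormedSpace ℝ X] : Prop :=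
  ∀ (f : ℕ → X) (x : X),
    (∀ φ : X →L[ℝ] ℝ, Tendsto (fun n => φ (f n)) atTop (𝓝 (φ x))) →
    Tendsto f atTop (𝓝 x)

/-- `X` has the Radon-Nikodym property: on every finite measure space, every
`X`-valued vector measure of bounded variation which is absolutely continuous
with respect to the measure has a Bochner-integrable density. -/
def HasRNP (X : Type*) [NormedAddCommGroup X] [NormedSpace ℝ X] : Prop :=
  ∀ (Ω : Type) [MeasurableSpace Ω] (μ : Measure Ω), IsFiniteMeasure μ →
    ∀ τ : VectorMeasure Ω X,
      (∀ s : Set Ω, MeasurableSet s → μ s = 0 → τ s = 0) →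
      (∃ C : ℝ, ∀ P : Finset (Set Ω), (∀ s ∈ P, MeasurableSet s) →
        ((P : Set (Set Ω)).Pairwise fun s t => Disjoint s t) →
        ∑ s ∈ P, ‖τ s‖ ≤ C) →
      ∃ g : Ω → X, Integrable g μ ∧
        ∀ s : Set Ω, MeasurableSet s → τ s = ∫ x in s, g x ∂μ

/-! ### `𝓛_{∞,λ}`-spaces -/

/-- The Banach-Mazur distance from `G` to `ℓ∞^n` is at most `θ`, witnessed by an
isomorphism `e` with `‖e‖ ⬝ ‖e⁻¹‖ ≤ θ'` for every `θ' > θ`. -/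
def BMdistToLinftyLE (G : Type*) [SeminormedAddCommGroup G] [NormedSpace ℝ G]
    (n : ℕ) (θ : ℝ) : Prop :=
  ∀ θ' : ℝ, θ < θ' → ∃ e : G ≃L[ℝ] (Fin n → ℝ),
    ‖(e : G →L[ℝ] (Fin n → ℝ))‖ * ‖(e.symm : (Fin n → ℝ) →L[ℝ] G)‖ ≤ θ'

/-- `X` is an (infinite-dimensional) `𝓛_{∞,λ}`-space: every finite-dimensional subspace
`F` of `X` is contained in a finite-dimensional subspace `G` with `d(G, ℓ∞^(dim G)) ≤ λ`. -/
def IsLinftyLam (lam : ℝ) (X : Type*) [NormedAddCommGroup X] [NormedSpace ℝ X] : Prop :=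
  (¬ FiniteDimensional ℝ X) ∧
  ∀ F : Submodule ℝ X, FiniteDimensional ℝ F →
    ∃ G : Submodule ℝ X, F ≤ G ∧ FiniteDimensional ℝ G ∧
      BMdistToLinftyLE G (Module.finrank ℝ G) lam

/-- `X` is an `𝓛_{∞,λ+}`-space: it is an `𝓛_{∞,θ}`-space for every `θ > λ`. -/
def IsLinftyPlus (lam : ℝ) (X : Type*) [NormedAddCommGroup X] [NormedSpace ℝ X] : Prop :=
  ∀ θ : ℝ, lam < θ → IsLinftyLam θ X

/-! ### Minimal spaces and `ℓ₁` -/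

/-- The space `ℓ₁`. -/
abbrev EllOne : Type := lp (fun _ : ℕ => ℝ) 1

/-- `X` is a minimal Banach space: it is infinite-dimensional and embeds isomorphically
into every infinite-dimensional (closed) subspace of itself. -/
def IsMinimal (X : Type*) [NormedAddCommGroup X] [NormedSpace ℝ X] : Prop :=
  (¬ FiniteDimensional ℝ X) ∧
  ∀ Z : Submodule ℝ X, IsClosed (Z : Set X) → ¬ FiniteDimensional ℝ Z → Embeds X Z

end


/-! ## Part 1: trees, ranks, boundedness -/

/-- A tree has a rank function with values at most `η`. -/
def HasTreeRank {Λ : Type*} (T : Set (List Λ)) (η : Ordinal.{0}) : Prop :=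
  ∃ r : List Λ → Ordinal.{0}, (∀ l, r l ≤ η) ∧ ∀ l a, l ++ [a] ∈ T → r (l ++ [a]) < r l

theorem tdi_zero {Λ : Type*} (T : Set (List Λ)) : treeDerivIter T 0 = T := by
  unfold treeDerivIter
  exact Ordinal.limitRecOn_zero _ _ _

theorem tdi_succ {Λ : Type*} (T : Set (List Λ)) (o : Ordinal.{0}) :
    treeDerivIter T (o + 1) = treeDeriv (treeDerivIter T o) := by
  unfold treeDerivIter
  exact Ordinal.limitRecOn_add_one _ _ _ _

theorem tdi_limit {Λ : Type*} (T : Set (List Λ)) (o : Ordinal.{0}) (h : Order.IsSuccLimit o) :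
    treeDerivIter T o = ⋂ (o' : Ordinal.{0}) (_ : o' < o), treeDerivIter T o' := by
  unfold treeDerivIter
  exact Ordinal.limitRecOn_limit _ _ _ _ h

theorem tdi_subset_of_rank {Λ : Type*} {T : Set (List Λ)} {r : List Λ → Ordinal.{0}}
    (hr : ∀ l a, l ++ [a] ∈ T → r (l ++ [a]) < r l) (α : Ordinal.{0}) :
    ∀ l ∈ treeDerivIter T α, l ∈ T ∧ α ≤ r l := by
  induction α using Ordinal.limitRecOn with
  | zero => intro l hl; rw [tdi_zero] at hl; exact ⟨hl, zero_le⟩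
  | add_one o ih =>
    intro l hl
    rw [tdi_succ] at hl
    obtain ⟨h1, a, h2⟩ := hl
    refine ⟨(ih l h1).1, ?_⟩
    have := ih _ h2
    exact Order.add_one_le_of_lt (this.2.trans_lt (hr l a this.1))
  | limit o ho ih =>
    intro l hl
    rw [tdi_limit _ _ ho] at hl
    simp only [Set.mem_iInter] at hl
    refine ⟨(ih 0 ho.pos l (hl 0 ho.pos)).1, ?_⟩
    exact le_of_forall_lt fun c hc =>
      (Order.lt_add_one_iff.2 le_rfl).trans_le (ih _ (ho.add_one_lt hc) l (hl _ (ho.add_one_lt hc))).2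

theorem tdi_empty_of_hasTreeRank {Λ : Type*} {T : Set (List Λ)} {η : Ordinal.{0}}
    (h : HasTreeRank T η) : treeDerivIter T (η + 1) = ∅ := by
  obtain ⟨r, h1, h2⟩ := h
  by_contra hne
  obtain ⟨l, hl⟩ := Set.nonempty_iff_ne_empty.2 hne
  have := (tdi_subset_of_rank h2 _ l hl).2
  exact absurd (this.trans (h1 l)) (not_le.2 (Order.lt_add_one_iff.2 le_rfl))

theorem treeRank_le_of_hasTreeRank {Λ : Type*} {T : Set (List Λ)} {η : Ordinal.{0}}
    (h : HasTreeRank T η) : treeRank T ≤ η + 1 :=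
  csInf_le' (tdi_empty_of_hasTreeRank h)

theorem hasTreeRank_of_tdi_empty {Λ : Type*} {T : Set (List Λ)} (hT : IsTree T) {β : Ordinal.{0}}
    (h : treeDerivIter T β = ∅) : HasTreeRank T β := by
  have hne : ∀ l, {α | l ∉ treeDerivIter T α}.Nonempty := fun l => ⟨β, by simp [h]⟩
  refine ⟨fun l => sInf {α | l ∉ treeDerivIter T α}, fun l => csInf_le' (by simp [h]), ?_⟩
  intro l a hla
  have hl : l ∈ T := hT l (l ++ [a]) (List.prefix_append _ _) hla
  have hmem := csInf_mem (hne l)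
  set α := sInf {α | l ∉ treeDerivIter T α} with hα
  have hlt : ∀ γ < α, l ∈ treeDerivIter T γ := fun γ hγ => by
    by_contra hc
    exact absurd (csInf_le' hc) (not_le.2 hγ)
  rcases Ordinal.zero_or_succ_or_isSuccLimit α with h0 | ⟨γ, hγ⟩ | hlim
  · rw [h0] at hmem
    exact absurd hl (by simpa [tdi_zero] using hmem)
  · have hγ1 : γ + 1 = α := hγ
    have hγlt : γ < α := by rw [← hγ1]; exact Order.lt_add_one_iff.2 le_rfl
    refine lt_of_le_of_lt (csInf_le' ?_) hγlt
    intro hc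
    apply hmem
    rw [← hγ1, tdi_succ]
    exact ⟨hlt γ hγlt, a, hc⟩
  · exfalso
    apply hmem
    rw [tdi_limit _ _ hlim]
    simp only [Set.mem_iInter]
    exact hlt

/-- The extension relation on a tree. -/
def treeRel {Λ : Type*} (T : Set (List Λ)) (l' l : List Λ) : Prop := ∃ a, l' = l ++ [a] ∧ l' ∈ T

theorem treeRel_wf {Λ : Type*} {T : Set (List Λ)} (hT : IsTree T) (h : ¬ TreeIllFounded T) :
    WellFounded (treeRel T) := by
  rw [wellFounded_iff_isEmpty_descending_chain]
  refine ⟨fun ⟨f, hf⟩ => h ?_⟩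
  have hpre : ∀ n m, n ≤ m → f n <+: f m := by
    intro n m hnm
    induction m, hnm using Nat.le_induction with
    | base => exact List.prefix_rfl
    | succ m _ ih =>
      obtain ⟨a, ha, _⟩ := hf m
      rw [ha]; exact ih.trans (List.prefix_append _ _)
  have hlen : ∀ n, n ≤ (f n).length := by
    intro n
    induction n with
    | zero => simp
    | succ n ih => obtain ⟨a, ha, _⟩ := hf n; rw [ha]; simp; omega
  refine ⟨fun i => (f (i + 1))[i]'(hlen (i + 1)), fun n => ?_⟩
  have hmem : f (n + 1) ∈ T := (hf n).choose_spec.2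
  refine hT _ _ ?_ hmem
  rw [List.prefix_iff_eq_take]
  apply List.ext_getElem
  · simp; exact (Nat.le_succ n).trans (hlen (n + 1))
  · intro i h1 h2
    simp only [List.length_ofFn] at h1
    simp only [List.getElem_ofFn, List.getElem_take]
    have := hpre (i + 1) (n + 1) (by omega)
    exact this.getElem _

theorem hasTreeRank_of_wf {Λ : Type} {T : Set (List Λ)} (hT : IsTree T)
    (h : ¬ TreeIllFounded T) : ∃ β, HasTreeRank T β := by
  have : IsWellFounded _ (treeRel T) := ⟨treeRel_wf hT h⟩
  refine ⟨⨆ l, IsWellFounded.rank (treeRel T) l, IsWellFounded.rank (treeRel T),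
    fun l => Ordinal.le_iSup _ l, fun l a hla => IsWellFounded.rank_lt_of_rel ⟨a, rfl, hla⟩⟩

theorem isSuccLimit_omega_one : Order.IsSuccLimit (Ordinal.omega.{0} 1) := by
  rw [← Cardinal.ord_aleph 1]
  exact Cardinal.isSuccLimit_ord (Cardinal.aleph0_le_aleph 1)

theorem hasTreeRank_of_wf_countable {Λ : Type} [Countable Λ] {T : Set (List Λ)} (hT : IsTree T)
    (h : ¬ TreeIllFounded T) : ∃ β < omega1, HasTreeRank T β := by
  have : IsWellFounded _ (treeRel T) := ⟨treeRel_wf hT h⟩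
  have ho : omega1 = Ordinal.omega 1 := Cardinal.ord_aleph 1
  have hlt : ∀ l, IsWellFounded.rank (treeRel T) l < Ordinal.omega 1 := by
    intro l
    induction l using (treeRel_wf hT h).induction with
    | _ l ih =>
      rw [IsWellFounded.rank_eq]
      apply Ordinal.iSup_lt_omega_one
      intro b
      exact isSuccLimit_omega_one.succ_lt (ih b.1 b.2)
  refine ⟨⨆ l, IsWellFounded.rank (treeRel T) l, ?_, IsWellFounded.rank (treeRel T),
    fun l => Ordinal.le_iSup _ l, fun l a hla => IsWellFounded.rank_lt_of_rel ⟨a, rfl, hla⟩⟩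
  rw [ho]
  exact Ordinal.iSup_lt_omega_one hlt

theorem HasTreeRank.not_illFounded {Λ : Type*} {T : Set (List Λ)} {η : Ordinal.{0}}
    (h : HasTreeRank T η) : ¬ TreeIllFounded T := by
  rintro ⟨σ, hσ⟩
  obtain ⟨r, -, h2⟩ := h
  have key : ∀ n : ℕ, r (List.ofFn fun i : Fin (n + 1) => σ i) < r (List.ofFn fun i : Fin n => σ i) := by
    intro n
    have e : (List.ofFn fun i : Fin (n + 1) => σ i) = (List.ofFn fun i : Fin n => σ i) ++ [σ n] := by
      rw [List.ofFn_succ_last]; simp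
    rw [e]
    exact h2 _ _ (e ▸ hσ (n + 1))
  exact (wellFounded_iff_isEmpty_descending_chain.1
    (wellFounded_lt (α := Ordinal.{0}))).false ⟨fun n => r (List.ofFn fun i : Fin n => σ i), key⟩

theorem HasTreeRank.comap {Λ Λ' : Type*} {T : Set (List Λ)} {T' : Set (List Λ')} {η : Ordinal.{0}}
    (h : HasTreeRank T' η) (φ : List Λ → List Λ')
    (hφ : ∀ l a, l ++ [a] ∈ T → (∃ b, φ (l ++ [a]) = φ l ++ [b]) ∧ φ (l ++ [a]) ∈ T') :
    HasTreeRank T η := by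
  obtain ⟨r, h1, h2⟩ := h
  refine ⟨fun l => r (φ l), fun l => h1 _, fun l a hla => ?_⟩
  obtain ⟨⟨b, hb⟩, hm⟩ := hφ l a hla
  simp only
  rw [hb] at hm ⊢
  exact h2 _ _ hm

/-- Boundedness. -/
theorem tree_boundedness {P : Type*} [TopologicalSpace P] {f : (ℕ → ℕ) → P} (hf : Continuous f)
    {Λ : Type} [Countable Λ] (D : List Λ → Set P) (hD : ∀ l, IsClosed (D l))
    (hDt : ∀ p, IsTree {l | p ∈ D l})
    (hw : ∀ x, ¬ TreeIllFounded {l | f x ∈ D l}) :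
    ∃ η < omega1, ∀ x, HasTreeRank {l | f x ∈ D l} η := by
  let S : Set (List (ℕ × Λ)) := {L | ∃ x : ℕ → ℕ, (∀ i (h : i < L.length), x i = (L[i]).1) ∧
    f x ∈ D (L.map Prod.snd)}
  have hS : IsTree S := by
    rintro s t hst ⟨x, h1, h2⟩
    refine ⟨x, fun i h => ?_, ?_⟩
    · rw [h1 i (h.trans_le hst.length_le), hst.getElem h]
    · exact hDt (f x) _ _ (hst.map Prod.snd) h2
  have hSw : ¬ TreeIllFounded S := by
    rintro ⟨σ, hσ⟩
    choose x hx1 hx2 using hσ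
    have hlim : Tendsto x atTop (𝓝 fun i => (σ i).1) := by
      rw [tendsto_pi_nhds]
      intro i
      apply tendsto_const_nhds.congr'
      filter_upwards [eventually_gt_atTop i] with n hn
      have := hx1 n i (by simpa using hn)
      simpa using this.symm
    have hflim := (hf.tendsto _).comp hlim
    apply hw (fun i => (σ i).1)
    refine ⟨fun i => (σ i).2, fun n => ?_⟩
    refine (hD _).mem_of_tendsto hflim ?_
    filter_upwards [eventually_ge_atTop n] with m hm
    have := hx2 m
    refine hDt (f (x m)) _ _ ?_ this
    rw [List.map_ofFn, List.prefix_iff_eq_take]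
    apply List.ext_getElem
    · simp [hm]
    · intro i h1 h2; simp
  obtain ⟨η, hη, hr⟩ := hasTreeRank_of_wf_countable hS hSw
  refine ⟨η, hη, fun x => hr.comap (fun l => List.ofFn fun i : Fin l.length => (x i, l[i])) ?_⟩
  intro l a hla
  refine ⟨⟨(x l.length, a), ?_⟩, ?_⟩
  · apply List.ext_getElem
    · simp
    · intro i h1 h2
      simp only [List.length_ofFn, List.length_append, List.length_singleton] at h1
      rcases Nat.lt_or_ge i l.length with h | h
      · rw [List.getElem_ofFn, List.getElem_append_left (by simpa using h), List.getElem_ofFn]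
        simp only [Fin.getElem_fin, List.getElem_append_left h]
      · have : i = l.length := by omega
        subst this
        rw [List.getElem_ofFn, List.getElem_append_right (by simp)]
        simp only [Fin.getElem_fin, List.getElem_concat_length, List.length_ofFn, Nat.sub_self, List.getElem_cons_zero]
  · refine ⟨x, fun i h => by rw [List.getElem_ofFn], ?_⟩
    have : List.map Prod.snd (List.ofFn fun i : Fin (l ++ [a]).length => (x i, (l ++ [a])[i])) = l ++ [a] := by
      rw [List.map_ofFn]
      exact List.ofFn_getElem
    rw [this]
    exact hla

theorem omega1_isSuccLimit : Order.IsSuccLimit omega1 := by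
  have ho : omega1 = Ordinal.omega 1 := Cardinal.ord_aleph 1
  rw [ho]; exact isSuccLimit_omega_one

theorem omega1_iSup_lt {α : Type} [Countable α] {f : α → Ordinal.{0}} (h : ∀ i, f i < omega1) :
    ⨆ i, f i < omega1 := by
  have ho : omega1 = Ordinal.omega 1 := Cardinal.ord_aleph 1
  rw [ho]; exact Ordinal.iSup_lt_omega_one (fun i => ho ▸ h i)

section index
variable {W : Type*} [SeminormedAddCommGroup W] [NormedSpace ℝ W] (e : ℕ → W)

theorem bourgainTree_isTree (δ : ℝ) (Y : Type*) [SeminormedAddCommGroup Y] [NormedSpace ℝ Y] :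
    IsTree (bourgainTree e δ Y) := by
  intro s t hst ht a
  have hlen := hst.length_le
  have h := ht (fun i => if i < s.length then a i else 0)
  have e1 : ∀ v : ℕ → W, ∑ i ∈ Finset.range t.length, (if i < s.length then a i else 0) • v i
      = ∑ i ∈ Finset.range s.length, a i • v i := by
    intro v
    symm
    rw [← Finset.sum_subset (Finset.range_subset_range.2 hlen)]
    · exact Finset.sum_congr rfl fun i hi => by simp [Finset.mem_range.1 hi]
    · intro i _ hi; simp at hi; simp [hi]
  have e2 : ∑ i ∈ Finset.range t.length, (if i < s.length then a i else 0) • t.getD i 0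
      = ∑ i ∈ Finset.range s.length, a i • s.getD i 0 := by
    symm
    rw [← Finset.sum_subset (Finset.range_subset_range.2 hlen)]
    · refine Finset.sum_congr rfl fun i hi => ?_
      have hi' := Finset.mem_range.1 hi
      rw [if_pos hi', List.getD_eq_getElem _ _ hi', List.getD_eq_getElem _ _ (hi'.trans_le hlen),
        hst.getElem hi']
    · intro i _ hi; simp at hi; simp [hi]
  rw [e1, e2] at h
  exact h

theorem hasTreeRank_of_index {X : Type} [SeminormedAddCommGroup X] [NormedSpace ℝ X]
    {ξ : Ordinal.{0}} (hξ : ξ < omega1) (h : bourgainIndex e X ≤ ξ) {δ : ℝ}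
    (hδ : δ ∈ Set.Ioc (0:ℝ) 1) : HasTreeRank (bourgainTree e δ X) ξ := by
  unfold bourgainIndex at h
  split_ifs at h with hc
  · exact absurd h (not_le.2 hξ)
  · push Not at hc
    have hT := bourgainTree_isTree e δ X
    obtain ⟨β, hβ⟩ := hasTreeRank_of_wf hT (hc δ hδ)
    have hmem : treeDerivIter (bourgainTree e δ X) (treeRank (bourgainTree e δ X)) = ∅ :=
      csInf_mem (s := {ξ | treeDerivIter (bourgainTree e δ X) ξ = ∅}) ⟨_, tdi_empty_of_hasTreeRank hβ⟩
    have hr := hasTreeRank_of_tdi_empty hT hmem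
    have hle : treeRank (bourgainTree e δ X) ≤ ξ :=
      le_trans (Ordinal.le_iSup (fun δ : Set.Ioc (0:ℝ) 1 => treeRank (bourgainTree e δ.1 X)) ⟨δ, hδ⟩) h
    obtain ⟨r, h1, h2⟩ := hr
    exact ⟨r, fun l => (h1 l).trans hle, h2⟩

theorem index_le_of_hasTreeRank {X : Type} [SeminormedAddCommGroup X] [NormedSpace ℝ X]
    {η : Ordinal.{0}} (h : ∀ δ ∈ Set.Ioc (0:ℝ) 1, HasTreeRank (bourgainTree e δ X) η) :
    bourgainIndex e X ≤ η + 1 := by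
  unfold bourgainIndex
  rw [if_neg]
  · exact Ordinal.iSup_le fun δ => treeRank_le_of_hasTreeRank (h δ.1 δ.2)
  · rintro ⟨δ, hδ, hc⟩
    exact (h δ hδ).not_illFounded hc

/-- Pulling back Bourgain trees along a linear isometry. -/
theorem map_mem_bourgainTree_iff {X Y : Type*} [SeminormedAddCommGroup X] [NormedSpace ℝ X]
    [SeminormedAddCommGroup Y] [NormedSpace ℝ Y] (j : X →ₗᵢ[ℝ] Y) (δ : ℝ) (l : List X) :
    l.map j ∈ bourgainTree e δ Y ↔ l ∈ bourgainTree e δ X := by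
  have key : ∀ a : ℕ → ℝ, ‖∑ i ∈ Finset.range l.length, a i • (l.map j).getD i 0‖
      = ‖∑ i ∈ Finset.range l.length, a i • l.getD i 0‖ := by
    intro a
    rw [← j.norm_map, map_sum]
    congr 1
    refine Finset.sum_congr rfl fun i hi => ?_
    have hi' := Finset.mem_range.1 hi
    rw [map_smul, List.getD_eq_getElem _ _ (by simpa using hi'), List.getD_eq_getElem _ _ hi']
    simp
  unfold bourgainTree
  simp only [Set.mem_ofPred_eq, List.length_map, key]

end index

/-! ## Part 2: basis constant, perturbations -/

/-- linear combination -/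
noncomputable abbrev lc {E : Type*} [AddCommGroup E] [Module ℝ E] (z : ℕ → E) :
    (ℕ →₀ ℝ) →ₗ[ℝ] E :=
  Finsupp.linearCombination ℝ z

theorem lc_eq_sum {E : Type*} [AddCommGroup E] [Module ℝ E] (z : ℕ → E) (a : ℕ →₀ ℝ) {N : ℕ}
    (h : a.support ⊆ Finset.range N) : lc z a = ∑ i ∈ Finset.range N, a i • z i := by
  rw [lc, Finsupp.linearCombination_apply]
  exact Finsupp.sum_of_support_subset _ h _ (by simp)

theorem exists_range_supset (a : ℕ →₀ ℝ) : ∃ N, a.support ⊆ Finset.range N :=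
  ⟨a.support.sup id + 1, fun i hi => by
    simpa [Nat.lt_succ_iff] using Finset.le_sup (f := id) hi⟩

/-- Truncated finsupp. -/
noncomputable def trunc (a : ℕ → ℝ) (N : ℕ) : ℕ →₀ ℝ :=
  Finsupp.onFinset (Finset.range N) (fun i => if i < N then a i else 0) (by
    intro i hi; by_contra hc; simp at hc; simp [hc.not_gt] at hi)

theorem lc_trunc {E : Type*} [AddCommGroup E] [Module ℝ E] (z : ℕ → E) (a : ℕ → ℝ) (N : ℕ) :
    lc z (trunc a N) = ∑ i ∈ Finset.range N, a i • z i := by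
  rw [lc_eq_sum z (trunc a N) (N := N) Finsupp.support_onFinset_subset]
  refine Finset.sum_congr rfl fun i hi => ?_
  simp [trunc, Finset.mem_range.1 hi]

section bc
variable {Z : Type*} [NormedAddCommGroup Z] [NormedSpace ℝ Z] [CompleteSpace Z]

/-- space of partial sum sequences -/
noncomputable def partialSumSpace (z : ℕ → Z) : Submodule ℝ C(OnePoint ℕ, Z) where
  carrier := {s | s ((0:ℕ) : OnePoint ℕ) = 0 ∧ ∀ n : ℕ, s ((n + 1 : ℕ) : OnePoint ℕ) - s (n : OnePoint ℕ) ∈ Submodule.span ℝ {z n}}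
  add_mem' := by
    rintro s t ⟨h1, h2⟩ ⟨h3, h4⟩
    refine ⟨by simp [h1, h3], fun n => ?_⟩
    have := Submodule.add_mem _ (h2 n) (h4 n)
    convert this using 1
    simp only [ContinuousMap.add_apply]; abel
  zero_mem' := by simp
  smul_mem' := by
    rintro c s ⟨h1, h2⟩
    refine ⟨by simp [h1], fun n => ?_⟩
    have := Submodule.smul_mem _ c (h2 n)
    convert this using 1
    simp only [ContinuousMap.smul_apply, smul_sub]

theorem partialSumSpace_isClosed (z : ℕ → Z) : IsClosed (partialSumSpace z : Set C(OnePoint ℕ, Z)) := by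
  have : (partialSumSpace z : Set C(OnePoint ℕ, Z)) = {s | s ((0:ℕ) : OnePoint ℕ) = 0} ∩ 
    ⋂ n : ℕ, {s | s ((n + 1 : ℕ) : OnePoint ℕ) - s (n : OnePoint ℕ) ∈ (Submodule.span ℝ {z n} : Set Z)} := by
    ext s; simp [partialSumSpace]
  rw [this]
  refine IsClosed.inter (isClosed_eq (continuous_eval_const _) continuous_const) ?_
  refine isClosed_iInter fun n => ?_
  exact (Submodule.closed_of_finiteDimensional (Submodule.span ℝ {z n})).preimage
    ((continuous_eval_const _).sub (continuous_eval_const _))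

theorem partialSum_coeff {z : ℕ → Z} {s : C(OnePoint ℕ, Z)} (hs : s ∈ partialSumSpace z) :
    ∃ a : ℕ → ℝ, ∀ m : ℕ, s (m : OnePoint ℕ) = ∑ i ∈ Finset.range m, a i • z i := by
  obtain ⟨h0, h1⟩ := hs
  choose a ha using fun n => Submodule.mem_span_singleton.1 (h1 n)
  refine ⟨a, fun m => ?_⟩
  induction m with
  | zero => simpa using h0
  | succ m ih => rw [Finset.sum_range_succ, ← ih, ha]; abel

theorem tendsto_onePoint (s : C(OnePoint ℕ, Z)) :
    Tendsto (fun m : ℕ => s (m : OnePoint ℕ)) atTop (𝓝 (s OnePoint.infty)) := by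
  have h1 : Tendsto (fun m : ℕ => (m : OnePoint ℕ)) atTop (𝓝 OnePoint.infty) := by
    have := OnePoint.tendsto_coe_infty (X := ℕ)
    rwa [Filter.coclosedCompact_eq_cocompact, Filter.cocompact_eq_cofinite, Nat.cofinite_eq_atTop] at this
  exact (s.continuous.tendsto _).comp h1

/-- Basis constant. -/
theorem basis_const {z : ℕ → Z} (hz : IsSchauderBasis z) :
    ∃ K : ℝ, 1 ≤ K ∧ ∀ (a : ℕ → ℝ) (m n : ℕ), m ≤ n →
      ‖∑ i ∈ Finset.range m, a i • z i‖ ≤ K * ‖∑ i ∈ Finset.range n, a i • z i‖ := by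
  have hcl := partialSumSpace_isClosed z
  have : CompleteSpace (partialSumSpace z) := hcl.completeSpace_coe
  let ev : partialSumSpace z →L[ℝ] Z :=
    (ContinuousMap.evalCLM ℝ (OnePoint.infty : OnePoint ℕ)).comp (partialSumSpace z).subtypeL
  have hev : ∀ s, ev s = s.1 OnePoint.infty := fun s => rfl
  have hinj : Function.Injective ev := by
    rw [injective_iff_map_eq_zero]
    intro s hs
    obtain ⟨a, ha⟩ := partialSum_coeff s.2
    have h1 := tendsto_onePoint s.1
    rw [← hev, hs] at h1
    have ha0 : a = 0 := (hz 0).unique (by simpa [ha] using h1) (by simp)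
    ext x
    induction x using OnePoint.rec with
    | infty => simpa [hev] using hs
    | coe m => simp [ha, ha0]
  have hsurj : Function.Surjective ev := by
    intro y
    obtain ⟨a, ha, -⟩ := hz y
    refine ⟨⟨OnePoint.continuousMapMkNat _ _ ha, ?_, ?_⟩, rfl⟩
    · show (∑ i ∈ Finset.range 0, a i • z i) = 0
      simp
    · intro n
      show (∑ i ∈ Finset.range (n+1), a i • z i) - (∑ i ∈ Finset.range n, a i • z i) ∈ _
      rw [Finset.sum_range_succ, add_sub_cancel_left]
      exact Submodule.mem_span_singleton.2 ⟨a n, rfl⟩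
  let Ev := ContinuousLinearEquiv.ofBijective ev (LinearMap.ker_eq_bot.2 hinj) (LinearMap.range_eq_top.2 hsurj)
  obtain ⟨C, hC0, hC⟩ := (Ev.symm : Z →L[ℝ] partialSumSpace z).bound
  refine ⟨max C 1, le_max_right _ _, fun a m n hmn => ?_⟩
  let b : ℕ → ℝ := fun i => if i < n then a i else 0
  have hb : ∀ k, ∑ i ∈ Finset.range k, b i • z i = ∑ i ∈ Finset.range (min k n), a i • z i := by
    intro k
    rw [← Finset.sum_subset (Finset.range_subset_range.2 (min_le_left k n))]
    · refine Finset.sum_congr rfl fun i hi => ?_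
      have : i < n := (Finset.mem_range.1 hi).trans_le (min_le_right _ _)
      simp [b, this]
    · intro i h1 h2
      simp at h1 h2
      simp [b, (h2 h1).not_gt]
  have hlim : Tendsto (fun k => ∑ i ∈ Finset.range k, b i • z i) atTop (𝓝 (∑ i ∈ Finset.range n, a i • z i)) := by
    apply tendsto_const_nhds.congr'
    filter_upwards [eventually_ge_atTop n] with k hk
    rw [hb, min_eq_right hk]
  let s : partialSumSpace z := ⟨OnePoint.continuousMapMkNat _ _ hlim, by
    constructor
    · show (∑ i ∈ Finset.range 0, b i • z i) = 0
      simp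
    · intro n
      show (∑ i ∈ Finset.range (n+1), b i • z i) - (∑ i ∈ Finset.range n, b i • z i) ∈ _
      rw [Finset.sum_range_succ, add_sub_cancel_left]
      exact Submodule.mem_span_singleton.2 ⟨b n, rfl⟩⟩
  have hs : Ev.symm (∑ i ∈ Finset.range n, a i • z i) = s := by
    rw [ContinuousLinearEquiv.symm_apply_eq]; rfl
  have h1 : ‖∑ i ∈ Finset.range m, a i • z i‖ ≤ ‖s‖ := by
    have : s.1 (m : OnePoint ℕ) = ∑ i ∈ Finset.range m, a i • z i := by
      show ∑ i ∈ Finset.range m, b i • z i = _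
      rw [hb, min_eq_left hmn]
    rw [← this]
    exact s.1.norm_coe_le_norm _
  have h2 := hC (∑ i ∈ Finset.range n, a i • z i)
  simp only [ContinuousLinearEquiv.coe_coe, hs] at h2
  calc _ ≤ _ := h1
    _ ≤ _ := h2
    _ ≤ _ := by gcongr; exact le_max_left _ _

/-- `K` is a basis constant for the normalized sequence `z`. -/
structure BasisConst (z : ℕ → Z) (K : ℝ) : Prop where
  one_le : 1 ≤ K
  dense : DenseRange (lc z)
  norm_one : ∀ n, ‖z n‖ = 1
  bound : ∀ (a : ℕ → ℝ) (m n : ℕ), m ≤ n →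
      ‖∑ i ∈ Finset.range m, a i • z i‖ ≤ K * ‖∑ i ∈ Finset.range n, a i • z i‖

theorem exists_basisConst {z : ℕ → Z} (hz : IsSchauderBasis z) (hn : ∀ n, ‖z n‖ = 1) :
    ∃ K, BasisConst z K := by
  obtain ⟨K, h1, h2⟩ := basis_const hz
  refine ⟨K, h1, ?_, hn, h2⟩
  intro y
  obtain ⟨a, ha, -⟩ := hz y
  refine mem_closure_of_tendsto ha (Eventually.of_forall fun m => ⟨trunc a m, lc_trunc _ _ _⟩)

variable {z : ℕ → Z} {K : ℝ}

theorem BasisConst.coeff (h : BasisConst z K) (a : ℕ → ℝ) {i n : ℕ} (hi : i < n) :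
    |a i| ≤ 2 * K * ‖∑ i ∈ Finset.range n, a i • z i‖ := by
  have h1 := h.bound a (i + 1) n hi
  have h2 := h.bound a i n hi.le
  have : a i • z i = ∑ j ∈ Finset.range (i+1), a j • z j - ∑ j ∈ Finset.range i, a j • z j := by
    rw [Finset.sum_range_succ]; abel
  have h3 : |a i| = ‖a i • z i‖ := by rw [norm_smul, h.norm_one, mul_one, Real.norm_eq_abs]
  rw [h3, this]
  refine (norm_sub_le _ _).trans ?_
  linarith

theorem BasisConst.block (h : BasisConst z K) (a : ℕ →₀ ℝ) (p q : ℕ) :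
    ‖lc z (a.filter (fun i => p ≤ i ∧ i < q))‖ ≤ 2 * K * ‖lc z a‖ := by
  have hK := h.one_le
  rcases Nat.lt_or_ge q p with hpq | hpq
  · have : a.filter (fun i => p ≤ i ∧ i < q) = 0 := by
      ext i; rw [Finsupp.filter_apply_neg]; · rfl
      · omega
    rw [this, map_zero, norm_zero]; positivity
  obtain ⟨N, hN⟩ := exists_range_supset a
  have hN' : a.support ⊆ Finset.range (max N q) := hN.trans (Finset.range_subset_range.2 (le_max_left _ _))
  have h1 : lc z (a.filter (fun i => p ≤ i ∧ i < q)) =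
      ∑ i ∈ Finset.range q, a i • z i - ∑ i ∈ Finset.range p, a i • z i := by
    rw [lc_eq_sum z _ (N := q), eq_sub_iff_add_eq, ← Finset.sum_range_add_sum_Ico _ hpq,
      ← Finset.sum_range_add_sum_Ico _ hpq]
    · have e1 : ∑ k ∈ Finset.range p, (a.filter (fun i => p ≤ i ∧ i < q)) k • z k = 0 := by
        refine Finset.sum_eq_zero fun i hi => ?_
        rw [Finsupp.filter_apply_neg, zero_smul]
        have := Finset.mem_range.1 hi; omega
      have e2 : ∑ k ∈ Finset.Ico p q, (a.filter (fun i => p ≤ i ∧ i < q)) k • z k = ∑ k ∈ Finset.Ico p q, a k • z k := by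
        refine Finset.sum_congr rfl fun i hi => ?_
        rw [Finsupp.filter_apply_pos]
        exact Finset.mem_Ico.1 hi
      rw [e1, e2]; abel
    · intro i hi
      rw [Finsupp.support_filter, Finset.mem_filter] at hi
      exact Finset.mem_range.2 hi.2.2
  rw [h1, lc_eq_sum z a hN']
  have h2 := h.bound a q (max N q) (le_max_right _ _)
  have h3 := h.bound a p (max N q) (hpq.trans (le_max_right _ _))
  refine (norm_sub_le _ _).trans ?_
  linarith

/-- Extending from the basis. -/
theorem extend_basis {W : Type*} [NormedAddCommGroup W] [NormedSpace ℝ W] [CompleteSpace W]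
    (hd : DenseRange (lc z)) (f : (ℕ →₀ ℝ) →ₗ[ℝ] W) {C : ℝ}
    (hC : ∀ a, ‖f a‖ ≤ C * ‖lc z a‖) :
    ∃ T : Z →L[ℝ] W, (∀ a, T (lc z a) = f a) ∧ ∀ x, ‖T x‖ ≤ C * ‖x‖ :=
  ⟨f.extendOfNorm (lc z), fun a => LinearMap.extendOfNorm_eq hd ⟨C, hC⟩ a,
    fun x => LinearMap.norm_extendOfNorm_apply_le hd C hC x⟩

theorem lower_extend {W : Type*} [NormedAddCommGroup W] [NormedSpace ℝ W]
    (hd : DenseRange (lc z)) (T : Z →L[ℝ] W) {c : ℝ}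
    (hc : ∀ a, c * ‖lc z a‖ ≤ ‖T (lc z a)‖) (x : Z) : c * ‖x‖ ≤ ‖T x‖ := by
  refine hd.induction_on (p := fun x => c * ‖x‖ ≤ ‖T x‖) x ?_ hc
  exact isClosed_le (by fun_prop) (by fun_prop)

theorem branch_iff {W : Type*} [NormedAddCommGroup W] [NormedSpace ℝ W] (δ : ℝ) (y : ℕ → W) :
    IsBranch (bourgainTree z δ W) y ↔
      ∀ a : ℕ →₀ ℝ, δ * ‖lc z a‖ ≤ ‖lc y a‖ ∧ ‖lc y a‖ ≤ δ⁻¹ * ‖lc z a‖ := by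
  have key : ∀ (n : ℕ) (a : ℕ → ℝ), ∑ i ∈ Finset.range n, a i • (List.ofFn fun i : Fin n => y i).getD i 0
      = ∑ i ∈ Finset.range n, a i • y i := by
    intro n a
    refine Finset.sum_congr rfl fun i hi => ?_
    rw [List.getD_eq_getElem _ _ (by simpa using hi), List.getElem_ofFn]
  constructor
  · intro h a
    obtain ⟨N, hN⟩ := exists_range_supset a
    have := h N a
    rw [List.length_ofFn, key] at this
    rwa [lc_eq_sum z a hN, lc_eq_sum y a hN]
  · intro h n a
    have := h (trunc a n)
    rw [lc_trunc, lc_trunc] at this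
    rwa [List.length_ofFn, key]

/-- Perturbation. -/
theorem BasisConst.perturb (h : BasisConst z K) {W : Type*} [NormedAddCommGroup W] [NormedSpace ℝ W]
    {δ : ℝ} (hδ0 : 0 < δ) (hδ1 : δ ≤ 1) {l l' : List W} (hl : l ∈ bourgainTree z δ W)
    (hlen : l'.length = l.length)
    (hc : ∀ i, i < l.length → ‖l'.getD i 0 - l.getD i 0‖ ≤ δ / (8 * K) * (1 / 2) ^ i) :
    l' ∈ bourgainTree z (δ / 2) W := by
  intro a
  have hK := h.one_le
  rw [hlen]
  obtain ⟨h1, h2⟩ := hl a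
  set N := ‖∑ i ∈ Finset.range l.length, a i • z i‖ with hN
  have hN0 : 0 ≤ N := norm_nonneg _
  have hdiff : ‖∑ i ∈ Finset.range l.length, a i • l'.getD i 0 -
      ∑ i ∈ Finset.range l.length, a i • l.getD i 0‖ ≤ δ / 2 * N := by
    rw [← Finset.sum_sub_distrib]
    calc _ ≤ ∑ i ∈ Finset.range l.length, ‖a i • l'.getD i 0 - a i • l.getD i 0‖ := norm_sum_le _ _
      _ ≤ ∑ i ∈ Finset.range l.length, (2 * K * N) * (δ / (8 * K) * (1 / 2) ^ i) := by
        refine Finset.sum_le_sum fun i hi => ?_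
        rw [← smul_sub, norm_smul, Real.norm_eq_abs]
        gcongr
        · exact h.coeff a (Finset.mem_range.1 hi)
        · exact hc i (Finset.mem_range.1 hi)
      _ = (N * δ / 4) * ∑ i ∈ Finset.range l.length, (1 / 2 : ℝ) ^ i := by
        rw [Finset.mul_sum]
        refine Finset.sum_congr rfl fun i _ => ?_
        field_simp; ring
      _ ≤ (N * δ / 4) * 2 := by
        gcongr
        exact sum_geometric_two_le _
      _ = _ := by ring
  have h3 := norm_le_norm_add_norm_sub' (∑ i ∈ Finset.range l.length, a i • l'.getD i 0) (∑ i ∈ Finset.range l.length, a i • l.getD i 0)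
  have h4 := norm_le_norm_add_norm_sub (∑ i ∈ Finset.range l.length, a i • l'.getD i 0) (∑ i ∈ Finset.range l.length, a i • l.getD i 0)
  constructor
  · linarith
  · have : (δ / 2)⁻¹ = 2 * δ⁻¹ := by field_simp
    rw [this]
    have : δ / 2 ≤ δ⁻¹ := by
      have : (1:ℝ) ≤ δ⁻¹ := (one_le_inv₀ hδ0).2 hδ1
      linarith
    have := mul_le_mul_of_nonneg_right this hN0
    linarith

end bc

/-! ## Part 3: no branches -/

section nb
variable {Z : Type*} [NormedAddCommGroup Z] [NormedSpace ℝ Z] [CompleteSpace Z]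

theorem embeds_ellOne {w : ℕ → Z} {c : ℝ} (hc : 0 < c) (hw : ∀ k, ‖w k‖ ≤ 1)
    (hl : ∀ (t : ℕ → ℝ) (n : ℕ), c * ∑ k ∈ Finset.range n, |t k| ≤ ‖∑ k ∈ Finset.range n, t k • w k‖) :
    Embeds EllOne Z := by
  have hnorm : ∀ t : EllOne, HasSum (fun k => |t k|) ‖t‖ := by
    intro t
    have := lp.hasSum_norm (p := 1) (by norm_num) t
    simpa using this
  have hle : ∀ (t : EllOne) k, ‖t k • w k‖ ≤ |t k| := fun t k => by
    rw [norm_smul, Real.norm_eq_abs]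
    exact mul_le_of_le_one_right (abs_nonneg _) (hw k)
  have hsum : ∀ t : EllOne, Summable (fun k => t k • w k) := fun t =>
    Summable.of_norm_bounded (hnorm t).summable (hle t)
  let T : EllOne →ₗ[ℝ] Z :=
    { toFun := fun t => ∑' k, t k • w k
      map_add' := fun s t => by
        rw [← (hsum s).tsum_add (hsum t)]
        exact tsum_congr fun k => by rw [lp.coeFn_add, Pi.add_apply, add_smul]
      map_smul' := fun r t => by
        rw [RingHom.id_apply, ← (hsum t).tsum_const_smul]
        exact tsum_congr fun k => by rw [lp.coeFn_smul, Pi.smul_apply, smul_assoc] }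
  refine ⟨T.mkContinuous 1 fun t => ?_, c, hc, fun t => ?_⟩
  · rw [one_mul]
    exact tsum_of_norm_bounded (hnorm t) (hle t)
  · have h1 := (hnorm t).tendsto_sum_nat
    have h2 := (hsum t).hasSum.tendsto_sum_nat
    exact le_of_tendsto_of_tendsto' (h1.const_mul c) h2.norm (fun n => hl _ n)

variable {z : ℕ → Z} {K : ℝ}

theorem BasisConst.lc_ne_zero (h : BasisConst z K) {a : ℕ →₀ ℝ} (ha : a ≠ 0) : lc z a ≠ 0 := by
  intro h0
  apply ha
  ext i
  obtain ⟨N, hN⟩ := exists_range_supset a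
  by_cases hi : i ∈ a.support
  · have := h.coeff a (Finset.mem_range.1 (hN hi))
    rw [← lc_eq_sum z a hN, h0] at this
    simpa using this
  · simpa using hi

variable {W : Type*} [NormedAddCommGroup W] [NormedSpace ℝ W] [CompleteSpace W]

/-- The two-term `ℓ₁` condition modulo `F`. -/
def L1Cond (F : Submodule ℝ W) (v : ℕ → W) (lev : ℕ → ℕ) : Prop :=
  ∀ (n : ℕ) (u u' : W), u ∈ Submodule.span ℝ (v '' {i | lev i < n}) →
    u' ∈ Submodule.span ℝ (v '' {i | n ≤ lev i}) →
    ‖F.mkQ u‖ + ‖F.mkQ u'‖ ≤ ‖F.mkQ (u + u')‖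

theorem L1Cond.sup {F : Submodule ℝ W} {v : ℕ → W} {lev : ℕ → ℕ} (h : L1Cond F v lev)
    {n : ℕ} {u u' : W} (hu : u ∈ F ⊔ Submodule.span ℝ (v '' {i | lev i < n}))
    (hu' : u' ∈ F ⊔ Submodule.span ℝ (v '' {i | n ≤ lev i})) :
    ‖F.mkQ u‖ + ‖F.mkQ u'‖ ≤ ‖F.mkQ (u + u')‖ := by
  obtain ⟨f, hf, s, hs, rfl⟩ := Submodule.mem_sup.1 hu
  obtain ⟨f', hf', s', hs', rfl⟩ := Submodule.mem_sup.1 hu'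
  have e1 : F.mkQ f = 0 := by simpa using hf
  have e2 : F.mkQ f' = 0 := by simpa using hf'
  have := h n s s' hs hs'
  simp only [map_add, e1, e2, zero_add] at this ⊢
  exact this

theorem sup_span_mono {F : Submodule ℝ W} {v : ℕ → W} {s t : Set ℕ} (h : s ⊆ t) {x : W}
    (hx : x ∈ F ⊔ Submodule.span ℝ (v '' s)) : x ∈ F ⊔ Submodule.span ℝ (v '' t) := by
  have : F ⊔ Submodule.span ℝ (v '' s) ≤ F ⊔ Submodule.span ℝ (v '' t) :=
    sup_le_sup_left (Submodule.span_mono (Set.image_mono h)) _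
  exact this hx

theorem case_one (h : BasisConst z K) (hl1 : ¬ Embeds EllOne Z) {F : Submodule ℝ W}
    {v : ℕ → W} {lev : ℕ → ℕ} (hlev : ∀ n, {i | lev i < n}.Finite) (hL : L1Cond F v lev)
    {δ : ℝ} (hδ : 0 < δ) {y : ℕ → W} (hy : ∀ n, y n ∈ F ⊔ Submodule.span ℝ (Set.range v))
    (hup : ∀ a, ‖lc y a‖ ≤ δ⁻¹ * ‖lc z a‖)
    {N : ℕ} {c : ℝ} (hc : 0 < c)
    (hlow : ∀ a : ℕ →₀ ℝ, (∀ i < N, a i = 0) → c * ‖lc z a‖ ≤ ‖F.mkQ (lc y a)‖) : False := by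
  apply hl1
  -- selection
  have sel : ∀ M : ℕ, ∃ a : ℕ →₀ ℝ, ∃ M' : ℕ, M ≤ M' ∧ (∀ i < N, a i = 0) ∧ ‖lc z a‖ = 1 ∧
      lc y a ∈ F ⊔ Submodule.span ℝ (v '' {i | M ≤ lev i ∧ lev i < M'}) := by
    intro M
    set U := F ⊔ Submodule.span ℝ (v '' {i | M ≤ lev i}) with hU
    set L := Submodule.span ℝ (v '' {i | lev i < M}) with hL'
    have hLfin : FiniteDimensional ℝ L := FiniteDimensional.span_of_finite ℝ ((hlev M).image v)
    have hUL : F ⊔ Submodule.span ℝ (Set.range v) ≤ U ⊔ L := by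
      refine sup_le (le_sup_of_le_left le_sup_left) ?_
      rw [Submodule.span_le]
      rintro _ ⟨i, rfl⟩
      rcases Nat.lt_or_ge (lev i) M with hi | hi
      · exact Submodule.mem_sup_right (Submodule.subset_span ⟨i, hi, rfl⟩)
      · exact Submodule.mem_sup_left (Submodule.mem_sup_right (Submodule.subset_span ⟨i, hi, rfl⟩))
    let f : (ℕ →₀ ℝ) →ₗ[ℝ] (W ⧸ U) := U.mkQ ∘ₗ lc (fun n => y (n + N))
    have hf : ∀ a, f a ∈ L.map U.mkQ := by
      intro a
      have h1 : lc (fun n => y (n + N)) a ∈ U ⊔ L := by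
        rw [lc, Finsupp.linearCombination_apply]
        exact Submodule.sum_mem _ fun i _ => Submodule.smul_mem _ _ (hUL (hy _))
      obtain ⟨p, hp, l, hl, e⟩ := Submodule.mem_sup.1 h1
      refine ⟨l, hl, ?_⟩
      show _ = U.mkQ (lc (fun n => y (n + N)) a)
      rw [← e, map_add]
      have : U.mkQ p = 0 := by simpa using hp
      rw [this, zero_add]
    let g : (ℕ →₀ ℝ) →ₗ[ℝ] (L.map U.mkQ) := f.codRestrict _ hf
    have hninj : ¬ Function.Injective g := by
      intro hi
      have : Module.Finite ℝ (ℕ →₀ ℝ) := Module.Finite.of_injective g hi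
      have h2 := Module.Finite.finite_basis (Finsupp.basisSingleOne (R := ℝ) (ι := ℕ))
      exact not_finite ℕ
    have : ∃ b : ℕ →₀ ℝ, b ≠ 0 ∧ f b = 0 := by
      by_contra! hcon
      apply hninj
      rw [injective_iff_map_eq_zero]
      intro b hb
      by_contra hb0
      exact hcon b hb0 (congrArg Subtype.val hb)
    obtain ⟨b, hb0, hb⟩ := this
    let a0 : ℕ →₀ ℝ := b.mapDomain (· + N)
    have ha00 : a0 ≠ 0 := by
      intro h0
      exact hb0 (Finsupp.mapDomain_injective (add_left_injective N) (by simpa [a0] using h0))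
    have ha0N : ∀ i < N, a0 i = 0 := fun i hi => by
      refine Finsupp.mapDomain_of_notMem_range _ _ ?_
      rintro ⟨j, hj⟩
      simp at hj; omega
    have hlca : lc y a0 = lc (fun n => y (n + N)) b := Finsupp.linearCombination_mapDomain _ _ _
    have hmem : lc y a0 ∈ U := by
      rw [hlca]
      have : U.mkQ (lc (fun n => y (n + N)) b) = 0 := hb
      simpa using this
    have hdir : Submodule.span ℝ (v '' {i | M ≤ lev i}) =
        ⨆ M' : ℕ, Submodule.span ℝ (v '' {i | M ≤ lev i ∧ lev i < M'}) := by
      rw [← Submodule.span_iUnion, ← Set.image_iUnion]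
      congr 2
      ext i
      simp only [Set.mem_ofPred_eq, Set.mem_iUnion]
      exact ⟨fun hi => ⟨lev i + 1, hi, Nat.lt_succ_self _⟩, fun ⟨_, hi, _⟩ => hi⟩
    obtain ⟨p, hp, s, hs, e⟩ := Submodule.mem_sup.1 hmem
    rw [hdir, Submodule.mem_iSup_of_directed] at hs
    swap
    · intro m1 m2
      exact ⟨max m1 m2, Submodule.span_mono (Set.image_mono fun i hi => ⟨hi.1, hi.2.trans_le (le_max_left _ _)⟩),
        Submodule.span_mono (Set.image_mono fun i hi => ⟨hi.1, hi.2.trans_le (le_max_right _ _)⟩)⟩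
    obtain ⟨M', hM'⟩ := hs
    have hn0 : ‖lc z a0‖ ≠ 0 := norm_ne_zero_iff.2 (h.lc_ne_zero ha00)
    refine ⟨‖lc z a0‖⁻¹ • a0, max M M', le_max_left _ _, fun i hi => by simp [ha0N i hi], ?_, ?_⟩
    · rw [map_smul, norm_smul, norm_inv, norm_norm, inv_mul_cancel₀ hn0]
    · rw [map_smul]
      refine Submodule.smul_mem _ _ ?_
      rw [← e]
      refine Submodule.add_mem_sup hp (Submodule.span_mono (Set.image_mono ?_) hM')
      exact fun i hi => ⟨hi.1, hi.2.trans_le (le_max_right _ _)⟩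
  choose A nx hle hA0 hA1 hAm using sel
  let M : ℕ → ℕ := fun k => Nat.rec 0 (fun _ m => nx m) k
  have hM : ∀ k, M (k + 1) = nx (M k) := fun k => rfl
  let a : ℕ → (ℕ →₀ ℝ) := fun k => A (M k)
  have hlowk : ∀ k, c ≤ ‖F.mkQ (lc y (a k))‖ := fun k => by
    have := hlow (a k) (hA0 _)
    rwa [hA1, mul_one] at this
  refine embeds_ellOne (w := fun k => lc z (a k)) (c := δ * c) (by positivity) (fun k => (hA1 _).le) ?_
  intro t n
  have key : ∀ n, (∑ k ∈ Finset.range n, t k • lc y (a k)) ∈ F ⊔ Submodule.span ℝ (v '' {i | lev i < M n}) ∧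
      c * ∑ k ∈ Finset.range n, |t k| ≤ ‖F.mkQ (∑ k ∈ Finset.range n, t k • lc y (a k))‖ := by
    intro n
    induction n with
    | zero => simp
    | succ n ih =>
      have hm : t n • lc y (a n) ∈ F ⊔ Submodule.span ℝ (v '' {i | M n ≤ lev i ∧ lev i < M (n+1)}) :=
        Submodule.smul_mem _ _ (hAm _)
      rw [Finset.sum_range_succ]
      constructor
      · refine Submodule.add_mem _ (?_) (?_)
        · refine sup_span_mono ?_ ih.1
          exact fun i hi => lt_of_lt_of_le hi (hle _)
        · refine sup_span_mono ?_ hm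
          exact fun i hi => hi.2
      · have h1 := hL.sup ih.1 (sup_span_mono (fun i hi => hi.1) hm)
        refine le_trans ?_ h1
        rw [Finset.sum_range_succ, mul_add]
        refine add_le_add ih.2 ?_
        rw [map_smul, norm_smul, Real.norm_eq_abs, mul_comm]
        exact mul_le_mul_of_nonneg_left (hlowk n) (abs_nonneg _)
  have h1 := (key n).2
  have h2 : ‖F.mkQ (∑ k ∈ Finset.range n, t k • lc y (a k))‖ ≤ ‖∑ k ∈ Finset.range n, t k • lc y (a k)‖ :=
    Submodule.Quotient.norm_mk_le _ _
  have h3 := hup (∑ k ∈ Finset.range n, t k • a k)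
  simp only [map_sum, map_smul] at h3
  have h4 := (h1.trans h2).trans h3
  rw [mul_assoc]
  calc δ * (c * ∑ k ∈ Finset.range n, |t k|) ≤ δ * (δ⁻¹ * ‖∑ k ∈ Finset.range n, t k • lc z (a k)‖) := by
        gcongr
    _ = _ := by field_simp

theorem filter_Ico_self {a : ℕ →₀ ℝ} {p q : ℕ} (h : ∀ i, a i ≠ 0 → p ≤ i ∧ i < q) :
    a.filter (fun i => p ≤ i ∧ i < q) = a := by
  ext i
  by_cases hi : a i = 0
  · simp [Finsupp.filter_apply, hi]
  · rw [Finsupp.filter_apply_pos]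
    exact h i hi

theorem filter_Ico_zero {a : ℕ →₀ ℝ} {p q : ℕ} (h : ∀ i, p ≤ i ∧ i < q → a i = 0) :
    a.filter (fun i => p ≤ i ∧ i < q) = 0 := by
  ext i
  by_cases hi : p ≤ i ∧ i < q
  · rw [Finsupp.filter_apply_pos]; exacts [h i hi, hi]
  · rw [Finsupp.filter_apply_neg]; exacts [rfl, hi]

theorem case_two (h : BasisConst z K) (hmin : IsMinimal Z) {F : Submodule ℝ W} {Q : Set W}
    (hQ : (F : Set W) ⊆ closure Q)
    {δ : ℝ} (hδ : 0 < δ) {y : ℕ → W}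
    (heq : ∀ a, δ * ‖lc z a‖ ≤ ‖lc y a‖ ∧ ‖lc y a‖ ≤ δ⁻¹ * ‖lc z a‖)
    (hsm : ∀ (N : ℕ) (c : ℝ), 0 < c → ∃ a : ℕ →₀ ℝ, (∀ i < N, a i = 0) ∧
      ‖F.mkQ (lc y a)‖ < c * ‖lc z a‖) :
    ∃ δ' ∈ Set.Ioc (0:ℝ) 1, ∃ u : ℕ → W, (∀ n, u n ∈ Q) ∧ IsBranch (bourgainTree z δ' W) u := by
  have hK := h.one_le
  -- selection
  have sel : ∀ (k N : ℕ), ∃ (a : ℕ →₀ ℝ) (N' : ℕ) (x : W), N ≤ N' ∧ (∀ i < N, a i = 0) ∧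
      (∀ i ≥ N', a i = 0) ∧ ‖lc z a‖ = 1 ∧ x ∈ F ∧ ‖lc y a - x‖ ≤ δ / (8 * K) * (1 / 2) ^ k := by
    intro k N
    have hc : 0 < δ / (8 * K) * (1 / 2) ^ k := by positivity
    obtain ⟨a, ha1, ha2⟩ := hsm N _ hc
    have hz0 : 0 < ‖lc z a‖ := by
      by_contra hcon
      have : ‖lc z a‖ = 0 := le_antisymm (not_lt.1 hcon) (norm_nonneg _)
      rw [this, mul_zero] at ha2
      exact absurd ha2 (not_lt.2 (norm_nonneg _))
    obtain ⟨N', hN'⟩ := exists_range_supset a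
    have h1 : ‖F.mkQ (lc y (‖lc z a‖⁻¹ • a))‖ < δ / (8 * K) * (1 / 2) ^ k := by
      rw [map_smul, map_smul, norm_smul, norm_inv, norm_norm, inv_mul_lt_iff₀ hz0, mul_comm]
      exact ha2
    obtain ⟨m, hm1, hm2⟩ := Submodule.Quotient.norm_mk_lt (S := F) (F.mkQ (lc y (‖lc z a‖⁻¹ • a))) (sub_pos.2 h1)
    refine ⟨‖lc z a‖⁻¹ • a, max N N', lc y (‖lc z a‖⁻¹ • a) - m, le_max_left _ _,
      fun i hi => by simp [ha1 i hi], fun i hi => ?_, ?_, ?_, ?_⟩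
    · have : a i = 0 := by
        by_contra hne
        have := Finset.mem_range.1 (hN' (Finsupp.mem_support_iff.2 hne))
        have := (le_max_right N N').trans hi
        omega
      simp [this]
    · rw [map_smul, norm_smul, norm_inv, norm_norm, inv_mul_cancel₀ hz0.ne']
    · exact (Submodule.Quotient.eq F).1 hm1.symm
    · rw [sub_sub_cancel]
      linarith
  choose A nx X hle hA0 hA1 hAn hXF hX using sel
  let p : ℕ → ℕ := fun k => Nat.rec 0 (fun j m => nx j m) k
  have hp : ∀ k, p (k + 1) = nx k (p k) := fun k => rfl
  have hpm : Monotone p := monotone_nat_of_le_succ fun k => hle _ _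
  let a : ℕ → (ℕ →₀ ℝ) := fun k => A k (p k)
  let x : ℕ → W := fun k => X k (p k)
  let w : ℕ → Z := fun k => lc z (a k)
  have hwn : ∀ k, ‖w k‖ = 1 := fun k => hAn _ _
  obtain ⟨T, hT, -⟩ := extend_basis h.dense (lc y) (fun a => (heq a).2)
  have hTlow : ∀ v, δ * ‖v‖ ≤ ‖T v‖ := lower_extend h.dense T fun a => by rw [hT]; exact (heq a).1
  -- the functionals
  have hφ : ∀ k, ∃ φ : Z →L[ℝ] ℝ, ‖φ‖ ≤ 2 * K ∧ ∀ l, φ (w l) = if l = k then 1 else 0 := by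
    intro k
    obtain ⟨g, hg1, hg2⟩ := exists_dual_vector ℝ (w k) (by rw [← norm_ne_zero_iff, hwn]; norm_num)
    let fl : (ℕ →₀ ℝ) →ₗ[ℝ] (ℕ →₀ ℝ) :=
      { toFun := fun b => b.filter (fun i : ℕ => p k ≤ i ∧ i < p (k+1))
        map_add' := fun b c => by rw [Finsupp.filter_add]
        map_smul' := fun c b => by rw [Finsupp.filter_smul]; rfl }
    obtain ⟨φ, h1, h2⟩ := extend_basis h.dense ((g : Z →ₗ[ℝ] ℝ) ∘ₗ lc z ∘ₗ fl) (C := 2 * K) (fun b => by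
      have e1 := h.block b (p k) (p (k+1))
      have e2 := g.le_opNorm (lc z (fl b))
      rw [hg1, one_mul] at e2
      exact e2.trans e1)
    refine ⟨φ, φ.opNorm_le_bound (by positivity) h2, fun l => ?_⟩
    rw [show w l = lc z (a l) from rfl, h1]
    split_ifs with hlk
    · rw [hlk]
      have : fl (a k) = a k := by
        refine filter_Ico_self ?_
        intro i hi
        constructor
        · by_contra hc; exact hi (hA0 _ _ i (not_le.1 hc))
        · by_contra hc; exact hi (hA1 _ _ i (not_lt.1 hc))
      simp only [LinearMap.comp_apply, this]
      show g (w k) = 1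
      rw [hg2, hwn]; simp
    · have : fl (a l) = 0 := by
        refine filter_Ico_zero ?_
        intro i hi
        rcases Nat.lt_or_ge l k with hl | hl
        · have : p (l + 1) ≤ p k := hpm hl
          exact hA1 l (p l) i (by rw [← hp]; omega)
        · have : p (k + 1) ≤ p l := hpm (show k + 1 ≤ l by omega)
          exact hA0 l (p l) i (by omega)
      simp [LinearMap.comp_apply, this]
  choose φ hφn hφw using hφ
  let ee : ℕ → W := fun k => T (w k) - x k
  have hee : ∀ k, ‖ee k‖ ≤ δ / (8 * K) * (1 / 2) ^ k := fun k => by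
    show ‖T (lc z (a k)) - x k‖ ≤ _
    rw [hT]; exact hX _ _
  let G : ℕ → (Z →L[ℝ] W) := fun k => (φ k).smulRight (ee k)
  have hGn : ∀ k, ‖G k‖ ≤ δ / 4 * (1 / 2) ^ k := fun k => by
    show ‖(φ k).smulRight (ee k)‖ ≤ _
    rw [ContinuousLinearMap.norm_smulRight_apply]
    calc _ ≤ 2 * K * (δ / (8 * K) * (1 / 2) ^ k) := by gcongr; exacts [hφn k, hee k]
      _ = _ := by field_simp; norm_num
  have hgeo : HasSum (fun k : ℕ => δ / 4 * (1 / 2 : ℝ) ^ k) (δ / 2) := by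
    have := hasSum_geometric_two.mul_left (δ / 4)
    rwa [show δ / 4 * 2 = δ / 2 by ring] at this
  have hGs : Summable G := Summable.of_norm_bounded hgeo.summable hGn
  have hGt : ‖∑' k, G k‖ ≤ δ / 2 := tsum_of_norm_bounded hgeo hGn
  let R : Z →L[ℝ] W := T - ∑' k, G k
  have hRlow : ∀ v, δ / 2 * ‖v‖ ≤ ‖R v‖ := by
    intro v
    have e1 := hTlow v
    have e2 := (∑' k, G k).le_of_opNorm_le hGt v
    have e3 := norm_le_norm_add_norm_sub' (T v) ((∑' k, G k) v)
    have e4 : ‖R v‖ = ‖T v - (∑' k, G k) v‖ := rfl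
    linarith
  have hRw : ∀ l, R (w l) = x l := by
    intro l
    have e1 : (∑' k, G k) (w l) = ee l := by
      have := (ContinuousLinearMap.apply ℝ W (w l)).map_tsum hGs
      simp only [ContinuousLinearMap.apply_apply] at this
      rw [this, tsum_eq_single l]
      · simp [G, hφw]
      · intro k hk; simp [G, hφw, hk.symm]
    show T (w l) - (∑' k, G k) (w l) = x l
    rw [e1]; exact sub_sub_cancel _ _
  let V : Submodule ℝ Z := (Submodule.span ℝ (Set.range w)).topologicalClosure
  have hVcl : IsClosed (V : Set Z) := Submodule.isClosed_topologicalClosure _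
  have hwV : ∀ k, w k ∈ V := fun k => Submodule.le_topologicalClosure _ (Submodule.subset_span ⟨k, rfl⟩)
  have hVinf : ¬ FiniteDimensional ℝ V := by
    intro hfin
    have hli : LinearIndependent ℝ (fun k => (⟨w k, hwV k⟩ : V)) := by
      rw [linearIndependent_iff']
      intro s g hg i hi
      have h1 := congrArg (fun t : V => φ i t.1) hg
      simp [hφw, hi] at h1
      exact h1
    have := hli.finite
    exact not_finite ℕ
  have hRV : ∀ v ∈ V, R v ∈ closure (F : Set W) := by
    intro v hv
    have : Set.MapsTo R (Submodule.span ℝ (Set.range w) : Set Z) (F : Set W) := by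
      intro v hv
      have : Submodule.span ℝ (Set.range w) ≤ F.comap (R : Z →ₗ[ℝ] W) := by
        rw [Submodule.span_le]
        rintro _ ⟨k, rfl⟩
        show R (w k) ∈ F
        rw [hRw]; exact hXF _ _
      exact this hv
    exact this.closure R.continuous hv
  obtain ⟨S, c, hc, hS⟩ := hmin.2 V hVcl hVinf
  let y' : ℕ → W := fun n => R (S (z n))
  let RS : Z →L[ℝ] W := R.comp (V.subtypeL.comp S)
  have hy' : ∀ b, lc y' b = RS (lc z b) := by
    intro b
    simp [lc, Finsupp.linearCombination_apply, Finsupp.sum, y', RS]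
  have hRSlow : ∀ v, δ / 2 * c * ‖v‖ ≤ ‖RS v‖ := fun v => by
    have e1 := hRlow (S v)
    have e2 := hS v
    calc _ = δ / 2 * (c * ‖v‖) := by ring
      _ ≤ δ / 2 * ‖S v‖ := by gcongr
      _ ≤ _ := e1
  let C := ‖RS‖ + 1
  have hC : 0 < C := by positivity
  let δ₁ := min (min (δ / 2 * c) C⁻¹) 1
  have hδ₁0 : 0 < δ₁ := by
    refine lt_min (lt_min (by positivity) (by positivity)) one_pos
  have hδ₁1 : δ₁ ≤ 1 := min_le_right _ _
  have hδ₁c : δ₁ ≤ δ / 2 * c := (min_le_left _ _).trans (min_le_left _ _)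
  have hδ₁C : C ≤ δ₁⁻¹ := by
    rw [le_inv_comm₀ hC hδ₁0]; exact (min_le_left _ _).trans (min_le_right _ _)
  have hbr : IsBranch (bourgainTree z δ₁ W) y' := by
    rw [branch_iff]
    intro b
    rw [hy']
    constructor
    · refine le_trans ?_ (hRSlow _)
      gcongr
    · refine (RS.le_opNorm _).trans ?_
      gcongr
      exact le_trans (by simp [C]) hδ₁C
  have hyQ : ∀ n, y' n ∈ closure Q := fun n =>
    closure_minimal hQ isClosed_closure (hRV _ (S (z n)).2)
  have hu : ∀ n, ∃ u ∈ Q, ‖u - y' n‖ ≤ δ₁ / (8 * K) * (1 / 2) ^ n := by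
    intro n
    obtain ⟨u, hu, hd⟩ := Metric.mem_closure_iff.1 (hyQ n) (δ₁ / (8 * K) * (1 / 2) ^ n) (by positivity)
    refine ⟨u, hu, ?_⟩
    rw [dist_comm, dist_eq_norm] at hd
    exact hd.le
  choose u huQ hud using hu
  refine ⟨δ₁ / 2, ⟨by positivity, by linarith⟩, u, huQ, fun n => ?_⟩
  refine h.perturb hδ₁0 hδ₁1 (hbr n) (by simp) ?_
  intro i hi
  simp only [List.length_ofFn] at hi
  rw [List.getD_eq_getElem _ _ (by simpa using hi), List.getD_eq_getElem _ _ (by simpa using hi),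
    List.getElem_ofFn, List.getElem_ofFn]
  exact hud i

/-- A branch in the big space gives a branch in the small space. -/
theorem no_branch (h : BasisConst z K) (hmin : IsMinimal Z) (hl1 : ¬ Embeds EllOne Z)
    {F : Submodule ℝ W} {Q : Set W} (hQ : (F : Set W) ⊆ closure Q)
    {v : ℕ → W} {lev : ℕ → ℕ} (hlev : ∀ n, {i | lev i < n}.Finite) (hL : L1Cond F v lev)
    {δ : ℝ} (hδ : 0 < δ) {y : ℕ → W} (hy : ∀ n, y n ∈ F ⊔ Submodule.span ℝ (Set.range v))
    (hbr : IsBranch (bourgainTree z δ W) y) :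
    ∃ δ' ∈ Set.Ioc (0:ℝ) 1, ∃ u : ℕ → W, (∀ n, u n ∈ Q) ∧ IsBranch (bourgainTree z δ' W) u := by
  rw [branch_iff] at hbr
  refine case_two h hmin hQ hδ hbr ?_
  intro N c hc
  by_contra! hcon
  exact case_one h hl1 hlev hL hδ hy (fun a => (hbr a).2) hc hcon

end nb

/-! ### Banach–Mazur -/

theorem banach_mazur (Y : Type*) [NormedAddCommGroup Y] [NormedSpace ℝ Y]
    [TopologicalSpace.SeparableSpace Y] : Nonempty (Y →ₗᵢ[ℝ] CantorC) := by
  classical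
  let K : Set (WeakDual ℝ Y) := WeakDual.toStrongDual ⁻¹' Metric.closedBall 0 1
  have hK : IsCompact K := WeakDual.isCompact_closedBall 0 1
  have hmet : TopologicalSpace.MetrizableSpace K := WeakDual.metrizable_of_isCompact ℝ Y K hK
  let _ : MetricSpace K := TopologicalSpace.metrizableSpaceMetric K
  have : CompactSpace K := isCompact_iff_compactSpace.mp hK
  have hne : Nonempty K := ⟨⟨0, by simp [K]⟩⟩
  obtain ⟨Φ, hΦc, hΦs⟩ := exists_nat_bool_continuous_surjective_of_compact K
  have hcont : ∀ y : Y, Continuous fun t => (Φ t : WeakDual ℝ Y) y := fun y =>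
    (WeakDual.eval_continuous y).comp (continuous_subtype_val.comp hΦc)
  let L : Y →ₗ[ℝ] CantorC :=
    { toFun := fun y => ⟨fun t => (Φ t : WeakDual ℝ Y) y, hcont y⟩
      map_add' := fun a b => by ext t; simp
      map_smul' := fun a b => by ext t; simp }
  refine ⟨⟨L, fun y => ?_⟩⟩
  apply le_antisymm
  · rw [ContinuousMap.norm_le _ (norm_nonneg _)]
    intro t
    have h1 : ‖WeakDual.toStrongDual (Φ t : WeakDual ℝ Y)‖ ≤ 1 :=
      mem_closedBall_zero_iff.mp (Φ t).2
    have := (WeakDual.toStrongDual (Φ t : WeakDual ℝ Y)).le_opNorm y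
    calc ‖(Φ t : WeakDual ℝ Y) y‖ ≤ ‖WeakDual.toStrongDual (Φ t : WeakDual ℝ Y)‖ * ‖y‖ := this
      _ ≤ 1 * ‖y‖ := by gcongr
      _ = ‖y‖ := one_mul _
  · obtain ⟨g, hg, hgy⟩ := exists_dual_vector'' ℝ y
    obtain ⟨t, ht⟩ := hΦs ⟨StrongDual.toWeakDual g, by simpa [K] using hg⟩
    have h2 : (L y) t = ‖y‖ := by
      change (Φ t : WeakDual ℝ Y) y = _
      rw [ht]; simpa using hgy
    calc ‖y‖ = ‖(L y) t‖ := by rw [h2]; simp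
      _ ≤ ‖L y‖ := ContinuousMap.norm_coe_le_norm _ _

/-! ### Coding -/

section coding

variable {W : Type*} [NormedAddCommGroup W] [NormedSpace ℝ W]

/-- Rational coefficients seen as real coefficients. -/
noncomputable def castf : (ℕ →₀ ℚ) →+ (ℕ →₀ ℝ) :=
  Finsupp.mapRange.addMonoidHom (Rat.castHom ℝ).toAddMonoidHom

/-- Rational linear combinations. -/
noncomputable def rc (x : ℕ → W) (c : ℕ →₀ ℚ) : W := lc x (castf c)

theorem rc_add (x : ℕ → W) (c c' : ℕ →₀ ℚ) : rc x (c + c') = rc x c + rc x c' := by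
  simp [rc]

theorem rc_zero (x : ℕ → W) : rc x 0 = 0 := by simp [rc]

theorem rc_eq (x : ℕ → W) (c : ℕ →₀ ℚ) :
    rc x c = ∑ i ∈ c.support, ((c i : ℚ) : ℝ) • x i := by
  unfold rc castf lc
  rw [Finsupp.linearCombination_apply]
  change (Finsupp.mapRange (Rat.castHom ℝ).toAddMonoidHom (map_zero _) c).sum _ = _
  rw [Finsupp.sum_mapRange_index (by simp)]
  rfl

theorem rc_single (x : ℕ → W) (i : ℕ) : rc x (Finsupp.single i 1) = x i := by
  rw [rc_eq, Finsupp.support_single _ one_ne_zero]; simp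

theorem rc_smul (x : ℕ → W) (q : ℚ) (c : ℕ →₀ ℚ) : rc x (q • c) = (q : ℝ) • rc x c := by
  have : castf (q • c) = (q : ℝ) • castf c := by
    ext i; simp [castf]
  simp [rc, this]

theorem rc_map {W' : Type*} [NormedAddCommGroup W'] [NormedSpace ℝ W'] (T : W →ₗᵢ[ℝ] W') (x : ℕ → W)
    (c : ℕ →₀ ℚ) : rc (fun i => T (x i)) c = T (rc x c) := by
  simp [rc_eq, map_sum]

theorem rc_mem_span (x : ℕ → W) {S : Set ℕ} {c : ℕ →₀ ℚ} (hc : ∀ i, c i ≠ 0 → i ∈ S) :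
    rc x c ∈ Submodule.span ℝ (x '' S) := by
  rw [rc_eq]
  refine Submodule.sum_mem _ fun i hi => Submodule.smul_mem _ _ (Submodule.subset_span ⟨i, ?_, rfl⟩)
  exact hc i (by simpa using hi)

theorem continuous_rc {P : Type*} [TopologicalSpace P] {x : P → ℕ → W} (hx : Continuous x)
    (c : ℕ →₀ ℚ) : Continuous fun p => rc (x p) c := by
  simp only [rc_eq]
  exact continuous_finsetSum _ fun i _ => ((continuous_apply i).comp hx).const_smul _

theorem span_subset_closure_rc (x : ℕ → W) (S : Set ℕ) :
    (Submodule.span ℝ (x '' S) : Set W) ⊆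
      closure {w | ∃ c : ℕ →₀ ℚ, (∀ i, c i ≠ 0 → i ∈ S) ∧ rc x c = w} := by
  set A : Set W := {w | ∃ c : ℕ →₀ ℚ, (∀ i, c i ≠ 0 → i ∈ S) ∧ rc x c = w} with hA
  have hadd : ∀ a ∈ A, ∀ b ∈ A, a + b ∈ A := by
    rintro a ⟨c, hc, rfl⟩ b ⟨c', hc', rfl⟩
    refine ⟨c + c', fun i hi => ?_, rc_add _ _ _⟩
    by_cases h : c i = 0
    · exact hc' i (fun h' => hi (by simp [h, h']))
    · exact hc i h
  have hsm : ∀ (q : ℚ), ∀ a ∈ A, (q : ℝ) • a ∈ A := by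
    rintro q a ⟨c, hc, rfl⟩
    refine ⟨q • c, fun i hi => hc i (fun h => hi (by simp [h])), rc_smul _ _ _⟩
  intro w hw
  induction hw using Submodule.span_induction with
  | mem w hw =>
    obtain ⟨i, hi, rfl⟩ := hw
    refine subset_closure ⟨Finsupp.single i 1, fun k hk => ?_, rc_single x i⟩
    by_cases h : i = k
    · exact h ▸ hi
    · simp [h] at hk
  | zero => exact subset_closure ⟨0, by simp, rc_zero x⟩
  | add a b _ _ iha ihb =>
    exact map_mem_closure₂ continuous_add iha ihb fun a ha b hb => hadd a ha b hb
  | smul r a _ iha =>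
    have h1 : ∀ q : ℚ, (q : ℝ) • a ∈ closure A := fun q =>
      map_mem_closure (continuous_const_smul _) iha (hsm q)
    have h2 : IsClosed {r : ℝ | r • a ∈ closure A} :=
      isClosed_closure.preimage (continuous_id.smul continuous_const)
    have h3 : Set.range (Rat.cast : ℚ → ℝ) ⊆ {r : ℝ | r • a ∈ closure A} := by
      rintro _ ⟨q, rfl⟩; exact h1 q
    have h4 := closure_minimal h3 h2
    rw [(Rat.denseRange_cast (𝕜 := ℝ)).closure_range] at h4
    exact h4 (Set.mem_univ r)

theorem span_range_subset_closure_rc (x : ℕ → W) :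
    (Submodule.span ℝ (Set.range x) : Set W) ⊆ closure (Set.range (rc x)) := by
  have := span_subset_closure_rc x Set.univ
  rw [Set.image_univ] at this
  refine this.trans (closure_mono ?_)
  rintro _ ⟨c, -, rfl⟩; exact ⟨c, rfl⟩

variable {Z : Type*} [NormedAddCommGroup Z] [NormedSpace ℝ Z]

theorem isClosed_tree {P Λ : Type*} [TopologicalSpace P] (z : ℕ → Z) (δ : ℝ) {ev : P → Λ → W}
    (hev : ∀ a, Continuous fun p => ev p a) (l : List Λ) :
    IsClosed {p | l.map (ev p) ∈ bourgainTree z δ W} := by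
  have hg : ∀ i, Continuous fun p => (l.map (ev p)).getD i 0 := by
    intro i
    cases h : l[i]? with
    | none => simpa [List.getD_eq_getElem?_getD, h] using continuous_const
    | some a => simpa [List.getD_eq_getElem?_getD, h] using hev a
  have hs : ∀ a : ℕ → ℝ, Continuous fun p =>
      ‖∑ i ∈ Finset.range l.length, a i • (l.map (ev p)).getD i 0‖ := fun a =>
    (continuous_finsetSum _ fun i _ => (hg i).const_smul _).norm
  have : {p | l.map (ev p) ∈ bourgainTree z δ W} = ⋂ a : ℕ → ℝ,
      ({p | δ * ‖∑ i ∈ Finset.range l.length, a i • z i‖ ≤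
          ‖∑ i ∈ Finset.range l.length, a i • (l.map (ev p)).getD i 0‖} ∩
        {p | ‖∑ i ∈ Finset.range l.length, a i • (l.map (ev p)).getD i 0‖ ≤
          δ⁻¹ * ‖∑ i ∈ Finset.range l.length, a i • z i‖}) := by
    ext p
    simp only [bourgainTree, List.length_map, Set.mem_iInter, Set.mem_inter_iff, Set.mem_ofPred_eq]
  rw [this]
  exact isClosed_iInter fun a => (isClosed_le continuous_const (hs a)).inter
    (isClosed_le (hs a) continuous_const)

theorem bourgainTree_anti (z : ℕ → Z) {δ δ' : ℝ} (h0 : 0 < δ') (h : δ' ≤ δ) :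
    bourgainTree z δ W ⊆ bourgainTree z δ' W := by
  intro l hl a
  obtain ⟨h1, h2⟩ := hl a
  refine ⟨le_trans (by gcongr) h1, h2.trans ?_⟩
  gcongr

end coding

/-- The space of codes. -/
abbrev CodeP : Type := (ℕ → CantorC) × (ℕ → CantorC) × (ℕ → ℕ) × (ℕ × List (ℕ →₀ ℚ) → ℕ)

set_option synthInstance.maxHeartbeats 400000 in
set_option synthInstance.maxSize 100000 in
instance : PolishSpace CodeP := by
  have h1 : SecondCountableTopology (ℕ → CantorC) := inferInstance
  have h2 : TopologicalSpace.IsCompletelyMetrizableSpace (ℕ → CantorC) := inferInstance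
  have h3 : SecondCountableTopology (ℕ × List (ℕ →₀ ℚ) → ℕ) := inferInstance
  have h4 : TopologicalSpace.IsCompletelyMetrizableSpace (ℕ × List (ℕ →₀ ℚ) → ℕ) := inferInstance
  have h5 : SecondCountableTopology ((ℕ → ℕ) × (ℕ × List (ℕ →₀ ℚ) → ℕ)) := inferInstance
  have h6 : TopologicalSpace.IsCompletelyMetrizableSpace ((ℕ → ℕ) × (ℕ × List (ℕ →₀ ℚ) → ℕ)) :=
    inferInstance
  have h7 : SecondCountableTopology CodeP := inferInstance
  have h8 : TopologicalSpace.IsCompletelyMetrizableSpace CodeP := inferInstance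
  exact PolishSpace.mk

/-- Evaluation of codes. -/
noncomputable def evc {W : Type*} [NormedAddCommGroup W] [NormedSpace ℝ W]
    (x v : ℕ → W) (c : (ℕ →₀ ℚ) × (ℕ →₀ ℚ)) : W := rc x c.1 + rc v c.2

section codeA
variable {Z : Type*} [NormedAddCommGroup Z] [NormedSpace ℝ Z]

/-- The Borel set of codes. -/
def codeA (z : ℕ → Z) (E : ℕ → Ordinal.{0}) : Set CodeP :=
  {p | ∀ n, ∃ B, ∀ i, p.2.2.1 i < n → i < B} ∩
  ({p | ∀ (n : ℕ) (c c' : ℕ →₀ ℚ) (q : ℕ →₀ ℚ) (m : ℕ),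
      ((∀ i, c i ≠ 0 → p.2.2.1 i < n) ∧ (∀ i, c' i ≠ 0 → n ≤ p.2.2.1 i)) →
      ∃ q1 q2 : ℕ →₀ ℚ, ‖rc p.2.1 c - rc p.1 q1‖ + ‖rc p.2.1 c' - rc p.1 q2‖ <
        ‖rc p.2.1 (c + c') - rc p.1 q‖ + 1 / ((m : ℝ) + 1)} ∩
  {p | ∀ (m : ℕ) (s : List (ℕ →₀ ℚ)) (i : ℕ →₀ ℚ),
      (s ++ [i]).map (rc p.1) ∈ bourgainTree z (1 / ((m : ℝ) + 1)) CantorC →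
      E (p.2.2.2 (m, s ++ [i])) < E (p.2.2.2 (m, s))})

theorem analytic_codeA (z : ℕ → Z) (E : ℕ → Ordinal.{0}) : AnalyticSet (codeA z E) := by
  let _ : MeasurableSpace CodeP := borel CodeP
  have : BorelSpace CodeP := ⟨rfl⟩
  apply MeasurableSet.analyticSet
  have hlev : ∀ i, Continuous fun p : CodeP => p.2.2.1 i := fun i => by fun_prop
  have hx : Continuous fun p : CodeP => p.1 := continuous_fst
  have hv : Continuous fun p : CodeP => p.2.1 := by fun_prop
  have hdisc : ∀ (i : ℕ) (A : Set ℕ), MeasurableSet {p : CodeP | p.2.2.1 i ∈ A} := fun i A =>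
    ((isOpen_discrete A).preimage (hlev i)).measurableSet
  refine MeasurableSet.inter ?_ (MeasurableSet.inter ?_ ?_)
  · have : ∀ n B i, MeasurableSet {p : CodeP | p.2.2.1 i < n → i < B} := fun n B i =>
      hdisc i {k | k < n → i < B}
    rw [Set.ofPred_forall]
    refine MeasurableSet.iInter fun n => ?_
    rw [Set.ofPred_exists]
    refine MeasurableSet.iUnion fun B => ?_
    rw [Set.ofPred_forall]
    exact MeasurableSet.iInter fun i => this n B i
  · rw [Set.ofPred_forall]; refine MeasurableSet.iInter fun n => ?_
    rw [Set.ofPred_forall]; refine MeasurableSet.iInter fun c => ?_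
    rw [Set.ofPred_forall]; refine MeasurableSet.iInter fun c' => ?_
    rw [Set.ofPred_forall]; refine MeasurableSet.iInter fun q => ?_
    rw [Set.ofPred_forall]; refine MeasurableSet.iInter fun m => ?_
    refine MeasurableSet.imp ?_ ?_
    · rw [Set.ofPred_and]
      refine MeasurableSet.inter ?_ ?_
      · rw [Set.ofPred_forall]; refine MeasurableSet.iInter fun i => ?_
        exact hdisc i {k | c i ≠ 0 → k < n}
      · rw [Set.ofPred_forall]; refine MeasurableSet.iInter fun i => ?_
        exact hdisc i {k | c' i ≠ 0 → n ≤ k}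
    · rw [Set.ofPred_exists]; refine MeasurableSet.iUnion fun q1 => ?_
      rw [Set.ofPred_exists]; refine MeasurableSet.iUnion fun q2 => ?_
      refine (isOpen_lt ?_ ?_).measurableSet
      · exact ((continuous_rc hv c).sub (continuous_rc hx q1)).norm.add
          ((continuous_rc hv c').sub (continuous_rc hx q2)).norm
      · exact (((continuous_rc hv (c + c')).sub (continuous_rc hx q)).norm).add continuous_const
  · rw [Set.ofPred_forall]; refine MeasurableSet.iInter fun m => ?_
    rw [Set.ofPred_forall]; refine MeasurableSet.iInter fun s => ?_
    rw [Set.ofPred_forall]; refine MeasurableSet.iInter fun i => ?_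
    refine MeasurableSet.imp ?_ ?_
    · exact (isClosed_tree z _ (fun c => continuous_rc hx c) (s ++ [i])).measurableSet
    · have : Continuous fun p : CodeP => (p.2.2.2 (m, s ++ [i]), p.2.2.2 (m, s)) := by fun_prop
      exact ((isOpen_discrete {k : ℕ × ℕ | E k.1 < E k.2}).preimage this).measurableSet

end codeA

section glemma

/-- `Y` is an extension of `X` by an `ℓ₁`-sum of finite-dimensional pieces. -/
def ExtPair (X Y : Type) [NormedAddCommGroup X] [NormedSpace ℝ X]
    [NormedAddCommGroup Y] [NormedSpace ℝ Y] : Prop :=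
  ∃ (j : X →ₗᵢ[ℝ] Y) (v : ℕ → Y) (lev : ℕ → ℕ), (∀ n, {i | lev i < n}.Finite) ∧
    Dense ((LinearMap.range j.toLinearMap ⊔ Submodule.span ℝ (Set.range v) : Submodule ℝ Y) : Set Y) ∧
    L1Cond (LinearMap.range j.toLinearMap) v lev

variable {Z : Type*} [NormedAddCommGroup Z] [NormedSpace ℝ Z] [CompleteSpace Z]

theorem quot_approx {W : Type*} [NormedAddCommGroup W] [NormedSpace ℝ W] {F : Submodule ℝ W}
    {x : ℕ → W} (hF : (F : Set W) ⊆ closure (Set.range (rc x))) (u : W) {ε : ℝ} (hε : 0 < ε) :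
    ∃ q, ‖u - rc x q‖ < ‖F.mkQ u‖ + ε := by
  obtain ⟨m, hm, hm2⟩ := Submodule.Quotient.norm_mk_lt (S := F) (F.mkQ u) (half_pos hε)
  have hmem : u - m ∈ F := by
    have : F.mkQ m = F.mkQ u := hm
    rw [← Submodule.ker_mkQ F, LinearMap.mem_ker, map_sub, this, sub_self]
  obtain ⟨_, ⟨q, rfl⟩, hq⟩ := Metric.mem_closure_iff.1 (hF hmem) _ (half_pos hε)
  refine ⟨q, ?_⟩
  rw [dist_eq_norm] at hq
  calc ‖u - rc x q‖ = ‖m + (u - m - rc x q)‖ := by congr 1; abel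
    _ ≤ ‖m‖ + ‖u - m - rc x q‖ := norm_add_le _ _
    _ < ‖F.mkQ u‖ + ε := by linarith

theorem mkQ_le {W : Type*} [NormedAddCommGroup W] [NormedSpace ℝ W] {F : Submodule ℝ W}
    (u : W) {f : W} (hf : f ∈ F) : ‖F.mkQ u‖ ≤ ‖u - f‖ := by
  have : F.mkQ u = F.mkQ (u - f) := by
    rw [map_sub, (Submodule.Quotient.mk_eq_zero F).2 hf |> (fun h => (h : F.mkQ f = 0)), sub_zero]
  rw [this]
  exact Submodule.Quotient.norm_mk_le F _

theorem continuous_mkQ_norm {W : Type*} [NormedAddCommGroup W] [NormedSpace ℝ W]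
    (F : Submodule ℝ W) : Continuous fun w => ‖F.mkQ w‖ := by
  refine LipschitzWith.continuous (K := 1) (LipschitzWith.of_dist_le_mul fun a b => ?_)
  rw [NNReal.coe_one, one_mul, Real.dist_eq, dist_eq_norm]
  refine (abs_norm_sub_norm_le _ _).trans ?_
  rw [← map_sub]
  exact Submodule.Quotient.norm_mk_le F _

theorem L1_of_rat_aux {W : Type*} [NormedAddCommGroup W] [NormedSpace ℝ W] {x v : ℕ → W} {lev : ℕ → ℕ}
    (h2 : ∀ (n : ℕ) (c c' : ℕ →₀ ℚ) (q : ℕ →₀ ℚ) (m : ℕ),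
      ((∀ i, c i ≠ 0 → lev i < n) ∧ (∀ i, c' i ≠ 0 → n ≤ lev i)) →
      ∃ q1 q2 : ℕ →₀ ℚ, ‖rc v c - rc x q1‖ + ‖rc v c' - rc x q2‖ <
        ‖rc v (c + c') - rc x q‖ + 1 / ((m : ℝ) + 1)) {F : Submodule ℝ W}
    (hF : (F : Set W) ⊆ closure (Set.range (rc x))) (hxF : ∀ q, rc x q ∈ F) (n : ℕ) (c c' : ℕ →₀ ℚ)
    (hc : ∀ i, c i ≠ 0 → lev i < n) (hc' : ∀ i, c' i ≠ 0 → n ≤ lev i) :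
      ‖F.mkQ (rc v c)‖ + ‖F.mkQ (rc v c')‖ ≤ ‖F.mkQ (rc v c + rc v c')‖ := by
  refine le_of_forall_pos_le_add fun ε hε => ?_
  obtain ⟨m, hm⟩ := exists_nat_one_div_lt (half_pos hε)
  obtain ⟨q, hq⟩ := quot_approx hF (rc v c + rc v c') (half_pos hε)
  obtain ⟨q1, q2, h⟩ := h2 n c c' q m ⟨hc, hc'⟩
  rw [rc_add] at h
  have e1 := mkQ_le (rc v c) (hxF q1)
  have e2 := mkQ_le (rc v c') (hxF q2)
  linarith

theorem L1_closure {W : Type*} [NormedAddCommGroup W] [NormedSpace ℝ W]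
    {F : Submodule ℝ W} {A B : Set W} (h : ∀ a ∈ A, ∀ b ∈ B, ‖F.mkQ a‖ + ‖F.mkQ b‖ ≤ ‖F.mkQ (a + b)‖) :
    ∀ a ∈ closure A, ∀ b ∈ closure B, ‖F.mkQ a‖ + ‖F.mkQ b‖ ≤ ‖F.mkQ (a + b)‖ := by
  have hN := continuous_mkQ_norm F
  have h1 : ∀ a ∈ closure A, ∀ b ∈ B, ‖F.mkQ a‖ + ‖F.mkQ b‖ ≤ ‖F.mkQ (a + b)‖ := by
    intro a ha b hb
    refine le_on_closure (s := A) (f := fun a => ‖F.mkQ a‖ + ‖F.mkQ b‖) (g := fun a => ‖F.mkQ (a + b)‖)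
      (fun a ha => h a ha b hb) (hN.add continuous_const).continuousOn ?_ ha
    exact (hN.comp (continuous_id.add continuous_const)).continuousOn
  intro a ha b hb
  refine le_on_closure (s := B) (f := fun b => ‖F.mkQ a‖ + ‖F.mkQ b‖) (g := fun b => ‖F.mkQ (a + b)‖)
    (fun b hb => h1 a ha b hb) (continuous_const.add hN).continuousOn ?_ hb
  exact (hN.comp (continuous_const.add continuous_id)).continuousOn

theorem L1_of_rat {W : Type*} [NormedAddCommGroup W] [NormedSpace ℝ W] {x v : ℕ → W} {lev : ℕ → ℕ}
    (h2 : ∀ (n : ℕ) (c c' : ℕ →₀ ℚ) (q : ℕ →₀ ℚ) (m : ℕ),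
      ((∀ i, c i ≠ 0 → lev i < n) ∧ (∀ i, c' i ≠ 0 → n ≤ lev i)) →
      ∃ q1 q2 : ℕ →₀ ℚ, ‖rc v c - rc x q1‖ + ‖rc v c' - rc x q2‖ <
        ‖rc v (c + c') - rc x q‖ + 1 / ((m : ℝ) + 1)) :
    L1Cond (Submodule.span ℝ (Set.range x)) v lev := by
  have hF := span_range_subset_closure_rc x
  have hxF : ∀ q, rc x q ∈ Submodule.span ℝ (Set.range x) := fun q => by
    have := rc_mem_span x (S := Set.univ) (c := q) (fun _ _ => trivial)
    rwa [Set.image_univ] at this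
  intro n u u' hu hu'
  refine L1_closure ?_ u (span_subset_closure_rc _ _ hu) u' (span_subset_closure_rc _ _ hu')
  rintro _ ⟨c, hc, rfl⟩ _ ⟨c', hc', rfl⟩
  exact L1_of_rat_aux h2 hF hxF n c c' hc hc'

theorem codeA_L1 {z : ℕ → Z} {E : ℕ → Ordinal.{0}} {p : CodeP} (hp : p ∈ codeA z E) :
    L1Cond (Submodule.span ℝ (Set.range p.1)) p.2.1 p.2.2.1 :=
  L1_of_rat hp.2.1

theorem continuous_evc {P W : Type*} [NormedAddCommGroup W] [NormedSpace ℝ W] [TopologicalSpace P]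
    {x v : P → ℕ → W} (hx : Continuous x) (hv : Continuous v) (c : (ℕ →₀ ℚ) × (ℕ →₀ ℚ)) :
    Continuous fun p => evc (x p) (v p) c :=
  (continuous_rc hx c.1).add (continuous_rc hv c.2)

theorem codeA_no_branch {z : ℕ → Z} {K : ℝ} (h : BasisConst z K) (hmin : IsMinimal Z)
    (hl1 : ¬ Embeds EllOne Z) {E : ℕ → Ordinal.{0}} {ξ : Ordinal.{0}} (hE : ∀ k, E k ≤ ξ)
    {p : CodeP} (hp : p ∈ codeA z E) {δ : ℝ} (hδ : 0 < δ) :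
    ¬ TreeIllFounded {l | l.map (evc p.1 p.2.1) ∈ bourgainTree z δ CantorC} := by
  rintro ⟨σ, hσ⟩
  have hL := codeA_L1 hp
  obtain ⟨hA1, -, hA3⟩ := hp
  have hlev : ∀ n, {i | p.2.2.1 i < n}.Finite := by
    intro n
    obtain ⟨B, hB⟩ := hA1 n
    exact (Set.finite_lt_nat B).subset fun i hi => hB i hi
  have hrc : ∀ (x : ℕ → CantorC) (c : ℕ →₀ ℚ), rc x c ∈ Submodule.span ℝ (Set.range x) := by
    intro x c
    have := rc_mem_span x (S := Set.univ) (c := c) (fun _ _ => trivial)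
    rwa [Set.image_univ] at this
  have hbr : IsBranch (bourgainTree z δ CantorC) (fun n => evc p.1 p.2.1 (σ n)) := by
    intro n
    have := hσ n
    rw [Set.mem_ofPred_eq, List.map_ofFn] at this
    exact this
  obtain ⟨δ', ⟨hδ'0, -⟩, u, hu, hub⟩ := no_branch h hmin hl1 (span_range_subset_closure_rc p.1) hlev hL hδ
    (fun n => Submodule.add_mem_sup (hrc p.1 (σ n).1) (hrc p.2.1 (σ n).2)) hbr
  choose c hc using hu
  obtain ⟨m, hm⟩ := exists_nat_one_div_lt hδ'0
  have hR : HasTreeRank {s : List (ℕ →₀ ℚ) | s.map (rc p.1) ∈ bourgainTree z (1 / ((m : ℝ) + 1)) CantorC} ξ :=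
    ⟨fun s => E (p.2.2.2 (m, s)), fun s => hE _, fun s i hs => hA3 m s i hs⟩
  refine hR.not_illFounded ⟨c, fun n => ?_⟩
  rw [Set.mem_ofPred_eq, List.map_ofFn]
  have := bourgainTree_anti z (by positivity) hm.le (hub n)
  have e : (rc p.1 ∘ fun i : Fin n => c i) = fun i : Fin n => u i := by
    funext i; exact hc i
  rw [e]; exact this

/-- A pair gives a code. -/
theorem exists_code {z : ℕ → Z} {ξ : Ordinal.{0}} (hξ : ξ < omega1)
    {E : ℕ → Ordinal.{0}} (hE : ∀ α ≤ ξ, ∃ k, E k = α) {X Y : Type}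
    [NormedAddCommGroup X] [NormedSpace ℝ X]
    [NormedAddCommGroup Y] [NormedSpace ℝ Y] 
    {j : X →ₗᵢ[ℝ] Y} {v : ℕ → Y} {lev : ℕ → ℕ} (hlev : ∀ n, {i | lev i < n}.Finite)
    (hL : L1Cond (LinearMap.range j.toLinearMap) v lev) (hX : bourgainIndex z X ≤ ξ)
    {d : ℕ → X} (hd : DenseRange d) (ι : Y →ₗᵢ[ℝ] CantorC) :
    ∃ ρ, ((fun i => ι (j (d i)), fun i => ι (v i), lev, ρ) : CodeP) ∈ codeA z E := by
  have hr : ∀ m : ℕ, HasTreeRank (bourgainTree z (1 / ((m : ℝ) + 1)) X) ξ := fun m =>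
    hasTreeRank_of_index z hξ hX ⟨by positivity, by
      rw [div_le_one (by positivity)]; linarith [(Nat.cast_nonneg m : (0:ℝ) ≤ m)]⟩
  choose r hr1 hr2 using hr
  choose k hk using fun (m : ℕ) (s : List (ℕ →₀ ℚ)) => hE (r m (s.map (rc d))) (hr1 m _)
  have hF : ((LinearMap.range j.toLinearMap : Submodule ℝ Y) : Set Y) ⊆
      closure (Set.range (rc fun i => j (d i))) := by
    rintro _ ⟨x, rfl⟩
    refine map_mem_closure j.continuous (hd x) ?_
    rintro _ ⟨i, rfl⟩
    exact ⟨Finsupp.single i 1, rc_single _ i⟩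
  have hjF : ∀ q, rc (fun i => j (d i)) q ∈ LinearMap.range j.toLinearMap := fun q => by
    rw [rc_map j]; exact ⟨_, rfl⟩
  have e1 : ∀ q, rc (fun i => ι (j (d i))) q = ι (rc (fun i => j (d i)) q) := fun q => rc_map ι _ q
  refine ⟨fun a => k a.1 a.2, ?_, ?_, ?_⟩
  · intro n
    obtain ⟨B, hB⟩ := (hlev n).bddAbove
    exact ⟨B + 1, fun i hi => Nat.lt_succ_of_le (hB hi)⟩
  · rintro n c c' q m ⟨hc, hc'⟩
    have h1 := hL n _ _ (rc_mem_span v (S := {i | lev i < n}) hc) (rc_mem_span v (S := {i | n ≤ lev i}) hc')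
    have hε : (0:ℝ) < 1 / ((m : ℝ) + 1) / 2 := by positivity
    obtain ⟨q1, hq1⟩ := quot_approx hF (rc v c) hε
    obtain ⟨q2, hq2⟩ := quot_approx hF (rc v c') hε
    refine ⟨q1, q2, ?_⟩
    simp only [e1, rc_map ι, ← map_sub, LinearIsometry.norm_map]
    have h2 := mkQ_le (rc v (c + c')) (hjF q)
    rw [← rc_add] at h1
    linarith
  · intro m s i hs
    have e2 : (s ++ [i]).map (rc fun i => ι (j (d i))) = (((s ++ [i]).map (rc d)).map j).map ι := by
      rw [List.map_map, List.map_map]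
      congr 1
      funext q
      rw [e1, rc_map j]; rfl
    have hs' : (s ++ [i]).map (rc fun i => ι (j (d i))) ∈ bourgainTree z (1 / ((m : ℝ) + 1)) CantorC := hs
    rw [e2, map_mem_bourgainTree_iff, map_mem_bourgainTree_iff] at hs'
    change E (k m (s ++ [i])) < E (k m s)
    rw [hk, hk]
    rw [List.map_append] at hs' ⊢
    exact hr2 m _ _ hs'

theorem evc_dense {X Y : Type}
    [NormedAddCommGroup X] [NormedSpace ℝ X]
    [NormedAddCommGroup Y] [NormedSpace ℝ Y] 
    {j : X →ₗᵢ[ℝ] Y} {v : ℕ → Y} 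
    (hD : Dense ((LinearMap.range j.toLinearMap ⊔ Submodule.span ℝ (Set.range v) : Submodule ℝ Y) : Set Y))
    {d : ℕ → X} (hd : DenseRange d) : DenseRange (evc (fun i => j (d i)) v) := by
  have h1 : ((LinearMap.range j.toLinearMap ⊔ Submodule.span ℝ (Set.range v) : Submodule ℝ Y) : Set Y)
      ⊆ closure (Set.range (evc (fun i => j (d i)) v)) := by
    intro w hw
    obtain ⟨a, ha, b, hb, rfl⟩ := Submodule.mem_sup.1 hw
    have hF : a ∈ closure (Set.range (rc fun i => j (d i))) := by
      obtain ⟨x, rfl⟩ := ha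
      refine map_mem_closure j.continuous (hd x) ?_
      rintro _ ⟨i, rfl⟩
      exact ⟨Finsupp.single i 1, rc_single _ i⟩
    refine map_mem_closure₂ continuous_add hF (span_range_subset_closure_rc v hb) ?_
    rintro _ ⟨c, rfl⟩ _ ⟨c', rfl⟩
    exact ⟨(c, c'), rfl⟩
  exact dense_closure.1 (hD.mono h1)

theorem rank_of_code {z : ℕ → Z} {K : ℝ} (h : BasisConst z K) {X Y : Type}
    [NormedAddCommGroup X] [NormedSpace ℝ X]
    [NormedAddCommGroup Y] [NormedSpace ℝ Y] 
    {j : X →ₗᵢ[ℝ] Y} {v : ℕ → Y} 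
    (hD : Dense ((LinearMap.range j.toLinearMap ⊔ Submodule.span ℝ (Set.range v) : Submodule ℝ Y) : Set Y))
    {d : ℕ → X} (hd : DenseRange d) (ι : Y →ₗᵢ[ℝ] CantorC) {η : Ordinal.{0}}
    (hη : ∀ m : ℕ, HasTreeRank {l | l.map (evc (fun i => ι (j (d i))) fun i => ι (v i)) ∈
      bourgainTree z (1 / ((m : ℝ) + 1)) CantorC} η) :
    bourgainIndex z Y ≤ η + 1 := by
  refine index_le_of_hasTreeRank z fun δ hδ => ?_
  have hδ0 := hδ.1
  have hK := h.one_le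
  have hK0 : 0 < K := by linarith
  obtain ⟨m, hm⟩ := exists_nat_one_div_lt (half_pos hδ.1)
  have hdense := evc_dense hD hd
  have hc : ∀ (i : ℕ) (y : Y), ∃ c, ‖evc (fun i => j (d i)) v c - y‖ ≤ δ / (8 * K) * (1 / 2) ^ i := by
    intro i y
    obtain ⟨c, hc⟩ := hdense.exists_dist_lt y (ε := δ / (8 * K) * (1 / 2) ^ i) (by positivity)
    refine ⟨c, ?_⟩
    rw [dist_comm, dist_eq_norm] at hc
    exact hc.le
  choose code hcode using hc
  refine (hη m).comap (fun l => l.mapIdx code) fun l a hla => ⟨⟨code l.length a, List.mapIdx_concat⟩, ?_⟩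
  set L := l ++ [a] with hLdef
  have e : (L.mapIdx code).map (evc (fun i => ι (j (d i))) fun i => ι (v i)) =
      ((L.mapIdx code).map (evc (fun i => j (d i)) v)).map ι := by
    rw [List.map_map]
    congr 1
    funext c
    simp only [evc, Function.comp, map_add, rc_map ι]
  rw [Set.mem_ofPred_eq, e, map_mem_bourgainTree_iff]
  refine bourgainTree_anti z (by positivity) hm.le (h.perturb hδ.1 hδ.2 hla (by simp) fun i hi => ?_)
  have : ((L.mapIdx code).map (evc (fun i => j (d i)) v)).getD i 0 = evc (fun i => j (d i)) v (code i (L.getD i 0)) := by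
    simp [List.getD_eq_getElem?_getD, List.getElem?_eq_getElem hi]
  rw [this]
  exact hcode i _

set_option maxHeartbeats 1000000 in
theorem g_lemma {z : ℕ → Z} {K : ℝ} (h : BasisConst z K) (hmin : IsMinimal Z)
    (hl1 : ¬ Embeds EllOne Z) {ξ : Ordinal.{0}} (hξ : ξ < omega1) :
    ∃ η < omega1, ∀ (X Y : Type) [NormedAddCommGroup X] [NormedSpace ℝ X]
      [TopologicalSpace.SeparableSpace X] [NormedAddCommGroup Y] [NormedSpace ℝ Y]
      [TopologicalSpace.SeparableSpace Y],
      ExtPair X Y → bourgainIndex z X ≤ ξ → bourgainIndex z Y ≤ η := by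
  have hcount : (Set.Iic ξ).Countable := by
    have h1 : ξ + 1 < omega1 := by
      have := omega1_isSuccLimit.succ_lt hξ
      simpa using this
    have h2 : (ξ + 1).card < Cardinal.aleph 1 := Cardinal.lt_ord.1 h1
    have h3 : (ξ + 1).card ≤ Cardinal.aleph0 := by
      rw [← Cardinal.aleph_zero, ← Order.lt_succ_iff, Cardinal.succ_aleph]
      simpa using h2
    have h4 : Cardinal.mk (Set.Iio (ξ + 1)) ≤ Cardinal.aleph0 := by
      rw [Cardinal.mk_Iio_ordinal]
      rw [Cardinal.lift_le_aleph0]; exact h3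
    have h5 := Cardinal.le_aleph0_iff_set_countable.1 h4
    refine h5.mono fun a ha => ?_
    exact Order.lt_add_one_iff.2 (Set.mem_Iic.1 ha)
  obtain ⟨E, hE⟩ := hcount.exists_eq_range ⟨ξ, Set.mem_Iic.2 le_rfl⟩
  have hE1 : ∀ k, E k ≤ ξ := fun k => by
    have : E k ∈ Set.Iic ξ := hE ▸ ⟨k, rfl⟩
    exact this
  have hE2 : ∀ α ≤ ξ, ∃ k, E k = α := fun α hα => by
    have : α ∈ Set.range E := hE ▸ hα
    exact this
  have han := analytic_codeA z E
  rw [AnalyticSet_def] at han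
  rcases han with hem | ⟨f, hf, hfr⟩
  · refine ⟨0, (zero_le (a := ξ)).trans_lt hξ, fun X Y _ _ _ _ _ _ ⟨j, v, lev, h1, h2, h3⟩ hX => ?_⟩
    obtain ⟨ι⟩ := banach_mazur Y
    obtain ⟨ρ, hρ⟩ := exists_code hξ hE2 h1 h3 hX (TopologicalSpace.denseRange_denseSeq X) ι
    rw [hem] at hρ
    exact hρ.elim
  · have hfA : ∀ t, f t ∈ codeA z E := fun t => hfr ▸ ⟨t, rfl⟩
    have hb : ∀ m : ℕ, ∃ η < omega1, ∀ t, HasTreeRank {l | l.map (evc (f t).1 (f t).2.1) ∈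
        bourgainTree z (1 / ((m : ℝ) + 1)) CantorC} η := by
      intro m
      have hx : Continuous fun p : CodeP => p.1 := continuous_fst
      have hv : Continuous fun p : CodeP => p.2.1 := by fun_prop
      refine tree_boundedness hf (Λ := (ℕ →₀ ℚ) × (ℕ →₀ ℚ))
        (fun l => {p : CodeP | l.map (evc p.1 p.2.1) ∈ bourgainTree z (1 / ((m : ℝ) + 1)) CantorC}) ?_ ?_ ?_
      · intro l
        exact isClosed_tree z _ (fun c => continuous_evc hx hv c) l
      · intro p s t hst ht
        exact bourgainTree_isTree z _ _ _ _ (hst.map _) ht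
      · intro t
        exact codeA_no_branch h hmin hl1 hE1 (hfA t) (by positivity)
    choose η hη1 hη2 using hb
    refine ⟨(⨆ m, η m) + 1, ?_, fun X Y _ _ _ _ _ _ ⟨j, v, lev, h1, h2, h3⟩ hX => ?_⟩
    · have := omega1_isSuccLimit.succ_lt (omega1_iSup_lt hη1)
      simpa using this
    obtain ⟨ι⟩ := banach_mazur Y
    obtain ⟨ρ, hρ⟩ := exists_code hξ hE2 h1 h3 hX (TopologicalSpace.denseRange_denseSeq X) ι
    rw [← hfr] at hρ
    obtain ⟨t, ht⟩ := hρ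
    refine rank_of_code h h2 (TopologicalSpace.denseRange_denseSeq X) ι fun m => ?_
    have := hη2 m t
    rw [ht] at this
    obtain ⟨r, hr1, hr2⟩ := this
    exact ⟨r, fun l => (hr1 l).trans (Ordinal.le_iSup η m), hr2⟩

end glemma

section lpone

variable {E : ℕ → Type} [∀ n, NormedAddCommGroup (E n)] [∀ n, NormedSpace ℝ (E n)]
variable {Y : Type} [NormedAddCommGroup Y] [NormedSpace ℝ Y]

theorem l1_hasSum (f : lp E 1) : HasSum (fun i => ‖f i‖) ‖f‖ := by
  have := lp.hasSum_norm (p := 1) (by simp) f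
  simpa using this

/-- Constructor for elements of the `ℓ₁`-sum. -/
def l1mk (f : ∀ n, E n) (hf : Summable fun i => ‖f i‖) : lp E 1 :=
  ⟨f, memℓp_gen (by simpa using hf)⟩

theorem l1mk_apply (f : ∀ n, E n) (hf : Summable fun i => ‖f i‖) (n : ℕ) : l1mk f hf n = f n := rfl

/-- Inclusion of a summand. -/
noncomputable def l1s (E : ℕ → Type) [∀ n, NormedAddCommGroup (E n)] [∀ n, NormedSpace ℝ (E n)] (m : ℕ) :
    E m →L[ℝ] lp E 1 := lp.singleContinuousLinearMap ℝ E 1 m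

/-- Coordinate projection. -/
noncomputable def l1e (E : ℕ → Type) [∀ n, NormedAddCommGroup (E n)] [∀ n, NormedSpace ℝ (E n)] (m : ℕ) :
    lp E 1 →L[ℝ] E m := lp.evalCLM ℝ E 1 m

theorem l1e_apply (m : ℕ) (f : lp E 1) : l1e E m f = f m := rfl

theorem l1s_self (m : ℕ) (a : E m) : l1s E m a m = a := lp.single_apply_self _ _ _

theorem l1s_ne {m n : ℕ} (a : E m) (h : n ≠ m) : l1s E m a n = 0 := lp.single_apply_ne _ _ _ h

theorem l1s_norm (m : ℕ) (a : E m) : ‖l1s E m a‖ = ‖a‖ := lp.norm_single (by simp) _ _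

theorem l1_hasSum_single (f : lp E 1) : HasSum (fun m => l1s E m (f m)) f :=
  lp.hasSum_single (by simp) f

theorem l1_ext {f g : lp E 1} (h : ∀ m, f m = g m) : f = g := lp.ext (funext h)

theorem l1_clm_ext {F : Type*} [NormedAddCommGroup F] [NormedSpace ℝ F] {S T : lp E 1 →L[ℝ] F}
    (h : ∀ m a, S (l1s E m a) = T (l1s E m a)) : S = T :=
  lp.ext_continuousLinearMap (by simp) fun m => by ext a; exact h m a

theorem l1_summable_norm {A : ∀ m, E m →L[ℝ] Y} {C : ℝ} (hA : ∀ m e, ‖A m e‖ ≤ C * ‖e‖) (f : lp E 1) :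
    Summable fun m => ‖A m (f m)‖ :=
  Summable.of_nonneg_of_le (fun _ => norm_nonneg _) (fun m => hA m (f m)) ((l1_hasSum f).summable.mul_left C)

/-- The map on an `ℓ₁`-sum induced by a uniformly bounded family. -/
noncomputable def l1lift [CompleteSpace Y] (A : ∀ m, E m →L[ℝ] Y) (C : ℝ) (hA : ∀ m e, ‖A m e‖ ≤ C * ‖e‖) :
    lp E 1 →L[ℝ] Y :=
  LinearMap.mkContinuous
    { toFun := fun f => ∑' m, A m (f m)
      map_add' := fun f g => by
        rw [← ((l1_summable_norm hA f).of_norm).tsum_add ((l1_summable_norm hA g).of_norm)]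
        exact tsum_congr fun m => by simp
      map_smul' := fun r f => by
        rw [RingHom.id_apply, ← tsum_const_smul'']
        exact tsum_congr fun m => by simp } C (fun f => by
      refine (norm_tsum_le_tsum_norm (l1_summable_norm hA f)).trans ?_
      rw [← (l1_hasSum f).tsum_eq, ← tsum_mul_left]
      exact (l1_summable_norm hA f).tsum_le_tsum (fun m => hA m (f m)) ((l1_hasSum f).summable.mul_left C))

theorem l1lift_hasSum [CompleteSpace Y] {A : ∀ m, E m →L[ℝ] Y} {C : ℝ} (hA : ∀ m e, ‖A m e‖ ≤ C * ‖e‖)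
    (f : lp E 1) : HasSum (fun m => A m (f m)) (l1lift A C hA f) :=
  ((l1_summable_norm hA f).of_norm).hasSum

theorem l1lift_bound [CompleteSpace Y] {A : ∀ m, E m →L[ℝ] Y} {C : ℝ} (hA : ∀ m e, ‖A m e‖ ≤ C * ‖e‖)
    (f : lp E 1) : ‖l1lift A C hA f‖ ≤ C * ‖f‖ := by
  refine (norm_tsum_le_tsum_norm (l1_summable_norm hA f)).trans ?_
  rw [← (l1_hasSum f).tsum_eq, ← tsum_mul_left]
  exact (l1_summable_norm hA f).tsum_le_tsum (fun m => hA m (f m)) ((l1_hasSum f).summable.mul_left C)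

theorem l1lift_single [CompleteSpace Y] {A : ∀ m, E m →L[ℝ] Y} {C : ℝ} (hA : ∀ m e, ‖A m e‖ ≤ C * ‖e‖)
    (m : ℕ) (a : E m) : l1lift A C hA (l1s E m a) = A m a := by
  refine (l1lift_hasSum hA (l1s E m a)).unique ?_
  have : A m a = A m (l1s E m a m) := by rw [l1s_self]
  rw [this]
  exact hasSum_single m fun n hn => by rw [l1s_ne _ hn, map_zero]

theorem l1_norm_split (n : ℕ) (f g : lp E 1) (hf : ∀ k, n ≤ k → f k = 0) (hg : ∀ k, k < n → g k = 0) :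
    ‖f + g‖ = ‖f‖ + ‖g‖ := by
  refine (l1_hasSum (f + g)).unique ?_
  have := (l1_hasSum f).add (l1_hasSum g)
  convert this using 2 with k
  change ‖f k + g k‖ = _
  rcases Nat.lt_or_ge k n with h | h
  · simp [hg k h]
  · simp [hf k h]

theorem extPair_of_lp {X : Type} [NormedAddCommGroup X] [NormedSpace ℝ X] [∀ n, FiniteDimensional ℝ (E n)]
    (j : X →ₗᵢ[ℝ] Y) (A : lp E 1 →L[ℝ] Y) (hs : ∀ y, ∃ x ε, j x + A ε = y)
    (hL : ∀ (n : ℕ) (f g : lp E 1), (∀ k, n ≤ k → f k = 0) → (∀ k, k < n → g k = 0) → ∀ (x : X) (η : ℝ), 0 < η →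
      ∃ x1 x2, ‖A f - j x1‖ + ‖A g - j x2‖ ≤ ‖A (f + g) - j x‖ + η) : ExtPair X Y := by
  classical
  let d : ℕ → ℕ := fun n => Module.finrank ℝ (E n)
  let b : ∀ n, Module.Basis (Fin (d n)) ℝ (E n) := fun n => Module.finBasis ℝ (E n)
  let v : ℕ → Y := fun i => if h : i.unpair.2 < d i.unpair.1 then
    A (l1s E i.unpair.1 (b i.unpair.1 ⟨i.unpair.2, h⟩)) else 0
  let lev : ℕ → ℕ := fun i => if i.unpair.2 < d i.unpair.1 then i.unpair.1 else i.unpair.1 + i.unpair.2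
  have hv : ∀ i, ∃ e : E (i.unpair.1), v i = A (l1s E i.unpair.1 e) ∧ (e ≠ 0 → lev i = i.unpair.1) := by
    intro i
    by_cases h : i.unpair.2 < d i.unpair.1
    · exact ⟨b i.unpair.1 ⟨i.unpair.2, h⟩, by simp [v, h], fun _ => by simp [lev, h]⟩
    · exact ⟨0, by simp [v, h], fun h => absurd rfl h⟩
  refine ⟨j, v, lev, ?_, ?_, ?_⟩
  · intro n
    have : {i | lev i < n} ⊆ (fun q : ℕ × ℕ => Nat.pair q.1 q.2) ''
        (Set.Iio n ×ˢ Set.Iio (n + ∑ a ∈ Finset.range n, d a)) := by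
      intro i hi
      refine ⟨(i.unpair.1, i.unpair.2), ?_, Nat.pair_unpair i⟩
      rw [Set.mem_ofPred_eq] at hi
      simp only [Set.mem_prod, Set.mem_Iio]
      by_cases h : i.unpair.2 < d i.unpair.1
      · simp only [lev, h, if_true] at hi
        refine ⟨hi, ?_⟩
        have := Finset.single_le_sum (f := d) (fun _ _ => Nat.zero_le _) (Finset.mem_range.2 hi)
        omega
      · simp only [lev, h, if_false] at hi
        omega
    exact (((Set.finite_Iio _).prod (Set.finite_Iio _)).image _).subset this
  · have h1 : ∀ (m : ℕ) (e : E m), A (l1s E m e) ∈ Submodule.span ℝ (Set.range v) := by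
      intro m e
      rw [← (b m).sum_repr e, map_sum, map_sum]
      refine Submodule.sum_mem _ fun k _ => ?_
      rw [map_smul, map_smul]
      refine Submodule.smul_mem _ _ (Submodule.subset_span ⟨Nat.pair m k, ?_⟩)
      have hk : (Nat.pair m k).unpair = (m, (k : ℕ)) := Nat.unpair_pair _ _
      have gen : ∀ (q : ℕ × ℕ), q = (m, (k : ℕ)) → (if h : q.2 < d q.1 then A (l1s E q.1 (b q.1 ⟨q.2, h⟩)) else 0)
          = A (l1s E m (b m k)) := by
        rintro _ rfl
        simp
      exact gen _ hk
    have h2 : ∀ f : lp E 1, A f ∈ closure ((Submodule.span ℝ (Set.range v) : Submodule ℝ Y) : Set Y) := by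
      intro f
      have := (l1_hasSum_single f).mapL A
      exact mem_closure_of_tendsto this (Filter.Eventually.of_forall fun s =>
        Submodule.sum_mem _ fun m _ => h1 m _)
    intro y
    obtain ⟨x, f, rfl⟩ := hs y
    have hx : j x ∈ closure ((LinearMap.range j.toLinearMap : Submodule ℝ Y) : Set Y) :=
      subset_closure ⟨x, rfl⟩
    exact map_mem_closure₂ continuous_add hx (h2 f) fun a ha b hb => Submodule.add_mem_sup ha hb
  · intro n u u' hu hu'
    have h1 : ∀ (n : ℕ), ∀ u ∈ Submodule.span ℝ (v '' {i | lev i < n}),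
        ∃ f : lp E 1, (∀ k, n ≤ k → f k = 0) ∧ A f = u := by
      intro n u hu
      induction hu using Submodule.span_induction with
      | mem w hw =>
        obtain ⟨i, hi, rfl⟩ := hw
        obtain ⟨e, he, he2⟩ := hv i
        refine ⟨l1s E _ e, fun k hk => ?_, he.symm⟩
        by_cases h0 : e = 0
        · simp [h0]
        · refine l1s_ne _ ?_
          rw [Set.mem_ofPred_eq, he2 h0] at hi
          omega
      | zero => exact ⟨0, fun _ _ => rfl, map_zero _⟩
      | add a b _ _ iha ihb =>
        obtain ⟨f, hf, rfl⟩ := iha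
        obtain ⟨g, hg, rfl⟩ := ihb
        refine ⟨f + g, fun k hk => ?_, map_add _ _ _⟩
        change f k + g k = 0
        rw [hf k hk, hg k hk, add_zero]
      | smul r a _ iha =>
        obtain ⟨f, hf, rfl⟩ := iha
        refine ⟨r • f, fun k hk => ?_, map_smul _ _ _⟩
        change r • f k = 0
        rw [hf k hk, smul_zero]
    have h2 : ∀ (n : ℕ), ∀ u ∈ Submodule.span ℝ (v '' {i | n ≤ lev i}),
        ∃ f : lp E 1, (∀ k, k < n → f k = 0) ∧ A f = u := by
      intro n u hu
      induction hu using Submodule.span_induction with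
      | mem w hw =>
        obtain ⟨i, hi, rfl⟩ := hw
        obtain ⟨e, he, he2⟩ := hv i
        refine ⟨l1s E _ e, fun k hk => ?_, he.symm⟩
        by_cases h0 : e = 0
        · simp [h0]
        · refine l1s_ne _ ?_
          rw [Set.mem_ofPred_eq, he2 h0] at hi
          omega
      | zero => exact ⟨0, fun _ _ => rfl, map_zero _⟩
      | add a b _ _ iha ihb =>
        obtain ⟨f, hf, rfl⟩ := iha
        obtain ⟨g, hg, rfl⟩ := ihb
        refine ⟨f + g, fun k hk => ?_, map_add _ _ _⟩
        change f k + g k = 0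
        rw [hf k hk, hg k hk, add_zero]
      | smul r a _ iha =>
        obtain ⟨f, hf, rfl⟩ := iha
        refine ⟨r • f, fun k hk => ?_, map_smul _ _ _⟩
        change r • f k = 0
        rw [hf k hk, smul_zero]
    obtain ⟨f, hf, rfl⟩ := h1 n u hu
    obtain ⟨g, hg, rfl⟩ := h2 n u' hu'
    refine le_of_forall_pos_le_add fun ε hε => ?_
    obtain ⟨m, hm, hm2⟩ := Submodule.Quotient.norm_mk_lt
      (S := LinearMap.range j.toLinearMap) ((LinearMap.range j.toLinearMap).mkQ (A f + A g)) (half_pos hε)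
    have hmem : (A f + A g) - m ∈ LinearMap.range j.toLinearMap := by
      have : (LinearMap.range j.toLinearMap).mkQ m = (LinearMap.range j.toLinearMap).mkQ (A f + A g) := hm
      rw [← Submodule.ker_mkQ (LinearMap.range j.toLinearMap), LinearMap.mem_ker, map_sub, this, sub_self]
    obtain ⟨x, hx⟩ := hmem
    obtain ⟨x1, x2, h⟩ := hL n f g hf hg x _ (half_pos hε)
    have e1 := mkQ_le (F := LinearMap.range j.toLinearMap) (A f) (f := j x1) ⟨x1, rfl⟩
    have e2 := mkQ_le (F := LinearMap.range j.toLinearMap) (A g) (f := j x2) ⟨x2, rfl⟩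
    have e3 : A (f + g) - j x = m := by
      rw [map_add]
      have : j x = A f + A g - m := hx
      rw [this]; abel
    rw [e3] at h
    linarith

end lpone

section pushout

set_option maxHeartbeats 1000000 in
theorem exists_pushout {X L M : Type} [NormedAddCommGroup X] [NormedSpace ℝ X] [CompleteSpace X]
    [NormedAddCommGroup L] [NormedSpace ℝ L] [CompleteSpace L]
    [NormedAddCommGroup M] [NormedSpace ℝ M]
    (S : M →L[ℝ] X) (Q : M →L[ℝ] L) (hSQ : ∀ f, ‖S f‖ ≤ ‖Q f‖) :
    ∃ (Y : Type) (_ : NormedAddCommGroup Y) (_ : NormedSpace ℝ Y) (_ : CompleteSpace Y)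
      (j : X →ₗᵢ[ℝ] Y) (A : L →L[ℝ] Y), (∀ e, ‖A e‖ ≤ ‖e‖) ∧ (∀ y, ∃ x e, j x + A e = y) ∧
      (∀ f, j (S f) = A (Q f)) ∧
      (∀ x e η, 0 < η → ∃ f, ‖x + S f‖ + ‖e - Q f‖ ≤ ‖j x + A e‖ + η) ∧
      (∀ (V : Type) [NormedAddCommGroup V] [NormedSpace ℝ V] (α : X →L[ℝ] V) (β : L →L[ℝ] V) (C : ℝ),
        0 ≤ C → (∀ x, ‖α x‖ ≤ C * ‖x‖) → (∀ e, ‖β e‖ ≤ C * ‖e‖) → (∀ f, α (S f) = β (Q f)) →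
        ∃ γ : Y →L[ℝ] V, (∀ x, γ (j x) = α x) ∧ (∀ e, γ (A e) = β e) ∧ ∀ y, ‖γ y‖ ≤ C * ‖y‖) := by
  classical
  let U := WithLp.prodContinuousLinearEquiv 1 ℝ X L
  have hU : ∀ x e, ‖U.symm (x, e)‖ = ‖x‖ + ‖e‖ := fun x e => WithLp.prod_norm_eq_of_L1 _
  have hU2 : ∀ b, ‖b‖ = ‖(U b).1‖ + ‖(U b).2‖ := fun b => WithLp.prod_norm_eq_of_L1 b
  let G : M →L[ℝ] WithLp 1 (X × L) := U.symm.toContinuousLinearMap ∘L (S.prod (-Q))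
  have hG : ∀ f, G f = U.symm (S f, - Q f) := fun f => rfl
  let R : Submodule ℝ (WithLp 1 (X × L)) := (LinearMap.range G.toLinearMap).topologicalClosure
  have hR : IsClosed (R : Set (WithLp 1 (X × L))) := Submodule.isClosed_topologicalClosure _
  have hRc : (R : Set (WithLp 1 (X × L))) = closure (Set.range G) := by
    rw [Submodule.topologicalClosure_coe]; rfl
  have hGR : ∀ f, G f ∈ R := fun f => by
    have : G f ∈ (R : Set (WithLp 1 (X × L))) := by rw [hRc]; exact subset_closure ⟨f, rfl⟩
    exact this
  have hRn : ∀ r ∈ R, ‖(U r).1‖ ≤ ‖(U r).2‖ := by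
    intro r hr
    have hr' : r ∈ closure (Set.range G) := by rw [← hRc]; exact hr
    have hcl : IsClosed {r | ‖(U r).1‖ ≤ ‖(U r).2‖} :=
      isClosed_le (continuous_fst.comp U.continuous).norm (continuous_snd.comp U.continuous).norm
    refine closure_minimal ?_ hcl hr'
    rintro _ ⟨f, rfl⟩
    rw [Set.mem_ofPred_eq, hG]
    simpa using hSQ f
  have : IsClosed (R : Set (WithLp 1 (X × L))) := hR
  let Y := WithLp 1 (X × L) ⧸ R
  let _i1 : NormedAddCommGroup Y := Submodule.Quotient.normedAddCommGroup R
  let _i2 : NormedSpace ℝ Y := Submodule.Quotient.normedSpace R ℝ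
  have hcomp : CompleteSpace Y := inferInstance
  let mk : WithLp 1 (X × L) →ₗ[ℝ] Y := R.mkQ
  have hmk1 : ∀ b, ‖mk b‖ ≤ ‖b‖ := fun b => Submodule.Quotient.norm_mk_le R b
  have hmkc : ∀ y : Y, ∀ η, 0 < η → ∃ b, mk b = y ∧ ‖b‖ < ‖y‖ + η := fun y η hη =>
    Submodule.Quotient.norm_mk_lt (S := R) y hη
  have hker : ∀ b b', mk b = mk b' → b' - b ∈ R := by
    intro b b' h
    rw [← Submodule.ker_mkQ R, LinearMap.mem_ker, map_sub]
    exact sub_eq_zero.2 h.symm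
  have hker2 : ∀ r ∈ R, mk r = 0 := fun r hr => (Submodule.Quotient.mk_eq_zero R).2 hr
  let j0 : X →ₗ[ℝ] Y := mk ∘ₗ U.symm.toLinearMap ∘ₗ LinearMap.inl ℝ X L
  have hj0 : ∀ x, j0 x = mk (U.symm (x, 0)) := fun x => rfl
  let A0 : L →ₗ[ℝ] Y := mk ∘ₗ U.symm.toLinearMap ∘ₗ LinearMap.inr ℝ X L
  have hA0 : ∀ e, A0 e = mk (U.symm (0, e)) := fun x => rfl
  have hjA : ∀ x e, j0 x + A0 e = mk (U.symm (x, e)) := by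
    intro x e
    rw [hj0, hA0, ← map_add, ← map_add]; simp
  have happ : ∀ x e η, 0 < η → ∃ f, ‖x + S f‖ + ‖e - Q f‖ ≤ ‖j0 x + A0 e‖ + η := by
    intro x e η hη
    rw [hjA]
    obtain ⟨b, hb, hb2⟩ := hmkc (mk (U.symm (x, e))) (η / 2) (half_pos hη)
    have h1 := hker _ _ hb.symm
    have h2 : b - U.symm (x, e) ∈ closure (Set.range G) := by rw [← hRc]; exact h1
    obtain ⟨_, ⟨f, rfl⟩, hf⟩ := Metric.mem_closure_iff.1 h2 _ (half_pos hη)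
    refine ⟨f, ?_⟩
    rw [dist_eq_norm] at hf
    have h3 : ‖x + S f‖ + ‖e - Q f‖ = ‖U.symm (x, e) + G f‖ := by
      rw [hG, ← map_add, Prod.mk_add_mk, hU, sub_eq_add_neg]
    rw [h3]
    have h4 : U.symm (x, e) + G f = b - (b - U.symm (x, e) - G f) := by abel
    rw [h4]
    linarith [norm_sub_le b (b - U.symm (x, e) - G f)]
  have hjn : ∀ x, ‖j0 x‖ = ‖x‖ := by
    intro x
    apply le_antisymm
    · rw [hj0]; refine (hmk1 _).trans ?_; rw [hU]; simp
    · refine le_of_forall_pos_le_add fun η hη => ?_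
      obtain ⟨f, hf⟩ := happ x 0 η hη
      rw [map_zero, add_zero, zero_sub, norm_neg] at hf
      have h1 := norm_sub_le (x + S f) (S f)
      rw [add_sub_cancel_right] at h1
      linarith [hSQ f]
  have hAn : ∀ e, ‖A0 e‖ ≤ 1 * ‖e‖ := by
    intro e; rw [hA0]; refine (hmk1 _).trans ?_; rw [hU]; simp
  refine ⟨Y, _i1, _i2, hcomp, ⟨j0, hjn⟩, A0.mkContinuous 1 hAn, ?_, ?_, ?_, ?_, ?_⟩
  · intro e; have := hAn e; rwa [one_mul] at this
  · intro y
    obtain ⟨b, hb, -⟩ := hmkc y 1 one_pos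
    refine ⟨(U b).1, (U b).2, ?_⟩
    change j0 _ + A0 _ = y
    rw [hjA, Prod.mk.eta, U.symm_apply_apply, hb]
  · intro f
    change j0 _ = A0 _
    have h1 := hker2 _ (hGR f)
    rw [hG, ← hjA, map_neg] at h1
    exact sub_eq_zero.1 (by rw [sub_eq_add_neg]; exact h1)
  · exact happ
  · intro V _ _ α β C hC hα hβ hαβ
    let γ0 : WithLp 1 (X × L) →L[ℝ] V := (α.coprod β) ∘L U.toContinuousLinearMap
    have hγ0 : ∀ b, γ0 b = α (U b).1 + β (U b).2 := fun b => rfl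
    have hRγ : R ≤ LinearMap.ker γ0.toLinearMap := by
      intro r hr
      have hr' : r ∈ closure (Set.range G) := by rw [← hRc]; exact hr
      have hcl : IsClosed {r | γ0 r = 0} := isClosed_eq γ0.continuous continuous_const
      refine closure_minimal ?_ hcl hr'
      rintro _ ⟨f, rfl⟩
      rw [Set.mem_ofPred_eq, hγ0, hG]
      simp [hαβ]
    let γ1 : Y →ₗ[ℝ] V := R.liftQ γ0.toLinearMap hRγ
    have hγ1 : ∀ b, γ1 (mk b) = γ0 b := fun b => rfl
    have hγb : ∀ y, ‖γ1 y‖ ≤ C * ‖y‖ := by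
      intro y
      have h1 : ∀ η, 0 < η → ‖γ1 y‖ ≤ C * (‖y‖ + η) := by
        intro η hη
        obtain ⟨b, rfl, hb⟩ := hmkc y η hη
        rw [hγ1, hγ0]
        calc ‖α (U b).1 + β (U b).2‖ ≤ ‖α (U b).1‖ + ‖β (U b).2‖ := norm_add_le _ _
          _ ≤ C * ‖(U b).1‖ + C * ‖(U b).2‖ := add_le_add (hα _) (hβ _)
          _ = C * ‖b‖ := by rw [hU2 b]; ring
          _ ≤ _ := by gcongr
      have h2 : Tendsto (fun η : ℝ => C * (‖y‖ + η)) (𝓝[>] 0) (𝓝 (C * (‖y‖ + 0))) := by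
        refine Tendsto.mono_left ?_ nhdsWithin_le_nhds
        exact (Continuous.tendsto (by fun_prop) 0)
      rw [add_zero] at h2
      exact ge_of_tendsto h2 (eventually_nhdsWithin_of_forall fun η hη => h1 η hη)
    refine ⟨γ1.mkContinuous C hγb, ?_, ?_, hγb⟩
    · intro x
      change γ1 (j0 x) = _
      rw [hj0, hγ1, hγ0]; simp
    · intro e
      change γ1 (A0 e) = _
      rw [hA0, hγ1, hγ0]; simp

end pushout

section fdd

/-- A uniformly bounded sequence of commuting finite rank projections converging to the identity. -/
def HasFDD (Y : Type) [NormedAddCommGroup Y] [NormedSpace ℝ Y] : Prop :=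
  ∃ (T : ℕ → Y →L[ℝ] Y) (C : ℝ), (∀ n y, ‖T n y‖ ≤ C * ‖y‖) ∧
    (∀ n m, n ≤ m → ∀ y, T n (T m y) = T n y ∧ T m (T n y) = T n y) ∧
    (∀ n, FiniteDimensional ℝ (LinearMap.range (T n).toLinearMap)) ∧
    ∀ y, Tendsto (fun n => T n y) atTop (𝓝 y)

/-- Pointwise convergence to the identity holds on a closed subspace. -/
theorem closed_conv {Y : Type} [NormedAddCommGroup Y] [NormedSpace ℝ Y] (T : ℕ → Y →L[ℝ] Y) {C : ℝ}
    (hC : ∀ n y, ‖T n y‖ ≤ C * ‖y‖) : IsClosed {y | Tendsto (fun n => T n y) atTop (𝓝 y)} := by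
  have hC0 : ∀ n y, ‖T n y‖ ≤ (|C| + 1) * ‖y‖ := fun n y => (hC n y).trans
    (mul_le_mul_of_nonneg_right (by linarith [le_abs_self C]) (norm_nonneg _))
  have hpos : 0 < |C| + 2 := by positivity
  refine isClosed_of_closure_subset fun y hy => ?_
  rw [Set.mem_ofPred_eq, Metric.tendsto_atTop]
  intro ε hε
  obtain ⟨w, hw, hyw⟩ := Metric.mem_closure_iff.1 hy (ε / (2 * (|C| + 2))) (by positivity)
  rw [Set.mem_ofPred_eq, Metric.tendsto_atTop] at hw
  obtain ⟨N, hN⟩ := hw (ε / 2) (by positivity)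
  refine ⟨N, fun n hn => ?_⟩
  have h1 := hN n hn
  rw [dist_eq_norm] at h1 hyw ⊢
  have h2 : T n y - y = T n (y - w) + (T n w - w) - (y - w) := by rw [map_sub]; abel
  have h3 : ‖T n y - y‖ ≤ ‖T n (y - w)‖ + ‖T n w - w‖ + ‖y - w‖ := by
    rw [h2]; exact (norm_sub_le _ _).trans (by gcongr; exact norm_add_le _ _)
  have h4 := hC0 n (y - w)
  have h5 : (|C| + 2) * ‖y - w‖ < ε / 2 := by
    calc (|C| + 2) * ‖y - w‖ < (|C| + 2) * (ε / (2 * (|C| + 2))) := by gcongr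
      _ = ε / 2 := by field_simp
  nlinarith

theorem l1_mem_of_closed {E : ℕ → Type} [∀ n, NormedAddCommGroup (E n)] [∀ n, NormedSpace ℝ (E n)]
    (W : Submodule ℝ (lp E 1)) (hW : IsClosed (W : Set (lp E 1))) (h : ∀ m a, l1s E m a ∈ W)
    (f : lp E 1) : f ∈ W :=
  hW.mem_of_tendsto (l1_hasSum_single f) (Eventually.of_forall fun _ => W.sum_mem fun i _ => h i _)

set_option maxHeartbeats 1000000 in
theorem fdd_step {X : Type} [NormedAddCommGroup X] [NormedSpace ℝ X] [CompleteSpace X]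
    {E : ℕ → Type} [∀ n, NormedAddCommGroup (E n)] [∀ n, NormedSpace ℝ (E n)]
    [∀ n, FiniteDimensional ℝ (E n)]
    (F : ℕ → Submodule ℝ X) (hF : Monotone F) (hFd : Dense {x | ∃ n, x ∈ F n})
    (J : ∀ n, X →L[ℝ] E n) (hJ : ∀ n x, ‖J n x‖ ≤ 2 * ‖x‖) (hJF : ∀ n, ∀ x ∈ F n, ‖x‖ ≤ ‖J n x‖)
    (τ : ∀ m n, E m →L[ℝ] E n) (hτ : ∀ m n e, ‖τ m n e‖ ≤ ‖e‖)
    (hτJ : ∀ m n, n ≤ m → ∀ x, τ m n (J m x) = J n x)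
    (hττ : ∀ m p n, n ≤ p → p ≤ m → ∀ e, τ p n (τ m p e) = τ m n e)
    (hτ1 : ∀ n e, τ n n e = e) :
    ∃ (Y : Type) (_ : NormedAddCommGroup Y) (_ : NormedSpace ℝ Y) (_ : CompleteSpace Y),
      ExtPair X Y ∧ HasFDD Y := by
  classical
  have hcE : ∀ n, CompleteSpace (E n) := fun n => FiniteDimensional.complete ℝ (E n)
  have hA1 : ∀ m (e : F m), ‖(F m).subtypeL e‖ ≤ 1 * ‖e‖ := fun m e => by simp
  have hA2 : ∀ m (e : F m), ‖((l1s E m) ∘L (J m) ∘L (F m).subtypeL) e‖ ≤ 2 * ‖e‖ := fun m e => by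
    have := hJ m e
    simpa [l1s_norm] using this
  let S := l1lift (fun m => (F m).subtypeL) 1 hA1
  let Q := l1lift (fun m => (l1s E m) ∘L (J m) ∘L (F m).subtypeL) 2 hA2
  have hQ : ∀ f m, Q f m = J m (f m) := by
    intro f m
    have h : (l1e E m) ∘L Q = (J m) ∘L (F m).subtypeL ∘L l1e (fun m => F m) m := by
      apply l1_clm_ext
      intro p a
      have : Q (l1s _ p a) = l1s E p (J p a) := l1lift_single hA2 p a
      simp only [ContinuousLinearMap.comp_apply, this, l1e_apply]
      by_cases hp : m = p
      · subst hp; rw [l1s_self, l1s_self]; rfl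
      · rw [l1s_ne _ hp, l1s_ne _ hp]; simp
    exact DFunLike.congr_fun h f
  have hSs : ∀ m (x : F m), S (l1s (fun m => F m) m x) = x := fun m x => l1lift_single hA1 m x
  have hQs : ∀ m (x : F m), Q (l1s (fun m => F m) m x) = l1s E m (J m x) :=
    fun m x => l1lift_single hA2 m x
  have hSQ : ∀ f, ‖S f‖ ≤ ‖Q f‖ := by
    intro f
    have h1 : ‖S f‖ ≤ ‖f‖ := by simpa using l1lift_bound hA1 f
    refine h1.trans (hasSum_le (fun m => ?_) (l1_hasSum f) (l1_hasSum (Q f)))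
    rw [hQ]
    exact hJF m _ (f m).2
  obtain ⟨Y, i1, i2, i3, j, A, hA, hsurj, hcompat, happ, huni⟩ := exists_pushout S Q hSQ
  -- the fixed identity
  have hjA : ∀ m, ∀ x ∈ F m, j x = A (l1s E m (J m x)) := by
    intro m x hx
    have := hcompat (l1s (fun m => F m) m ⟨x, hx⟩)
    rwa [hSs, hQs] at this
  -- induction principle
  have hind : ∀ W : Submodule ℝ Y, IsClosed (W : Set Y) → (∀ n, ∀ x ∈ F n, j x ∈ W) →
      (∀ m e, A (l1s E m e) ∈ W) → ∀ y, y ∈ W := by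
    intro W hW h1 h2 y
    obtain ⟨x, e, rfl⟩ := hsurj y
    refine W.add_mem ?_ ?_
    · have hcl : IsClosed {x | j x ∈ W} := hW.preimage j.continuous
      have : closure {x | ∃ n, x ∈ F n} ⊆ {x | j x ∈ W} :=
        closure_minimal (fun x ⟨n, hx⟩ => h1 n x hx) hcl
      exact this (hFd x)
    · have := l1_mem_of_closed (W.comap A.toLinearMap) (hW.preimage A.continuous) h2 e
      exact this
  -- the extension pair
  have hext : ExtPair X Y := by
    refine extPair_of_lp j A hsurj ?_
    intro n f g hf hg x η hη
    obtain ⟨u, hu⟩ := happ (-x) (f + g) η hη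
    have hsum := (l1_hasSum u).summable
    let u1 : lp (fun m => F m) 1 := l1mk (fun m => if m < n then u m else 0)
      (hsum.of_nonneg_of_le (fun _ => norm_nonneg _) (fun m => by split_ifs <;> simp))
    let u2 : lp (fun m => F m) 1 := l1mk (fun m => if m < n then 0 else u m)
      (hsum.of_nonneg_of_le (fun _ => norm_nonneg _) (fun m => by split_ifs <;> simp))
    have h1 : ∀ k, u1 k = if k < n then u k else 0 := fun k => rfl
    have h2 : ∀ k, u2 k = if k < n then 0 else u k := fun k => rfl
    have h12 : u = u1 + u2 := l1_ext fun m => by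
      change u m = u1 m + u2 m
      rw [h1, h2]; split_ifs <;> simp
    refine ⟨S u1, S u2, ?_⟩
    rw [hcompat, hcompat, ← map_sub, ← map_sub]
    have h3 : ‖f - Q u1 + (g - Q u2)‖ = ‖f - Q u1‖ + ‖g - Q u2‖ := by
      refine l1_norm_split n _ _ (fun k hk => ?_) (fun k hk => ?_)
      · change f k - Q u1 k = 0
        rw [hf k hk, hQ, h1, if_neg (by omega)]; simp
      · change g k - Q u2 k = 0
        rw [hg k hk, hQ, h2, if_pos hk]; simp
    have h4 : f - Q u1 + (g - Q u2) = f + g - Q u := by rw [h12, map_add]; abel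
    have h5 : j (-x) + A (f + g) = A (f + g) - j x := by rw [map_neg]; abel
    rw [h5] at hu
    rw [h4] at h3
    linarith [hA (f - Q u1), hA (g - Q u2), norm_nonneg (-x + S u)]
  refine ⟨Y, i1, i2, i3, hext, ?_⟩
  -- the projections
  let B : ∀ n m, E m →L[ℝ] Y := fun n m =>
    if m ≤ n then A ∘L l1s E m else A ∘L l1s E n ∘L τ m n
  have hB : ∀ n m e, ‖B n m e‖ ≤ 2 * ‖e‖ := by
    intro n m e
    have h0 : ‖B n m e‖ ≤ ‖e‖ := by
      by_cases h : m ≤ n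
      · simp only [B, if_pos h]
        exact (hA _).trans (l1s_norm m e).le
      · simp only [B, if_neg h]
        refine (hA _).trans ?_
        change ‖l1s E n (τ m n e)‖ ≤ _
        rw [l1s_norm]
        exact hτ m n e
    linarith [norm_nonneg e]
  have hT : ∀ n, ∃ γ : Y →L[ℝ] Y, (∀ x, γ (j x) = A (l1s E n (J n x))) ∧
      (∀ m e, γ (A (l1s E m e)) = B n m e) ∧ ∀ y, ‖γ y‖ ≤ 2 * ‖y‖ := by
    intro n
    obtain ⟨γ, h1, h2, h3⟩ := huni Y (A ∘L l1s E n ∘L J n) (l1lift (B n) 2 (hB n)) 2 (by norm_num)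
      (fun x => by
        refine (hA _).trans ?_
        change ‖l1s E n (J n x)‖ ≤ _
        rw [l1s_norm]
        exact hJ n x)
      (l1lift_bound (hB n))
      (fun f => by
        have : (A ∘L l1s E n ∘L J n) ∘L S = (l1lift (B n) 2 (hB n)) ∘L Q := by
          apply l1_clm_ext
          intro m x
          change A (l1s E n (J n (S (l1s _ m x)))) = l1lift (B n) 2 (hB n) (Q (l1s _ m x))
          rw [hSs, hQs, l1lift_single]
          by_cases h : m ≤ n
          · simp only [B, if_pos h]
            change A (l1s E n (J n x)) = A (l1s E m (J m x))
            rw [← hjA m x x.2, ← hjA n x (hF h x.2)]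
          · simp only [B, if_neg h]
            change A (l1s E n (J n x)) = A (l1s E n (τ m n (J m x)))
            rw [hτJ m n (by omega)]
        exact DFunLike.congr_fun this f)
    refine ⟨γ, fun x => h1 x, fun m e => ?_, h3⟩
    rw [h2, l1lift_single]
  choose T hTj hTA hTb using hT
  have hT1 : ∀ n m e, m ≤ n → T n (A (l1s E m e)) = A (l1s E m e) := fun n m e h => by
    rw [hTA]; simp only [B, if_pos h]; rfl
  have hT2 : ∀ n m e, n ≤ m → T n (A (l1s E m e)) = A (l1s E n (τ m n e)) := fun n m e h => by
    rcases h.eq_or_lt with rfl | h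
    · rw [hT1 _ _ _ le_rfl, hτ1]
    · rw [hTA]; simp only [B, if_neg (not_le.2 h)]; rfl
  refine ⟨T, 2, hTb, ?_, ?_, ?_⟩
  · intro n m hnm y
    constructor
    · have hcl : IsClosed ((LinearMap.ker ((T n ∘L T m - T n : Y →L[ℝ] Y)).toLinearMap : Submodule ℝ Y) : Set Y) :=
        ContinuousLinearMap.isClosed_ker _
      have := hind _ hcl (fun p x hx => ?_) (fun p e => ?_) y
      · exact sub_eq_zero.1 this
      · change T n (T m (j x)) - T n (j x) = 0
        rw [hTj, hTj, hT2 _ _ _ hnm, hτJ _ _ hnm, sub_self]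
      · change T n (T m (A (l1s E p e))) - T n (A (l1s E p e)) = 0
        rcases le_total p m with h | h
        · rw [hT1 m _ _ h, sub_self]
        · rw [hT2 m _ _ h, hT2 n _ _ hnm, hT2 n _ _ (hnm.trans h), hττ _ _ _ hnm h, sub_self]
    · have hcl : IsClosed ((LinearMap.ker ((T m ∘L T n - T n : Y →L[ℝ] Y)).toLinearMap : Submodule ℝ Y) : Set Y) :=
        ContinuousLinearMap.isClosed_ker _
      have := hind _ hcl (fun p x hx => ?_) (fun p e => ?_) y
      · exact sub_eq_zero.1 this
      · change T m (T n (j x)) - T n (j x) = 0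
        rw [hTj, hT1 _ _ _ hnm, sub_self]
      · change T m (T n (A (l1s E p e))) - T n (A (l1s E p e)) = 0
        rcases le_total p n with h | h
        · rw [hT1 n _ _ h, hT1 m _ _ (h.trans hnm), sub_self]
        · rw [hT2 n _ _ h, hT1 _ _ _ hnm, sub_self]
  · intro n
    let R : Submodule ℝ Y := (Finset.range (n+1)).sup fun p => LinearMap.range (A ∘L l1s E p).toLinearMap
    have hR : FiniteDimensional ℝ R := Submodule.finiteDimensional_finset_sup _ _
    have hmem : ∀ p ≤ n, ∀ e, A (l1s E p e) ∈ R := fun p hp e =>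
      (Finset.le_sup (f := fun p => LinearMap.range (A ∘L l1s E p).toLinearMap)
        (Finset.mem_range.2 (Nat.lt_succ_of_le hp))) ⟨e, rfl⟩
    have hle : LinearMap.range (T n).toLinearMap ≤ R := by
      rintro _ ⟨y, rfl⟩
      have hcl : IsClosed ((R.comap (T n).toLinearMap : Submodule ℝ Y) : Set Y) :=
        (Submodule.closed_of_finiteDimensional R).preimage (T n).continuous
      refine hind _ hcl (fun p x hx => ?_) (fun p e => ?_) y
      · change T n (j x) ∈ R
        rw [hTj]; exact hmem n le_rfl _
      · change T n (A (l1s E p e)) ∈ R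
        rcases le_total p n with h | h
        · rw [hT1 n _ _ h]; exact hmem p h _
        · rw [hT2 n _ _ h]; exact hmem n le_rfl _
    exact Submodule.finiteDimensional_of_le hle
  · let W : Submodule ℝ Y :=
      { carrier := {y | Tendsto (fun n => T n y) atTop (𝓝 y)}
        zero_mem' := by simp
        add_mem' := fun {a b} ha hb => by
          have := Tendsto.add ha hb
          simpa using this
        smul_mem' := fun c a ha => by
          have := Tendsto.const_smul ha c
          simpa using this }
    refine hind W (closed_conv T hTb) (fun p x hx => ?_) (fun p e => ?_)
    · refine tendsto_const_nhds.congr' ?_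
      filter_upwards [eventually_ge_atTop p] with n hn
      rw [hTj, ← hjA n x (hF hn hx)]
    · refine tendsto_const_nhds.congr' ?_
      filter_upwards [eventually_ge_atTop p] with n hn
      rw [hT1 _ _ _ hn]

end fdd

section fddexists

variable {X : Type} [NormedAddCommGroup X] [NormedSpace ℝ X]

theorem norming_fd (F : Submodule ℝ X) [FiniteDimensional ℝ F] (d : ℕ → X) (hd : DenseRange d)
    (g : ℕ → X →L[ℝ] ℝ) (hg : ∀ i x, |g i x| ≤ ‖x‖) (hgd : ∀ i, g i (d i) = ‖d i‖) :
    ∃ k : ℕ, ∀ x ∈ F, x ≠ 0 → ∃ i < k, ‖x‖ ≤ 2 * |g i x| := by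
  have hp : ProperSpace F := FiniteDimensional.proper ℝ F
  have hcomp : IsCompact (Metric.sphere (0 : F) 1) := isCompact_sphere _ _
  obtain ⟨t, ht⟩ := hcomp.elim_finite_subcover (fun i : ℕ => {x : F | 1 < 2 * |g i (x : X)|})
    (fun i => isOpen_lt continuous_const
      (continuous_const.mul (((g i).continuous.comp continuous_subtype_val).abs)))
    (fun x hx => by
      have hx1 : ‖(x : X)‖ = 1 := by simpa using hx
      obtain ⟨_, hy, ⟨i, rfl⟩⟩ := Metric.dense_iff.1 hd (x : X) (1/8) (by norm_num)
      rw [Metric.mem_ball, dist_eq_norm] at hy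
      refine Set.mem_iUnion.2 ⟨i, ?_⟩
      rw [Set.mem_ofPred_eq]
      have h1 := hg i (d i - x)
      rw [map_sub, hgd] at h1
      have h2 := norm_sub_norm_le (x : X) (d i)
      rw [norm_sub_rev, hx1] at h2
      have h3 := (abs_le.1 h1).2
      have h4 := le_abs_self (g i x)
      linarith)
  refine ⟨t.sup id + 1, fun x hx hx0 => ?_⟩
  have hn : ‖x‖ ≠ 0 := norm_ne_zero_iff.2 hx0
  let u : F := ‖x‖⁻¹ • ⟨x, hx⟩
  have hu : u ∈ Metric.sphere (0 : F) 1 := by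
    rw [mem_sphere_zero_iff_norm, norm_smul, norm_inv, norm_norm]
    exact inv_mul_cancel₀ hn
  obtain ⟨i, hi⟩ := Set.mem_iUnion.1 (ht hu)
  obtain ⟨hit, hi⟩ := Set.mem_iUnion.1 hi
  rw [Set.mem_ofPred_eq] at hi
  refine ⟨i, Nat.lt_succ_of_le (Finset.le_sup (f := id) hit), ?_⟩
  have h5 : g i (u : X) = ‖x‖⁻¹ * g i x := by
    change g i (‖x‖⁻¹ • x) = _
    rw [map_smul, smul_eq_mul]
  rw [h5, abs_mul, abs_inv, abs_norm] at hi
  have h6 : 0 < ‖x‖ := norm_pos_iff.2 hx0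
  have h7 := mul_lt_mul_of_pos_left hi h6
  have h8 : ‖x‖ * (2 * (‖x‖⁻¹ * |g i x|)) = 2 * |g i x| := by field_simp
  linarith

theorem exists_fdd [CompleteSpace X] [TopologicalSpace.SeparableSpace X] :
    ∃ (Y : Type) (_ : NormedAddCommGroup Y) (_ : NormedSpace ℝ Y) (_ : CompleteSpace Y),
      ExtPair X Y ∧ HasFDD Y := by
  classical
  let d := TopologicalSpace.denseSeq X
  have hd : DenseRange d := TopologicalSpace.denseRange_denseSeq X
  have hex : ∀ i, ∃ g : X →L[ℝ] ℝ, ‖g‖ ≤ 1 ∧ g (d i) = ‖d i‖ := fun i => by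
    obtain ⟨g, h1, h2⟩ := exists_dual_vector'' ℝ (d i)
    exact ⟨g, h1, by simpa using h2⟩
  choose g hg1 hgd using hex
  have hg : ∀ i x, |g i x| ≤ ‖x‖ := fun i x => by
    have := (g i).le_of_opNorm_le (hg1 i) x
    simpa using this
  let F : ℕ → Submodule ℝ X := fun n => Submodule.span ℝ (d '' Set.Iio n)
  have hFfd : ∀ n, FiniteDimensional ℝ (F n) := fun n =>
    FiniteDimensional.span_of_finite ℝ ((Set.finite_Iio n).image d)
  have hF : Monotone F := fun a b h => Submodule.span_mono (Set.image_mono (Set.Iio_subset_Iio h))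
  have hFd : Dense {x | ∃ n, x ∈ F n} := hd.mono (by
    rintro _ ⟨i, rfl⟩
    exact ⟨i + 1, Submodule.subset_span ⟨i, Nat.lt_succ_self i, rfl⟩⟩)
  choose k0 hk0 using fun n => norming_fd (F n) d hd g hg hgd
  let k : ℕ → ℕ := fun n => ∑ i ∈ Finset.range (n+1), k0 i
  have hkm : Monotone k := fun a b h =>
    Finset.sum_le_sum_of_subset (Finset.range_mono (Nat.succ_le_succ h))
  have hk : ∀ n, k0 n ≤ k n := fun n =>
    Finset.single_le_sum (f := k0) (fun _ _ => Nat.zero_le _) (Finset.self_mem_range_succ n)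
  let J : ∀ n, X →L[ℝ] (Fin (k n) → ℝ) := fun n => ContinuousLinearMap.pi fun i => (2:ℝ) • g i
  have hJv : ∀ n x i, J n x i = 2 * g i x := fun n x i => rfl
  let τ0 : ∀ m n, (Fin (k m) → ℝ) →ₗ[ℝ] (Fin (k n) → ℝ) := fun m n =>
    { toFun := fun e i => if h : (i : ℕ) < k m then e ⟨i, h⟩ else 0
      map_add' := fun e f => by ext i; by_cases h : (i : ℕ) < k m <;> simp [h]
      map_smul' := fun c f => by ext i; by_cases h : (i : ℕ) < k m <;> simp [h] }
  let τ : ∀ m n, (Fin (k m) → ℝ) →L[ℝ] (Fin (k n) → ℝ) := fun m n =>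
    LinearMap.toContinuousLinearMap (τ0 m n)
  have hτv : ∀ m n e i, τ m n e i = if h : (i : ℕ) < k m then e ⟨i, h⟩ else 0 := fun m n e i => rfl
  refine fdd_step (E := fun n => Fin (k n) → ℝ) F hF hFd J ?_ ?_ τ ?_ ?_ ?_ ?_
  · intro n x
    refine (pi_norm_le_iff_of_nonneg (by positivity)).2 fun i => ?_
    rw [hJv, Real.norm_eq_abs, abs_mul, abs_two]
    linarith [hg i x]
  · intro n x hx
    by_cases hx0 : x = 0
    · subst hx0; simp
    · obtain ⟨i, hi, h⟩ := hk0 n x hx hx0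
      have := norm_le_pi_norm (J n x) ⟨i, hi.trans_le (hk n)⟩
      rw [hJv, Real.norm_eq_abs, abs_mul, abs_two] at this
      exact h.trans this
  · intro m n e
    refine (pi_norm_le_iff_of_nonneg (norm_nonneg _)).2 fun i => ?_
    rw [hτv]
    split_ifs with h
    · exact norm_le_pi_norm e _
    · simp
  · intro m n hnm x
    ext i
    rw [hτv, dif_pos (i.2.trans_le (hkm hnm)), hJv, hJv]
  · intro m p n hnp hpm e
    ext i
    have h1 := i.2.trans_le (hkm hnp)
    rw [hτv, dif_pos h1, hτv, hτv]
  · intro n e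
    ext i
    rw [hτv, dif_pos i.2]

end fddexists

section fdlemma

variable {M : Type} [NormedAddCommGroup M] [NormedSpace ℝ M]

/-- Extension of a finite coefficient vector by zero. -/
def ext0 {L : ℕ} (w : Fin L → ℝ) (j : ℕ) : ℝ := if h : j < L then w ⟨j, h⟩ else 0

/-- Truncation of a coefficient vector. -/
def trc {L : ℕ} (i : ℕ) (w : Fin L → ℝ) : Fin L → ℝ := fun k => if (k : ℕ) < i then w k else 0

theorem ext0_trc {L : ℕ} (i : ℕ) (w : Fin L → ℝ) (j : ℕ) :
    ext0 (trc i w) j = if j < i then ext0 w j else 0 := by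
  unfold ext0 trc
  by_cases h : j < L <;> simp [h]

/-- Partial sums as linear maps. -/
def psum (m : ℕ → M) (L n : ℕ) : (Fin L → ℝ) →ₗ[ℝ] M where
  toFun w := ∑ j ∈ Finset.range n, ext0 w j • m j
  map_add' w v := by
    rw [← Finset.sum_add_distrib]
    refine Finset.sum_congr rfl fun j _ => ?_
    rw [← add_smul]; congr 1
    unfold ext0; by_cases h : j < L <;> simp [h]
  map_smul' c w := by
    rw [RingHom.id_apply, Finset.smul_sum]
    refine Finset.sum_congr rfl fun j _ => ?_
    rw [smul_smul]; congr 1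
    unfold ext0; by_cases h : j < L <;> simp [h]

theorem psum_apply (m : ℕ → M) (L n : ℕ) (w : Fin L → ℝ) :
    psum m L n w = ∑ j ∈ Finset.range n, ext0 w j • m j := rfl

theorem psum_trc (m : ℕ → M) (L n i : ℕ) (w : Fin L → ℝ) :
    psum m L n (trc i w) = psum m L (min n i) w := by
  rw [psum_apply, psum_apply]
  have : Finset.range (min n i) = (Finset.range n).filter (· < i) := by ext; simp
  rw [this, Finset.sum_filter]
  refine Finset.sum_congr rfl fun j _ => ?_
  rw [ext0_trc]; split_ifs <;> simp

theorem periodic_bound {d : ℕ} (hd : 0 < d) (p : ℕ → M) (x : M) {K : ℝ}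
    (hp : ∀ n, p (d + n) = x + p n) (hK : ∀ n < d, ‖p n‖ ≤ K * ‖x‖) :
    ∀ R n, n ≤ d * R → ‖p n‖ ≤ (R + K) * ‖x‖ := by
  intro R
  induction R with
  | zero => intro n hn; have : n = 0 := by simpa using hn
            subst this; simpa using hK 0 hd
  | succ R ih =>
    intro n hn
    rcases Nat.lt_or_ge n d with h | h
    · refine (hK n h).trans ?_
      gcongr
      push_cast
      linarith [(Nat.cast_nonneg R : (0:ℝ) ≤ R)]
    · obtain ⟨q, rfl⟩ := Nat.exists_eq_add_of_le h
      rw [hp]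
      have := ih q (by rw [Nat.mul_succ] at hn; omega)
      have h2 := norm_add_le x (p q)
      push_cast
      linarith

theorem fd_lemma_aux {d R : ℕ} (hd : 0 < d) (hR : 0 < R) (m : ℕ → M) (c : ℕ → M →ₗ[ℝ] ℝ) (hm : ∀ j, m j ≠ 0)
    (hmp : ∀ j, m (d + j) = m j) (hcp : ∀ j, c (d + j) = c j)
    (hc : ∀ x, ∑ j ∈ Finset.range d, c j x • m j = x) {K : ℝ}
    (hK : ∀ x, ∀ n < d, ‖∑ j ∈ Finset.range n, c j x • m j‖ ≤ K * ‖x‖) (hRK : K ≤ R)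
    [FiniteDimensional ℝ M] :
    ∃ (N : Type) (_ : NormedAddCommGroup N) (_ : NormedSpace ℝ N) (_ : FiniteDimensional ℝ N)
      (L : ℕ) (θ : (Fin L → ℝ) ≃ₗ[ℝ] M × N), 0 < L ∧
      ∀ i w, ‖θ (trc i w)‖ ≤ 9 * ‖θ w‖ := by
  have hRr : (0:ℝ) < R := by exact_mod_cast hR
  obtain ⟨L, hL⟩ : ∃ L, L = d * R := ⟨_, rfl⟩
  have hL0 : 0 < L := hL ▸ Nat.mul_pos hd hR
  let Φ : (Fin L → ℝ) →ₗ[ℝ] (Fin L → M) := LinearMap.pi fun k => psum m L (k + 1)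
  have hΦ : ∀ w k, Φ w k = psum m L (k + 1) w := fun w k => rfl
  let σ := psum m L L
  let s : M →ₗ[ℝ] (Fin L → ℝ) := LinearMap.pi fun k => (R : ℝ)⁻¹ • c k
  have hsx : ∀ x n, n ≤ L → psum m L n (s x) = (R : ℝ)⁻¹ • ∑ j ∈ Finset.range n, c j x • m j := by
    intro x n hn
    rw [psum_apply, Finset.smul_sum]
    refine Finset.sum_congr rfl fun j hj => ?_
    have : j < L := (Finset.mem_range.1 hj).trans_le hn
    simp [ext0, this, s, mul_smul]
  have hper : ∀ x n, ∑ j ∈ Finset.range (d + n), c j x • m j = x + ∑ j ∈ Finset.range n, c j x • m j := by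
    intro x n
    rw [Finset.sum_range_add, hc]
    congr 1
    exact Finset.sum_congr rfl fun j _ => by rw [hmp, hcp]
  have hσs : ∀ x, σ (s x) = x := by
    intro x
    have hmul : ∀ r : ℕ, ∑ j ∈ Finset.range (d * r), c j x • m j = (r : ℝ) • x := by
      intro r
      induction r with
      | zero => simp
      | succ r ih =>
        rw [Nat.mul_succ, add_comm, hper, ih]; push_cast; rw [add_smul, one_smul, add_comm]
    change psum m L L (s x) = x
    rw [hsx x L le_rfl, hL, hmul, smul_smul, inv_mul_cancel₀ hRr.ne', one_smul]
  have hPΦ : ∀ w n, n ≤ L → ‖psum m L n w‖ ≤ ‖Φ w‖ := by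
    intro w n hn
    rcases n with _ | n
    · simp [psum_apply]
    · exact norm_le_pi_norm (Φ w) ⟨n, hn⟩
  have hΦs : ∀ x, ‖Φ (s x)‖ ≤ 2 * ‖x‖ := by
    intro x
    refine (pi_norm_le_iff_of_nonneg (by positivity)).2 fun k => ?_
    have hk : (k : ℕ) + 1 ≤ L := k.2
    rw [hΦ, hsx x _ hk, norm_smul, norm_inv, Real.norm_natCast]
    have h1 := periodic_bound hd (fun n => ∑ j ∈ Finset.range n, c j x • m j) x (hper x) (hK x) R (k+1)
      (hL ▸ hk)
    have h2 : (R + K) * ‖x‖ ≤ (2 * R) * ‖x‖ := by gcongr; linarith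
    calc (R:ℝ)⁻¹ * _ ≤ (R:ℝ)⁻¹ * ((2 * R) * ‖x‖) := by gcongr; exact h1.trans h2
      _ = 2 * ‖x‖ := by field_simp
  have hΦt : ∀ i w, ‖Φ (trc i w)‖ ≤ ‖Φ w‖ := by
    intro i w
    refine (pi_norm_le_iff_of_nonneg (by positivity)).2 fun k => ?_
    rw [hΦ, psum_trc]
    exact hPΦ w _ ((min_le_left _ _).trans k.2)
  have hΦinj : ∀ w, Φ w = 0 → w = 0 := by
    intro w hw
    have h0 : ∀ n, n ≤ L → psum m L n w = 0 := fun n hn => by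
      have := hPΦ w n hn
      rw [hw, norm_zero] at this
      exact norm_le_zero_iff.1 this
    ext k
    have h1 := h0 (k + 1) k.2
    have h2 := h0 k k.2.le
    rw [psum_apply] at h1 h2
    rw [Finset.sum_range_succ, h2, zero_add] at h1
    have h3 := (smul_eq_zero.1 h1).resolve_right (hm _)
    simpa [ext0] using h3
  let N : Submodule ℝ (Fin L → M) := (LinearMap.ker σ).map Φ
  let ρ : (Fin L → ℝ) →ₗ[ℝ] (Fin L → ℝ) := LinearMap.id - s ∘ₗ σ
  have hρ : ∀ w, ρ w = w - s (σ w) := fun w => rfl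
  have hρN : ∀ w, Φ (ρ w) ∈ N := fun w => ⟨ρ w, by
    change σ (ρ w) = 0
    rw [hρ, map_sub, hσs, sub_self], rfl⟩
  let θ0 : (Fin L → ℝ) →ₗ[ℝ] M × N := σ.prod ((Φ ∘ₗ ρ).codRestrict N hρN)
  have hθ1 : ∀ w, (θ0 w).1 = σ w := fun w => rfl
  have hθ2 : ∀ w, ((θ0 w).2 : Fin L → M) = Φ (ρ w) := fun w => rfl
  have hbij : Function.Bijective θ0 := by
    constructor
    · rw [← LinearMap.ker_eq_bot, LinearMap.ker_eq_bot']
      intro w hw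
      have h1 : σ w = 0 := by rw [← hθ1, hw]; rfl
      have h2 : Φ (ρ w) = 0 := by rw [← hθ2, hw]; rfl
      have h3 := hΦinj _ h2
      rw [hρ, h1, map_zero, sub_zero] at h3
      exact h3
    · rintro ⟨x, ⟨_, u, hu, rfl⟩⟩
      have hu' : σ u = 0 := hu
      have hσ : σ (u + s x) = x := by rw [map_add, hu', hσs, zero_add]
      refine ⟨u + s x, Prod.ext ?_ (Subtype.ext ?_)⟩
      · exact hσ
      · change Φ (ρ (u + s x)) = Φ u
        rw [hρ, hσ, add_sub_cancel_right]
  have hn : ∀ w, ‖θ0 w‖ = max ‖σ w‖ ‖Φ (ρ w)‖ := fun w => rfl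
  have hup : ∀ w, ‖θ0 w‖ ≤ 3 * ‖Φ w‖ := by
    intro w
    have h1 : ‖σ w‖ ≤ ‖Φ w‖ := hPΦ w L le_rfl
    rw [hn, hρ, map_sub]
    refine max_le (by linarith [norm_nonneg (Φ w)]) ?_
    have := norm_sub_le (Φ w) (Φ (s (σ w)))
    linarith [hΦs (σ w)]
  have hlow : ∀ w, ‖Φ w‖ ≤ 3 * ‖θ0 w‖ := by
    intro w
    have h1 : Φ w = Φ (ρ w) + Φ (s (σ w)) := by rw [← map_add, hρ, sub_add_cancel]
    have h2 := norm_add_le (Φ (ρ w)) (Φ (s (σ w)))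
    rw [← h1] at h2
    have h3 : ‖σ w‖ ≤ ‖θ0 w‖ := le_max_left _ _
    have h4 : ‖Φ (ρ w)‖ ≤ ‖θ0 w‖ := le_max_right _ _
    linarith [hΦs (σ w)]
  refine ⟨N, inferInstance, inferInstance, inferInstance, L, LinearEquiv.ofBijective θ0 hbij, hL0, ?_⟩
  intro i w
  change ‖θ0 _‖ ≤ 9 * ‖θ0 w‖
  linarith [hup (trc i w), hlow w, hΦt i w]

theorem fd_lemma (M : Type) [NormedAddCommGroup M] [NormedSpace ℝ M] [FiniteDimensional ℝ M] :
    ∃ (N : Type) (_ : NormedAddCommGroup N) (_ : NormedSpace ℝ N) (_ : FiniteDimensional ℝ N)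
      (L : ℕ) (θ : (Fin L → ℝ) ≃ₗ[ℝ] M × N), 0 < L ∧
      ∀ i w, ‖θ (trc i w)‖ ≤ 9 * ‖θ w‖ := by
  rcases subsingleton_or_nontrivial M with hM | hM
  · refine ⟨Fin 1 → ℝ, inferInstance, inferInstance, inferInstance, 1,
      LinearEquiv.ofBijective (LinearMap.inr ℝ M (Fin 1 → ℝ)) ⟨LinearMap.inr_injective, ?_⟩,
      one_pos, ?_⟩
    · rintro ⟨x, y⟩
      exact ⟨y, Prod.ext (Subsingleton.elim _ _) rfl⟩
    · intro i w
      rcases i with _ | i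
      · have : trc 0 w = 0 := by ext k; simp [trc]
        rw [this, map_zero, norm_zero]; positivity
      · have : trc (i+1) w = w := by ext k; simp [trc]
        rw [this]; linarith [norm_nonneg ((LinearEquiv.ofBijective (LinearMap.inr ℝ M (Fin 1 → ℝ)) ⟨LinearMap.inr_injective, by
          rintro ⟨x, y⟩
          exact ⟨y, Prod.ext (Subsingleton.elim _ _) rfl⟩⟩ : (Fin 1 → ℝ) ≃ₗ[ℝ] _) w)]
  · let b := Module.finBasis ℝ M
    obtain ⟨d, hdd⟩ : ∃ d, d = Module.finrank ℝ M := ⟨_, rfl⟩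
    have hd : 0 < d := hdd ▸ Module.finrank_pos
    let b : Module.Basis (Fin d) ℝ M := hdd ▸ Module.finBasis ℝ M
    let q : ℕ → Fin d := fun j => ⟨j % d, Nat.mod_lt _ hd⟩
    have hq : ∀ j, q (d + j) = q j := fun j => by simp [q]
    have hcont : ∀ i, ∃ C, ∀ x, ‖b.coord i x‖ ≤ C * ‖x‖ := fun i =>
      ⟨_, (LinearMap.toContinuousLinearMap (b.coord i)).le_opNorm⟩
    choose C hC using hcont
    have hC0 : ∀ i, 0 ≤ C i := fun i => by
      have h1 := hC i (b i)
      have h2 : b.coord i (b i) = 1 := by simp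
      rw [h2, norm_one] at h1
      by_contra h
      nlinarith [norm_nonneg (b i)]
    obtain ⟨R, hR⟩ := exists_nat_ge (max 1 (∑ j ∈ Finset.range d, C (q j) * ‖b (q j)‖))
    refine fd_lemma_aux (d := d) (R := R) (K := ∑ j ∈ Finset.range d, C (q j) * ‖b (q j)‖) hd ?_
      (fun j => b (q j)) (fun j => b.coord (q j)) (fun j => b.ne_zero _) (fun j => by rw [hq])
      (fun j => by rw [hq]) ?_ ?_ ((le_max_right _ _).trans hR)
    · have := (le_max_left _ _).trans hR
      exact_mod_cast (lt_of_lt_of_le one_pos this)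
    · intro x
      rw [← Fin.sum_univ_eq_sum_range (fun j => b.coord (q j) x • b (q j)) d]
      conv_rhs => rw [← b.sum_repr x]
      refine Finset.sum_congr rfl fun i _ => ?_
      have : q i = i := Fin.ext (Nat.mod_eq_of_lt i.2)
      rw [this]; rfl
    · intro x n hn
      refine (norm_sum_le _ _).trans ?_
      rw [Finset.sum_mul]
      refine (Finset.sum_le_sum_of_subset_of_nonneg (Finset.range_mono hn.le)
        (fun _ _ _ => norm_nonneg _)).trans (Finset.sum_le_sum fun j _ => ?_)
      rw [norm_smul]
      calc _ ≤ (C (q j) * ‖x‖) * ‖b (q j)‖ := by gcongr; exact hC _ _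
        _ = _ := by ring

end fdlemma

section blocks

theorem schauder_of_blocks {Y : Type*} [NormedAddCommGroup Y] [NormedSpace ℝ Y]
    (w : ℕ → ℕ → Y) (ψ : ℕ → ℕ → Y →L[ℝ] ℝ) (L : ℕ → ℕ) (hL : ∀ n, 0 < L n)
    (hbi : ∀ n i m j, i < L n → j < L m → ψ n i (w m j) = if n = m ∧ i = j then 1 else 0)
    (hU : ∀ y, Tendsto (fun n => ∑ l ∈ Finset.range n, ∑ j ∈ Finset.range (L l), ψ l j y • w l j)
      atTop (𝓝 y))
    (hc : ∀ y, ∃ c : ℕ → ℝ, Tendsto c atTop (𝓝 0) ∧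
      ∀ n i, i ≤ L n → ‖∑ j ∈ Finset.range i, ψ n j y • w n j‖ ≤ c n) : HasSchauderBasis Y := by
  classical
  let s : ℕ → ℕ := fun n => ∑ l ∈ Finset.range n, L l
  have hs1 : ∀ n, s (n + 1) = s n + L n := fun n => Finset.sum_range_succ _ _
  have hs : StrictMono s := strictMono_nat_of_lt_succ fun n => by rw [hs1]; linarith [hL n]
  have hex : ∀ k, ∃ n, s n ≤ k ∧ k < s (n + 1) := by
    intro k
    have h0 : ∃ n, k < s (n + 1) := ⟨k, (Nat.lt_succ_self k).trans_le (hs.id_le (k+1))⟩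
    refine ⟨Nat.find h0, ?_, Nat.find_spec h0⟩
    rcases hn : Nat.find h0 with _ | n
    · simp [s]
    · exact not_lt.1 (Nat.find_min h0 (hn ▸ Nat.lt_succ_self n))
  choose b hb1 hb2 using hex
  have huniq : ∀ n j, j < L n → b (s n + j) = n := by
    intro n j hj
    have h1 := hb1 (s n + j)
    have h2 := hb2 (s n + j)
    have h3 : s n < s (b (s n + j) + 1) := by omega
    have h4 : s (b (s n + j)) < s (n + 1) := by rw [hs1]; omega
    have := hs.lt_iff_lt.1 h3
    have := hs.lt_iff_lt.1 h4
    omega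
  let r : ℕ → ℕ := fun k => k - s (b k)
  have hr : ∀ k, r k < L (b k) := fun k => by
    have h1 := hb1 k
    have h2 := hb2 k
    rw [hs1] at h2
    change k - s (b k) < _
    omega
  have hk : ∀ k, k = s (b k) + r k := fun k => by
    have := hb1 k
    change k = s (b k) + (k - s (b k))
    omega
  have hr2 : ∀ n j, j < L n → r (s n + j) = j := fun n j hj => by
    change s n + j - s (b (s n + j)) = j
    rw [huniq n j hj]; omega
  have hbt : Tendsto b atTop atTop := tendsto_atTop.2 fun N => by
    filter_upwards [eventually_ge_atTop (s N)] with k hk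
    by_contra h
    have h1 : s (b k + 1) ≤ s N := hs.monotone (by omega)
    have := hb2 k
    omega
  let v : ℕ → Y := fun k => w (b k) (r k)
  let φ : ℕ → Y →L[ℝ] ℝ := fun k => ψ (b k) (r k)
  have hφv : ∀ k l, φ k (v l) = if k = l then 1 else 0 := by
    intro k l
    change ψ _ _ (w _ _) = _
    rw [hbi _ _ _ _ (hr k) (hr l)]
    by_cases h : k = l
    · subst h; simp
    · rw [if_neg h, if_neg]
      rintro ⟨h1, h2⟩
      apply h
      rw [hk k, hk l, h1, h2]
  have hblock : ∀ y n i, i ≤ L n → ∑ t ∈ Finset.range (s n + i), φ t y • v t =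
      ∑ t ∈ Finset.range (s n), φ t y • v t + ∑ j ∈ Finset.range i, ψ n j y • w n j := by
    intro y n i hi
    rw [Finset.sum_range_add]
    congr 1
    refine Finset.sum_congr rfl fun j hj => ?_
    have hj' := (Finset.mem_range.1 hj).trans_le hi
    simp only [φ, v]
    rw [huniq n j hj', hr2 n j hj']
  have hfull : ∀ y n, ∑ t ∈ Finset.range (s n), φ t y • v t =
      ∑ l ∈ Finset.range n, ∑ j ∈ Finset.range (L l), ψ l j y • w l j := by
    intro y n
    induction n with
    | zero => simp [s]
    | succ n ih => rw [hs1, hblock y n _ le_rfl, ih, Finset.sum_range_succ]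
  have hconv : ∀ y, Tendsto (fun k => ∑ t ∈ Finset.range k, φ t y • v t) atTop (𝓝 y) := by
    intro y
    obtain ⟨c, hc0, hcb⟩ := hc y
    have h1 : ∀ k, ∑ t ∈ Finset.range k, φ t y • v t =
        ∑ l ∈ Finset.range (b k), ∑ j ∈ Finset.range (L l), ψ l j y • w l j +
          ∑ j ∈ Finset.range (r k), ψ (b k) j y • w (b k) j := by
      intro k
      conv_lhs => rw [hk k]
      rw [hblock y _ _ (hr k).le, hfull]
    have h2 : Tendsto (fun k => ∑ j ∈ Finset.range (r k), ψ (b k) j y • w (b k) j) atTop (𝓝 0) :=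
      squeeze_zero_norm (fun k => hcb _ _ (hr k).le) (hc0.comp hbt)
    have h3 := ((hU y).comp hbt).add h2
    rw [add_zero] at h3
    exact h3.congr fun k => (h1 k).symm
  refine ⟨v, fun y => ⟨fun k => φ k y, hconv y, fun a ha => ?_⟩⟩
  funext k
  have h1 : Tendsto (fun m => φ k (∑ n ∈ Finset.range m, a n • v n)) atTop (𝓝 (φ k y)) :=
    ((φ k).continuous.tendsto y).comp ha
  refine tendsto_nhds_unique (tendsto_const_nhds.congr' ?_) h1
  filter_upwards [eventually_gt_atTop k] with m hm
  rw [map_sum, Finset.sum_eq_single k]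
  · rw [map_smul, hφv, if_pos rfl, smul_eq_mul, mul_one]
  · intro n _ hn
    rw [map_smul, hφv, if_neg hn.symm, smul_zero]
  · intro h
    exact absurd (Finset.mem_range.2 hm) h

/-- Coordinate vectors with natural number index. -/
def cvec (L j : ℕ) : Fin L → ℝ := fun k => if (k : ℕ) = j then 1 else 0

theorem sum_cvec {L : ℕ} (u : Fin L → ℝ) (i : ℕ) :
    ∑ j ∈ Finset.range i, ext0 u j • cvec L j = trc i u := by
  ext k
  rw [Finset.sum_apply]
  simp only [Pi.smul_apply, cvec, smul_eq_mul, mul_ite, mul_one, mul_zero, trc]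
  rw [Finset.sum_ite_eq]
  simp [ext0]

theorem ext0_cvec {L i j : ℕ} (hi : i < L) : ext0 (cvec L j) i = if i = j then 1 else 0 := by
  simp [ext0, cvec, hi]

set_option maxHeartbeats 1000000 in
theorem step2_aux {Y : Type} [NormedAddCommGroup Y] [NormedSpace ℝ Y]
    (D : ℕ → Y →L[ℝ] Y)
    (hDD : ∀ n m y, D n (D m y) = if n = m then D n y else 0)
    (hD : ∀ y, Tendsto (fun n => ∑ l ∈ Finset.range n, D l y) atTop (𝓝 y))
    (hfd : ∀ n, FiniteDimensional ℝ (LinearMap.range (D n).toLinearMap))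
    (N : ℕ → Type) [∀ n, NormedAddCommGroup (N n)] [∀ n, NormedSpace ℝ (N n)]
    [∀ n, FiniteDimensional ℝ (N n)] (L : ℕ → ℕ) (hL : ∀ n, 0 < L n)
    (θ : ∀ n, (Fin (L n) → ℝ) ≃ₗ[ℝ] (LinearMap.range (D n).toLinearMap) × N n)
    (hθ : ∀ n i w, ‖θ n (trc i w)‖ ≤ 9 * ‖θ n w‖) :
    HasSchauderBasis (Y × lp N 1) ∧ ExtPair Y (Y × lp N 1) := by
  classical
  let M : ℕ → Submodule ℝ Y := fun n => LinearMap.range (D n).toLinearMap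
  let π : ∀ n, (Y × lp N 1) →L[ℝ] (M n × N n) := fun n =>
    (((D n).codRestrict (M n) (fun y => ⟨y, rfl⟩)).comp (ContinuousLinearMap.fst ℝ Y (lp N 1))).prod
      ((l1e N n).comp (ContinuousLinearMap.snd ℝ Y (lp N 1)))
  have hπ1 : ∀ n y, ((π n y).1 : Y) = D n y.1 := fun n y => rfl
  have hπ2 : ∀ n y, (π n y).2 = y.2 n := fun n y => rfl
  let ι : ∀ n, (M n × N n) →ₗ[ℝ] (Y × lp N 1) := fun n =>
    (M n).subtype.prodMap (l1s N n).toLinearMap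
  have hι : ∀ n a, ι n a = ((a.1 : Y), l1s N n a.2) := fun n a => rfl
  have hιn : ∀ n a, ‖ι n a‖ = ‖a‖ := fun n a => by
    rw [hι, Prod.norm_def, Prod.norm_def, l1s_norm]; rfl
  have hπι : ∀ n a, π n (ι n a) = a := by
    rintro n ⟨⟨_, ⟨y, rfl⟩⟩, ν⟩
    refine Prod.ext (Subtype.ext ?_) ?_
    · rw [hπ1]
      change D n (D n y) = D n y
      rw [hDD, if_pos rfl]
    · rw [hπ2]; exact l1s_self n ν
  have hπι0 : ∀ n m a, n ≠ m → π n (ι m a) = 0 := by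
    rintro n m ⟨⟨_, ⟨y, rfl⟩⟩, ν⟩ h
    refine Prod.ext (Subtype.ext ?_) ?_
    · rw [hπ1]
      change D n (D m y) = 0
      rw [hDD, if_neg h]
    · rw [hπ2]; exact l1s_ne ν h
  let θs : ∀ n, (M n × N n) →L[ℝ] (Fin (L n) → ℝ) := fun n =>
    LinearMap.toContinuousLinearMap (θ n).symm.toLinearMap
  let ψ : ℕ → ℕ → (Y × lp N 1) →L[ℝ] ℝ := fun n j =>
    if h : j < L n then (ContinuousLinearMap.proj (⟨j, h⟩ : Fin (L n))) ∘L (θs n) ∘L (π n) else 0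
  have hψ : ∀ n j y, ψ n j y = ext0 ((θ n).symm (π n y)) j := by
    intro n j y
    by_cases h : j < L n
    · simp only [ψ, dif_pos h, ext0]; rfl
    · simp only [ψ, dif_neg h, ext0]; rfl
  let w : ℕ → ℕ → Y × lp N 1 := fun n j => ι n (θ n (cvec (L n) j))
  have hpart : ∀ n i y, ∑ j ∈ Finset.range i, ψ n j y • w n j =
      ι n (θ n (trc i ((θ n).symm (π n y)))) := by
    intro n i y
    rw [← sum_cvec, map_sum, map_sum]
    refine Finset.sum_congr rfl fun j _ => ?_
    rw [hψ, map_smul, map_smul]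
  have hfull : ∀ n y, ∑ j ∈ Finset.range (L n), ψ n j y • w n j = ι n (π n y) := by
    intro n y
    rw [hpart]
    have : ∀ u : Fin (L n) → ℝ, trc (L n) u = u := fun u => by ext k; simp [trc]
    rw [this, LinearEquiv.apply_symm_apply]
  constructor
  · refine schauder_of_blocks w ψ L hL ?_ ?_ ?_
    · intro n i m j hi hj
      rw [hψ]
      by_cases h : n = m
      · subst h
        rw [hπι, LinearEquiv.symm_apply_apply, ext0_cvec hi]
        simp
      · rw [hπι0 n m _ h, map_zero, if_neg (fun h' => h h'.1)]
        simp [ext0]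
    · intro y
      have h1 : Tendsto (fun n => ∑ l ∈ Finset.range n, l1s N l (y.2 l)) atTop (𝓝 y.2) :=
        (l1_hasSum_single y.2).tendsto_sum_nat
      have h2 := (hD y.1).prodMk_nhds h1
      refine h2.congr fun n => ?_
      simp only [hfull]
      refine Prod.ext ?_ ?_
      · rw [Prod.fst_sum]; rfl
      · rw [Prod.snd_sum]; rfl
    · intro y
      refine ⟨fun n => 9 * ‖π n y‖, ?_, fun n i _ => ?_⟩
      · have h1 : Tendsto (fun n => D n y.1) atTop (𝓝 0) := by
          have := ((hD y.1).comp (tendsto_add_atTop_nat 1)).sub (hD y.1)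
          rw [sub_self] at this
          refine this.congr fun n => ?_
          simp [Finset.sum_range_succ]
        have h2 : Tendsto (fun n => ‖y.2 n‖) atTop (𝓝 0) := (l1_hasSum y.2).summable.tendsto_atTop_zero
        have h3 : Tendsto (fun n => ‖π n y‖) atTop (𝓝 (max ‖(0 : Y)‖ 0)) := h1.norm.max h2
        rw [norm_zero, max_self] at h3
        simpa using h3.const_mul 9
      · rw [hpart, hιn]
        refine (hθ n i _).trans ?_
        rw [LinearEquiv.apply_symm_apply]
  · let j : Y →ₗᵢ[ℝ] (Y × lp N 1) := ⟨LinearMap.inl ℝ Y (lp N 1), fun y => by simp [Prod.norm_def]⟩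
    have hj : ∀ y, j y = (y, 0) := fun y => rfl
    refine extPair_of_lp j (ContinuousLinearMap.inr ℝ Y (lp N 1)) ?_ ?_
    · rintro ⟨y, ε⟩
      exact ⟨y, ε, by rw [hj]; simp⟩
    · intro n f g hf hg x η hη
      refine ⟨0, 0, ?_⟩
      rw [map_zero, sub_zero, sub_zero]
      have h1 : ∀ f, ‖ContinuousLinearMap.inr ℝ Y (lp N 1) f‖ = ‖f‖ := fun f => by
        simp [Prod.norm_def]
      rw [h1, h1, ← l1_norm_split n f g hf hg]
      have h2 : ‖f + g‖ ≤ ‖ContinuousLinearMap.inr ℝ Y (lp N 1) (f + g) - j x‖ := by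
        refine le_trans ?_ (norm_snd_le _)
        rw [hj]; simp
      linarith

theorem exists_basis_ext {Y : Type} [NormedAddCommGroup Y] [NormedSpace ℝ Y] [CompleteSpace Y]
    (h : HasFDD Y) :
    ∃ (V : Type) (_ : NormedAddCommGroup V) (_ : NormedSpace ℝ V) (_ : CompleteSpace V),
      ExtPair Y V ∧ HasSchauderBasis V := by
  classical
  obtain ⟨T, C, hC, hT, hfd, hconv⟩ := h
  let D : ℕ → Y →L[ℝ] Y := fun n => match n with
    | 0 => T 0
    | n + 1 => T (n + 1) - T n
  have hD0 : ∀ y, D 0 y = T 0 y := fun y => rfl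
  have hDs : ∀ n y, D (n+1) y = T (n+1) y - T n y := fun n y => rfl
  have hTT : ∀ n m y, T n (T m y) = T (min n m) y := fun n m y => by
    rcases le_total n m with h | h
    · rw [min_eq_left h]; exact (hT n m h y).1
    · rw [min_eq_right h]; exact (hT m n h y).2
  have hsum : ∀ n y, ∑ l ∈ Finset.range (n+1), D l y = T n y := by
    intro n y
    induction n with
    | zero => simp [hD0]
    | succ n ih => rw [Finset.sum_range_succ, ih, hDs]; abel
  have hTD : ∀ n m y, T n (D m y) = if m ≤ n then D m y else 0 := by
    intro n m y
    rcases m with _ | m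
    · rw [if_pos (Nat.zero_le _), hD0, hTT]; simp
    · rw [hDs, map_sub, hTT, hTT]
      split_ifs with h
      · rw [min_eq_right h, min_eq_right (by omega)]
      · rw [min_eq_left (by omega), min_eq_left (by omega), sub_self]
  have hDD : ∀ n m y, D n (D m y) = if n = m then D n y else 0 := by
    intro n m y
    rcases n with _ | n
    · rw [hD0, hTD]
      rcases m with _ | m <;> simp
    · rw [hDs, hTD, hTD]
      by_cases h1 : n + 1 = m
      · subst h1; simp
      · rw [if_neg h1]
        by_cases h2 : m ≤ n
        · rw [if_pos h2, if_pos (by omega), sub_self]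
        · rw [if_neg h2, if_neg (by omega), sub_self]
  have hDfd : ∀ n, FiniteDimensional ℝ (LinearMap.range (D n).toLinearMap) := by
    intro n
    have : LinearMap.range (D n).toLinearMap ≤ LinearMap.range (T n).toLinearMap := by
      rintro _ ⟨y, rfl⟩
      refine ⟨D n y, ?_⟩
      change T n (D n y) = D n y
      rw [hTD, if_pos le_rfl]
    have := hfd n
    exact Submodule.finiteDimensional_of_le ‹_ ≤ _›
  have hDc : ∀ y, Tendsto (fun n => ∑ l ∈ Finset.range n, D l y) atTop (𝓝 y) := fun y =>
    (tendsto_add_atTop_iff_nat 1).1 ((hconv y).congr fun n => (hsum n y).symm)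
  choose N i1 i2 i3 L θ hL hθ using fun n => fd_lemma (LinearMap.range (D n).toLinearMap)
  have i4 : ∀ n, CompleteSpace (N n) := fun n => FiniteDimensional.complete ℝ (N n)
  obtain ⟨h1, h2⟩ := step2_aux D hDD hDc hDfd N L hL θ hθ
  exact ⟨Y × lp N 1, inferInstance, inferInstance, inferInstance, h2, h1⟩

end blocks

section final

theorem ExtPair.separable {X Y : Type} [NormedAddCommGroup X] [NormedSpace ℝ X]
    [NormedAddCommGroup Y] [NormedSpace ℝ Y] [TopologicalSpace.SeparableSpace X] (h : ExtPair X Y) :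
    TopologicalSpace.SeparableSpace Y := by
  obtain ⟨j, v, lev, -, hD, -⟩ := h
  have := evc_dense hD (TopologicalSpace.denseRange_denseSeq X)
  exact ⟨⟨_, Set.countable_range _, this⟩⟩

theorem ExtPair.isometry {X Y : Type} [NormedAddCommGroup X] [NormedSpace ℝ X]
    [NormedAddCommGroup Y] [NormedSpace ℝ Y] (h : ExtPair X Y) : Nonempty (X →ₗᵢ[ℝ] Y) := by
  obtain ⟨j, _⟩ := h
  exact ⟨j⟩

theorem index_of_equiv {W : Type*} [NormedAddCommGroup W] [NormedSpace ℝ W] (e : ℕ → W)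
    {Y V : Type} [NormedAddCommGroup Y] [NormedSpace ℝ Y] [NormedAddCommGroup V] [NormedSpace ℝ V]
    (u : V →ₗᵢ[ℝ] Y) {η : Ordinal.{0}} (hη : η < omega1) (h : bourgainIndex e Y ≤ η) :
    bourgainIndex e V ≤ η + 1 := by
  refine index_le_of_hasTreeRank e fun δ hδ => ?_
  refine (hasTreeRank_of_index e hη h hδ).comap (fun l => l.map u) fun l a hla => ⟨⟨u a, by simp⟩, ?_⟩
  exact (map_mem_bourgainTree_iff e u δ _).2 hla

theorem schauder_of_equiv {Y V : Type} [NormedAddCommGroup Y] [NormedSpace ℝ Y]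
    [NormedAddCommGroup V] [NormedSpace ℝ V] (u : Y ≃ₗᵢ[ℝ] V) (h : HasSchauderBasis Y) :
    HasSchauderBasis V := by
  obtain ⟨x, hx⟩ := h
  refine ⟨fun n => u (x n), fun y => ?_⟩
  have key : ∀ a : ℕ → ℝ, Tendsto (fun m => ∑ n ∈ Finset.range m, a n • u (x n)) atTop (𝓝 y) ↔
      Tendsto (fun m => ∑ n ∈ Finset.range m, a n • x n) atTop (𝓝 (u.symm y)) := by
    intro a
    constructor
    · intro h
      have := (u.symm.continuous.tendsto y).comp h
      refine this.congr fun m => ?_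
      simp
    · intro h
      have := (u.continuous.tendsto (u.symm y)).comp h
      rw [LinearIsometryEquiv.apply_symm_apply] at this
      refine this.congr fun m => ?_
      simp
  obtain ⟨a, ha, hu⟩ := hx (u.symm y)
  exact ⟨a, (key a).2 ha, fun b hb => hu b ((key b).1 hb)⟩

theorem exists_SB {W : Type*} [NormedAddCommGroup W] [NormedSpace ℝ W] (e : ℕ → W)
    {X V : Type} [NormedAddCommGroup X] [NormedSpace ℝ X] [NormedAddCommGroup V] [NormedSpace ℝ V]
    [CompleteSpace V] [TopologicalSpace.SeparableSpace V] (i : X →ₗᵢ[ℝ] V) (hV : HasSchauderBasis V)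
    {η : Ordinal.{0}} (hη : η < omega1) (h : bourgainIndex e V ≤ η) :
    ∃ Y : SB, HasSchauderBasis ↥Y.1 ∧ EmbedsIsometrically X ↥Y.1 ∧ bourgainIndex e ↥Y.1 ≤ η + 1 := by
  obtain ⟨u⟩ := banach_mazur V
  have hcl : IsClosed ((LinearMap.range u.toLinearMap : Submodule ℝ CantorC) : Set CantorC) := by
    have := u.isometry.isClosedEmbedding.isClosed_range
    exact this
  let q : V ≃ₗᵢ[ℝ] (LinearMap.range u.toLinearMap) := u.equivRange
  exact ⟨⟨LinearMap.range u.toLinearMap, hcl⟩, schauder_of_equiv q hV,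
    ⟨q.toLinearIsometry.comp i⟩, index_of_equiv e q.symm.toLinearIsometry hη h⟩

end final

/-- **Corollary.** Let `Z` be a minimal Banach space with a (normalized) Schauder
basis `(z_n)` and not containing `ℓ₁`. Then there is a map `f_Z : ω₁ → ω₁` such that
for every `ξ < ω₁`, every separable Banach space `X` with `φ_{NC_Z}(X) ≤ ξ` embeds
isometrically into a Banach space `Y` with a Schauder basis and `φ_{NC_Z}(Y) ≤ f_Z(ξ)`. -/
theorem phiNCZ_uniform_basis_embedding (Z : Type*) [NormedAddCommGroup Z]
    [NormedSpace ℝ Z] [CompleteSpace Z]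
    (z : ℕ → Z) (hbasis : IsSchauderBasis z) (hnorm : ∀ n, ‖z n‖ = 1)
    (hmin : IsMinimal Z) (hZl1 : ¬ Embeds EllOne Z) :
    ∃ f : Ordinal.{0} → Ordinal.{0},
      (∀ ξ : Ordinal.{0}, ξ < omega1 → f ξ < omega1) ∧
      ∀ ξ : Ordinal.{0}, ξ < omega1 →
        ∀ (X : Type) [NormedAddCommGroup X] [NormedSpace ℝ X] [CompleteSpace X]
          [TopologicalSpace.SeparableSpace X],
          bourgainIndex z X ≤ ξ →
          ∃ Y : SB, HasSchauderBasis ↥Y.1 ∧ EmbedsIsometrically X ↥Y.1 ∧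
            bourgainIndex z ↥Y.1 ≤ f ξ := by
  obtain ⟨K, hK⟩ := exists_basisConst hbasis hnorm
  have key : ∀ ξ : Ordinal.{0}, ∃ η : Ordinal.{0}, ξ < omega1 → η < omega1 ∧
      ∀ (X Y : Type) [NormedAddCommGroup X] [NormedSpace ℝ X]
      [TopologicalSpace.SeparableSpace X] [NormedAddCommGroup Y] [NormedSpace ℝ Y]
      [TopologicalSpace.SeparableSpace Y],
      ExtPair X Y → bourgainIndex z X ≤ ξ → bourgainIndex z Y ≤ η := by
    intro ξ
    by_cases hξ : ξ < omega1
    · obtain ⟨η, h1, h2⟩ := g_lemma hK hmin hZl1 hξ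
      exact ⟨η, fun _ => ⟨h1, h2⟩⟩
    · exact ⟨0, fun h => absurd h hξ⟩
  choose g hg using key
  have hg1 : ∀ ξ, ξ < omega1 → g ξ < omega1 := fun ξ h => (hg ξ h).1
  refine ⟨fun ξ => g (g ξ) + 1, fun ξ hξ => ?_, ?_⟩
  · have := omega1_isSuccLimit.succ_lt (hg1 _ (hg1 _ hξ))
    simpa using this
  · intro ξ hξ X _ _ _ _ hX
    obtain ⟨Y0, a1, a2, a3, hext0, hfdd⟩ := exists_fdd (X := X)
    have s0 : TopologicalSpace.SeparableSpace Y0 := hext0.separable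
    obtain ⟨Y1, b1, b2, b3, hext1, hbas⟩ := exists_basis_ext hfdd
    have s1 : TopologicalSpace.SeparableSpace Y1 := hext1.separable
    have h0 := (hg ξ hξ).2 X Y0 hext0 hX
    have h1 := (hg _ (hg1 ξ hξ)).2 Y0 Y1 hext1 h0
    obtain ⟨i⟩ := hext0.isometry
    obtain ⟨i'⟩ := hext1.isometry
    exact exists_SB z (i'.comp i) hbas (hg1 _ (hg1 _ hξ)) h1
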